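/- Let K be the 120-cell, i.e. the regular 4-polytope {5, 3, 3}, and let D2K be the dual of the generalised cube 2^{K*}; D2K is a non-degenerate regular polytope of rank 5 of type {5, 3, 3, 4}. Then the halving group H(D2K) has order 2^{119} · 14400, and Γ(H(D2K)) is a finite regular rank-5 hypertope of type {5, 3, ₃³} (a locally spherical proper hypertope of hyperbolic type). -/

import Mathlib

set_option autoImplicit false

noncomputable section

/-! ### C-groups -/

/-- A family of involutions satisfying the intersection condition
(the family is a *C-group* for the group it generates). -/
def IsCGroup {G : Type*} [Group G] {I : Type*} (ρ : I → G) : Prop :=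
  (∀ i, orderOf (ρ i) = 2) ∧
    ∀ J K : Set I,
      Subgroup.closure (ρ '' J) ⊓ Subgroup.closure (ρ '' K) =
        Subgroup.closure (ρ '' (J ∩ K))

/-! ### Incidence systems -/

/-- The data of an incidence system over a type set `I`. -/
structure IncidenceSystem (I : Type*) where
  X : Type*
  t : X → I
  inc : X → X → Prop

namespace IncidenceSystem

variable {I : Type*} (Γ : IncidenceSystem I)

/-- The axioms of an incidence system: incidence is reflexive, symmetric and
two incident elements of the same type are equal. -/
def IsSystem : Prop :=
  (∀ x, Γ.inc x x) ∧ (∀ x y, Γ.inc x y → Γ.inc y x) ∧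
    ∀ x y, Γ.inc x y → Γ.t x = Γ.t y → x = y

/-- A flag: a set of pairwise incident elements. -/
def IsFlag (F : Set Γ.X) : Prop := ∀ x ∈ F, ∀ y ∈ F, Γ.inc x y

/-- A chamber: a flag whose type set is all of `I`. -/
def IsChamber (C : Set Γ.X) : Prop := Γ.IsFlag C ∧ Γ.t '' C = Set.univ

/-- An incidence geometry: every flag is contained in a chamber. -/
def IsGeometry : Prop :=
  Γ.IsSystem ∧ ∀ F : Set Γ.X, Γ.IsFlag F → ∃ C : Set Γ.X, Γ.IsChamber C ∧ F ⊆ C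

/-- The set of elements of the residue of the flag `F`. -/
def residueSet (F : Set Γ.X) : Set Γ.X := {x | x ∉ F ∧ ∀ y ∈ F, Γ.inc x y}

/-- Thin: every residue of rank one has exactly two elements. -/
def IsThin : Prop :=
  ∀ F : Set Γ.X, Γ.IsFlag F → (Set.univ \ Γ.t '' F).ncard = 1 →
    (Γ.residueSet F).ncard = 2

/-- Connectivity of the incidence graph restricted to a set `S`. -/
def ConnOn (S : Set Γ.X) : Prop :=
  ∀ x ∈ S, ∀ y ∈ S,
    Relation.ReflTransGen (fun a b => a ∈ S ∧ b ∈ S ∧ Γ.inc a b) x y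

/-- Connectivity of the incidence graph. -/
def IsConnected : Prop := Γ.ConnOn Set.univ

/-- Residual connectedness: connected and every residue of rank at least two
is connected. -/
def IsResiduallyConnected : Prop :=
  Γ.IsConnected ∧
    ∀ F : Set Γ.X, Γ.IsFlag F → 2 ≤ (Set.univ \ Γ.t '' F).ncard →
      Γ.ConnOn (Γ.residueSet F)

/-- A hypertope: a thin residually connected incidence geometry. -/
def IsHypertope : Prop := Γ.IsGeometry ∧ Γ.IsThin ∧ Γ.IsResiduallyConnected

/-- The group of type-preserving automorphisms. -/
def typeAut : Subgroup (Equiv.Perm Γ.X) where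
  carrier := {α | (∀ x, Γ.t (α x) = Γ.t x) ∧
    ∀ x y, Γ.inc (α x) (α y) ↔ Γ.inc x y}
  one_mem' := ⟨fun _ => rfl, fun _ _ => Iff.rfl⟩
  mul_mem' := by
    rintro a b ⟨ha1, ha2⟩ ⟨hb1, hb2⟩
    refine ⟨fun x => ?_, fun x y => ?_⟩
    · simp only [Equiv.Perm.mul_apply]; rw [ha1, hb1]
    · simp only [Equiv.Perm.mul_apply]; rw [ha2, hb2]
  inv_mem' := by
    rintro a ⟨ha1, ha2⟩
    refine ⟨fun x => ?_, fun x y => ?_⟩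
    · simpa using (ha1 (a⁻¹ x)).symm
    · simpa using (ha2 (a⁻¹ x) (a⁻¹ y)).symm

/-- Transitivity of the type-preserving automorphism group on chambers. -/
def ChamberTransitive : Prop :=
  ∀ C D : Set Γ.X, Γ.IsChamber C → Γ.IsChamber D →
    ∃ α ∈ Γ.typeAut, ⇑α '' C = D

/-- A regular hypertope: a chamber-transitive hypertope. -/
def IsRegularHypertope : Prop := Γ.IsHypertope ∧ Γ.ChamberTransitive

/-- Flag-transitivity: for each type set, the type-preserving automorphism group
is transitive on flags of that type. -/
def FlagTransitive : Prop :=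
  ∀ F G : Set Γ.X, Γ.IsFlag F → Γ.IsFlag G → Γ.t '' F = Γ.t '' G →
    ∃ α ∈ Γ.typeAut, ⇑α '' F = G

/-- `C'` is the chamber `i`-adjacent to the chamber `C`:  it is a chamber
differing from `C` exactly in its element of type `i`. -/
def IAdjacentChamber (C C' : Set Γ.X) (i : I) : Prop :=
  Γ.IsChamber C' ∧ C' ≠ C ∧ ∀ x ∈ C, Γ.t x ≠ i → x ∈ C'

/-- The stabiliser of a flag in the type-preserving automorphism group. -/
def flagStab (F : Set Γ.X) : Subgroup ↥Γ.typeAut where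
  carrier := {α | ∀ x ∈ F, (↑α : Equiv.Perm Γ.X) x = x}
  one_mem' := by intro x hx; simp
  mul_mem' := by
    intro a b ha hb x hx
    simp only [Subgroup.coe_mul, Equiv.Perm.mul_apply]
    rw [hb x hx, ha x hx]
  inv_mem' := by
    intro a ha x hx
    have h2 := congrArg (⇑(↑a : Equiv.Perm Γ.X)⁻¹) (ha x hx)
    simpa using h2.symm

end IncidenceSystem
/-! ### Coset incidence systems -/

/-- The right coset `H g`. -/
def rCoset {G : Type*} [Group G] (H : Subgroup G) (g : G) : Set G :=
  {x | x * g⁻¹ ∈ H}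

/-- The elements of the coset incidence system: right cosets of the `Gi`,
marked by their type. -/
abbrev cosetX {G : Type*} [Group G] {I : Type*} (Gi : I → Subgroup G) : Type _ :=
  Σ i : I, {s : Set G // ∃ g : G, s = rCoset (Gi i) g}

/-- The coset incidence system `Γ(G; (G_i)_{i ∈ I})`: the `i`-elements are the
right cosets of `G_i`, and two cosets are incident iff they meet. -/
def cosetSystem {G : Type*} [Group G] {I : Type*} (Gi : I → Subgroup G) :
    IncidenceSystem I where
  X := cosetX Gi
  t := fun x => x.1
  inc := fun x y => (x.2.1 ∩ y.2.1).Nonempty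

/-- Right multiplication by `g` on the cosets. -/
def cosetMul {G : Type*} [Group G] {I : Type*} (Gi : I → Subgroup G) (g : G) :
    cosetX Gi → cosetX Gi :=
  fun x => ⟨x.1, ⟨(· * g) '' x.2.1, by
    obtain ⟨s, g₀, hg₀⟩ := x.2
    refine ⟨g₀ * g, ?_⟩
    subst hg₀
    ext y
    simp only [Set.mem_image, rCoset, Set.mem_setOf_eq, mul_inv_rev]
    constructor
    · rintro ⟨z, hz, rfl⟩
      simpa [mul_assoc] using hz
    · intro hy
      exact ⟨y * g⁻¹, by simpa [mul_assoc] using hy, by simp⟩⟩⟩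
/-! ### Abstract polytopes -/

/-- A flag of a partially ordered set: a maximal chain. -/
def IsMaxFlag (P : Type*) [PartialOrder P] (F : Set P) : Prop :=
  IsMaxChain (· ≤ ·) F

/-- Strong flag-connectivity: any two flags `F`, `G` are joined by a sequence of
flags, each containing `F ∩ G`, in which consecutive flags differ in exactly
one face. -/
def StronglyFlagConnected (P : Type*) [PartialOrder P] : Prop :=
  ∀ F G : Set P, IsMaxFlag P F → IsMaxFlag P G →
    Relation.ReflTransGen
      (fun A B => IsMaxFlag P A ∧ IsMaxFlag P B ∧ F ∩ G ⊆ A ∧ F ∩ G ⊆ B ∧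
        (A \ B).ncard = 1 ∧ (B \ A).ncard = 1) F G

/-- An abstract polytope of rank `n`: a bounded poset, graded by the rank
function `rk` ranging from `-1` (the least face) to `n` (the greatest face),
each flag containing exactly one face of each rank (hence `n + 2` faces),
satisfying the diamond condition and strong flag-connectivity. -/
def IsPolytope (P : Type*) [PartialOrder P] (rk : P → ℤ) (n : ℕ) : Prop :=
  (∃ b : P, IsBot b ∧ rk b = -1) ∧
  (∃ tp : P, IsTop tp ∧ rk tp = n) ∧
  StrictMono rk ∧
  (∀ F : Set P, IsMaxFlag P F → ∀ k : ℤ, -1 ≤ k → k ≤ (n : ℤ) → ∃ x ∈ F, rk x = k) ∧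
  (∀ x z : P, x < z → rk z = rk x + 2 → {y : P | x < y ∧ y < z}.ncard = 2) ∧
  StronglyFlagConnected P

/-- Non-degenerate: every section of rank 2 is a `p`-gon with `p ≥ 3`,
i.e. has at least three faces of each intermediate rank. -/
def NonDegenerate (P : Type*) [PartialOrder P] (rk : P → ℤ) : Prop :=
  ∀ F G : P, F < G → rk G = rk F + 3 →
    ∃ H₁ H₂ H₃ : P,
      (F < H₁ ∧ H₁ < G ∧ rk H₁ = rk F + 1) ∧
      (F < H₂ ∧ H₂ < G ∧ rk H₂ = rk F + 1) ∧
      (F < H₃ ∧ H₃ < G ∧ rk H₃ = rk F + 1) ∧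
      H₁ ≠ H₂ ∧ H₁ ≠ H₃ ∧ H₂ ≠ H₃

/-- The group of order automorphisms of a poset (the automorphism group of an
abstract polytope). -/
def orderAut (P : Type*) [PartialOrder P] : Subgroup (Equiv.Perm P) where
  carrier := {α | ∀ x y : P, α x ≤ α y ↔ x ≤ y}
  one_mem' := fun _ _ => Iff.rfl
  mul_mem' := by
    intro a b ha hb x y
    simp only [Equiv.Perm.mul_apply]
    rw [ha, hb]
  inv_mem' := by
    intro a ha x y
    simpa using (ha (a⁻¹ x) (a⁻¹ y)).symm

/-- A regular polytope: the automorphism group is transitive on flags. -/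
def IsRegularPolytope (P : Type*) [PartialOrder P] : Prop :=
  ∀ F G : Set P, IsMaxFlag P F → IsMaxFlag P G →
    ∃ α ∈ orderAut P, ⇑α '' F = G

/-- `Φ` is a base flag and `ϱ` the corresponding family of distinguished
generators: `ϱ i` maps `Φ` to the flag `Φ^i` differing from `Φ` exactly in
its face of rank `i`. -/
def IsDistinguishedGens (P : Type*) [PartialOrder P] (rk : P → ℤ) (n : ℕ)
    (Φ : Set P) (ϱ : Fin n → ↥(orderAut P)) : Prop :=
  IsMaxFlag P Φ ∧
    ∀ i : Fin n,
      ⇑(ϱ i).1 '' Φ ≠ Φ ∧ ∀ x ∈ Φ, rk x ≠ (i : ℤ) → x ∈ ⇑(ϱ i).1 '' Φ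

/-- The incidence system associated with an abstract polytope: the elements are
the proper faces (the faces of ranks `0, …, n-1`), the type of a face is its
rank and incidence is comparability. -/
def polytopeSystem (P : Type*) [PartialOrder P] (rk : P → ℤ) (n : ℕ) :
    IncidenceSystem (Fin n) where
  X := {x : P // 0 ≤ rk x ∧ rk x < (n : ℤ)}
  t := fun x => ⟨(rk x.1).toNat, by
    have h1 := x.2.1; have h2 := x.2.2; omega⟩
  inc := fun x y => x.1 ≤ y.1 ∨ y.1 ≤ x.1

/-! ### The halving operation -/

/-- The halving generators: `ρ i = ϱ i` for `i ≤ n - 2` and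
`ρ (n-1) = ϱ (n-1) * ϱ (n-2) * ϱ (n-1)`. -/
def halvingGens {G : Type*} [Group G] (n : ℕ) (ϱ : Fin n → G) : Fin n → G :=
  fun i =>
    if (i : ℕ) = n - 1 then
      ϱ i * ϱ (⟨n - 2, by have := i.isLt; omega⟩ : Fin n) * ϱ i
    else ϱ i

/-- The lift of a generating family into the subgroup it generates. -/
def liftGens {G : Type*} [Group G] {I : Type*} (ρ : I → G) :
    I → ↥(Subgroup.closure (Set.range ρ)) :=
  fun i => ⟨ρ i, Subgroup.subset_closure (Set.mem_range_self i)⟩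

/-- The subgroups `H_i = ⟨ρ_j : j ≠ i⟩` of the halving group `H(P)`,
where `ρ` is the family of halving generators obtained from `ϱ`. -/
def halvingCosetFamily {G : Type*} [Group G] (n : ℕ) (ϱ : Fin n → G) :
    Fin n → Subgroup ↥(Subgroup.closure (Set.range (halvingGens n ϱ))) :=
  fun i => Subgroup.closure (liftGens (halvingGens n ϱ) '' {j | j ≠ i})

/-- The coset incidence system `Γ(H(P); (H_i))` of the halving group. -/
def halvingCosetSystem {G : Type*} [Group G] (n : ℕ) (ϱ : Fin n → G) :
    IncidenceSystem (Fin n) :=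
  cosetSystem (halvingCosetFamily n ϱ)
/-! ### Generalised cubes -/

/-- The vertex set of a polytope: the faces of rank `0`. -/
abbrev polyVertices (K : Type*) (rk : K → ℤ) : Type _ := {v : K // rk v = 0}

/-- The face `F(x)` of the generalised cube `2^K`:
`F(x) = {y : y_v = x_v whenever the vertex v is not incident to F}`. -/
def cubeFace (K : Type*) [PartialOrder K] (rk : K → ℤ) (F : K)
    (x : polyVertices K rk → Bool) : Set (polyVertices K rk → Bool) :=
  {y | ∀ v : polyVertices K rk, ¬ v.1 ≤ F → y v = x v}

/-- Danzer's generalised cube `2^K`: the improper least face `∅` together with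
the sets `F(x)` for `F` a face of `K` (for `F` the least face of `K` this
gives the singletons `{x}`, the vertices of `2^K`; the faces of rank `i ≥ 1`
are the `F(x)` with `rk F = i - 1 ≥ 0`), ordered by inclusion. -/
abbrev genCube (K : Type*) [PartialOrder K] (rk : K → ℤ) : Type _ :=
  {S : Set (polyVertices K rk → Bool) //
    S = ∅ ∨ ∃ (F : K) (x : polyVertices K rk → Bool), S = cubeFace K rk F x}

/-- The rank function of the dual of a polytope of rank `n`. -/
def dualRk {P : Type*} (rk : P → ℤ) (n : ℕ) : Pᵒᵈ → ℤ :=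
  fun x => (n : ℤ) - 1 - rk (OrderDual.ofDual x)

/-- `D2 K rk n`, for `K` a polytope of rank `n`, is the polytope
`D2K = (2^{K*})*`, the dual of the generalised cube over the dual of `K`. -/
abbrev D2 (K : Type*) [PartialOrder K] (rkK : K → ℤ) (n : ℕ) : Type _ :=
  (genCube Kᵒᵈ (dualRk rkK n))ᵒᵈ

/-! ### Flags and automorphisms of abstract polytopes -/

section Polytope

open scoped Pointwise

variable {P : Type*} [PartialOrder P] {rk : P → ℤ} {n : ℕ}

theorem smul_le_smul_iff_of_orderAut (g : ↥(orderAut P)) (x y : P) :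
    g • x ≤ g • y ↔ x ≤ y :=
  g.2 x y

theorem smul_lt_smul_iff_of_orderAut (g : ↥(orderAut P)) (x y : P) :
    g • x < g • y ↔ x < y := by
  simp only [lt_iff_le_not_ge, smul_le_smul_iff_of_orderAut]

theorem IsMaxFlag.le_total {F : Set P} (hF : IsMaxFlag P F) {x y : P} (hx : x ∈ F)
    (hy : y ∈ F) : x ≤ y ∨ y ≤ x :=
  hF.1.total hx hy

theorem IsMaxFlag.eq_of_subset {F G : Set P} (hF : IsMaxFlag P F) (hG : IsMaxFlag P G)
    (h : F ⊆ G) : F = G :=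
  hF.2 hG.1 h

theorem IsMaxFlag.mem_of_forall {F : Set P} (hF : IsMaxFlag P F) {x : P}
    (h : ∀ y ∈ F, x ≤ y ∨ y ≤ x) : x ∈ F := by
  have hc : IsChain (· ≤ ·) (insert x F) := hF.1.insert fun b hb _ => h b hb
  rw [hF.2 hc (Set.subset_insert x F)]
  exact Set.mem_insert x F

theorem IsMaxFlag.smul {F : Set P} (hF : IsMaxFlag P F) (g : ↥(orderAut P)) :
    IsMaxFlag P (g • F) := by
  have := IsMaxChain.image (⟨g.1, g.2 _ _⟩ : P ≃o P) hF
  exact this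

namespace IsPolytope

theorem le_of_rank_le (hP : IsPolytope P rk n) {F : Set P} (hF : IsMaxFlag P F) {x y : P}
    (hx : x ∈ F) (hy : y ∈ F) (h : rk x ≤ rk y) : x ≤ y := by
  rcases hF.le_total hx hy with h' | h'
  · exact h'
  · rcases h'.lt_or_eq with h'' | h''
    · have := hP.2.2.1 h''
      omega
    · exact h''.ge

theorem eq_of_rank_eq (hP : IsPolytope P rk n) {F : Set P} (hF : IsMaxFlag P F) {x y : P}
    (hx : x ∈ F) (hy : y ∈ F) (h : rk x = rk y) : x = y :=
  le_antisymm (hP.le_of_rank_le hF hx hy h.le) (hP.le_of_rank_le hF hy hx h.ge)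

theorem lt_of_rank_lt (hP : IsPolytope P rk n) {F : Set P} (hF : IsMaxFlag P F) {x y : P}
    (hx : x ∈ F) (hy : y ∈ F) (h : rk x < rk y) : x < y :=
  lt_of_le_of_ne (hP.le_of_rank_le hF hx hy h.le) (by rintro rfl; omega)

theorem neg_one_le_rank (hP : IsPolytope P rk n) (x : P) : -1 ≤ rk x := by
  obtain ⟨b, hb, hrb⟩ := hP.1
  rw [← hrb]
  exact hP.2.2.1.monotone (hb x)

theorem rank_le (hP : IsPolytope P rk n) (x : P) : rk x ≤ n := by
  obtain ⟨b, hb, hrb⟩ := hP.2.1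
  rw [← hrb]
  exact hP.2.2.1.monotone (hb x)

theorem isTop_of_rank (hP : IsPolytope P rk n) {x : P} (h : rk x = n) : IsTop x := by
  obtain ⟨b, hb, hrb⟩ := hP.2.1
  rcases (hb x).lt_or_eq with h' | h'
  · have := hP.2.2.1 h'
    omega
  · rwa [h']

theorem isBot_of_rank (hP : IsPolytope P rk n) {x : P} (h : rk x = -1) : IsBot x := by
  obtain ⟨b, hb, hrb⟩ := hP.1
  rcases (hb x).lt_or_eq with h' | h'
  · have := hP.2.2.1 h'
    omega
  · rwa [← h']

theorem exists_mem_rank (hP : IsPolytope P rk n) {F : Set P} (hF : IsMaxFlag P F) {k : ℤ}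
    (h : -1 ≤ k) (h' : k ≤ n) : ∃ x ∈ F, rk x = k :=
  hP.2.2.2.1 F hF k h h'

theorem rank_add_one_eq_ncard (hP : IsPolytope P rk n) {F : Set P} (hF : IsMaxFlag P F)
    {x : P} (hx : x ∈ F) : rk x + 1 = ({y ∈ F | y < x}.ncard : ℤ) := by
  have himg : rk '' {y ∈ F | y < x} = Set.Ico (-1) (rk x) := by
    ext k
    constructor
    · rintro ⟨y, ⟨_, hlt⟩, rfl⟩
      exact ⟨hP.neg_one_le_rank y, hP.2.2.1 hlt⟩
    · rintro ⟨h1, h2⟩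
      have := hP.rank_le x
      obtain ⟨y, hy, rfl⟩ := hP.exists_mem_rank hF h1 (by omega)
      exact ⟨y, ⟨hy, hP.lt_of_rank_lt hF hy hx h2⟩, rfl⟩
  have hinj : Set.InjOn rk {y ∈ F | y < x} := fun a ha b hb h =>
    hP.eq_of_rank_eq hF ha.1 hb.1 h
  have h1 := hinj.ncard_image
  rw [himg, ← Finset.coe_Ico, Set.ncard_coe_finset, Int.card_Ico] at h1
  have := hP.neg_one_le_rank x
  omega

theorem exists_flag (x : P) : ∃ F, IsMaxFlag P F ∧ x ∈ F := by
  obtain ⟨M, hM, hs⟩ := (IsChain.singleton (r := (· ≤ ·)) (a := x)).exists_maxChain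
  exact ⟨M, hM, hs rfl⟩

theorem rank_unique {rk' : P → ℤ} {n' : ℕ} (hP : IsPolytope P rk n)
    (hP' : IsPolytope P rk' n') : rk = rk' := by
  funext x
  obtain ⟨F, hF, hx⟩ := exists_flag x
  have h1 := hP.rank_add_one_eq_ncard hF hx
  have h2 := hP'.rank_add_one_eq_ncard hF hx
  omega

theorem rank_smul (hP : IsPolytope P rk n) (g : ↥(orderAut P)) (x : P) :
    rk (g • x) = rk x := by
  obtain ⟨F, hF, hx⟩ := exists_flag x
  have h1 := hP.rank_add_one_eq_ncard hF hx
  have h2 := hP.rank_add_one_eq_ncard (hF.smul g) (Set.smul_mem_smul_set hx)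
  have h3 : {y ∈ g • F | y < g • x} = g • {y ∈ F | y < x} := by
    ext y
    simp only [Set.mem_smul_set_iff_inv_smul_mem, Set.mem_ofPred_eq]
    rw [← smul_lt_smul_iff_of_orderAut g (g⁻¹ • y) x, smul_inv_smul]
  rw [h3, Set.ncard_smul_set] at h2
  omega

theorem mem_of_mem_of_agree (hP : IsPolytope P rk n) {F G : Set P} (hF : IsMaxFlag P F)
    (hG : IsMaxFlag P G) {i : ℤ} (h : ∀ x ∈ F, rk x ≠ i → x ∈ G) :
    ∀ x ∈ G, rk x ≠ i → x ∈ F := by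
  intro x hx hi
  obtain ⟨y, hy, hr⟩ := hP.exists_mem_rank hF (hP.neg_one_le_rank x) (hP.rank_le x)
  rwa [← hP.eq_of_rank_eq hG (h y hy (by omega)) hx hr]

/-- Two flags adjacent to a third one at the same rank coincide. -/
theorem adjacent_flag_unique (hP : IsPolytope P rk n) {F A B : Set P} (hF : IsMaxFlag P F)
    (hA : IsMaxFlag P A) (hB : IsMaxFlag P B) (hAF : A ≠ F) (hBF : B ≠ F) {i : ℤ}
    (hFA : ∀ x ∈ F, rk x ≠ i → x ∈ A) (hFB : ∀ x ∈ F, rk x ≠ i → x ∈ B) : A = B := by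
  refine hA.eq_of_subset hB fun a ha => ?_
  by_cases hi : rk a = i
  · have h1 := hP.neg_one_le_rank a
    have h2 := hP.rank_le a
    obtain ⟨f, hf, hfr⟩ := hP.exists_mem_rank hF h1 h2
    obtain ⟨b, hb, hbr⟩ := hP.exists_mem_rank hB h1 h2
    have hne : ∀ C, IsMaxFlag P C → C ≠ F → (∀ x ∈ F, rk x ≠ i → x ∈ C) → ∀ c ∈ C,
        rk c = i → c ≠ f := by
      rintro C hC hCF hFC c hc hci rfl
      refine hCF (hF.eq_of_subset hC fun x hx => ?_).symm
      by_cases hxi : rk x = i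
      · rwa [hP.eq_of_rank_eq hF hx hf (by omega)]
      · exact hFC x hx hxi
    have haf := hne A hA hAF hFA a ha hi
    have hbf := hne B hB hBF hFB b hb (by omega)
    have hlo : -1 < rk a := by
      rcases h1.lt_or_eq with h | h
      · exact h
      · exact absurd (le_antisymm (hP.isBot_of_rank h.symm f)
          (hP.isBot_of_rank (hfr.trans h.symm) a)) haf
    have hhi : rk a < n := by
      rcases h2.lt_or_eq with h | h
      · exact h
      · exact absurd (le_antisymm (hP.isTop_of_rank (hfr.trans h) a)
          (hP.isTop_of_rank h f)) haf
    obtain ⟨p, hp, hpr⟩ := hP.exists_mem_rank hF (k := i - 1) (by omega) (by omega)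
    obtain ⟨q, hq, hqr⟩ := hP.exists_mem_rank hF (k := i + 1) (by omega) (by omega)
    have hpq := hP.lt_of_rank_lt hF hp hq (by omega)
    have h2 := hP.2.2.2.2.1 p q hpq (by omega)
    have hmem : ∀ C, IsMaxFlag P C → (∀ x ∈ F, rk x ≠ i → x ∈ C) → ∀ c ∈ C,
        rk c = i → c ∈ {y | p < y ∧ y < q} := fun C hC hFC c hc hci =>
      ⟨hP.lt_of_rank_lt hC (hFC p hp (by omega)) hc (by omega),
        hP.lt_of_rank_lt hC hc (hFC q hq (by omega)) (by omega)⟩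
    have ma := hmem A hA hFA a ha hi
    have mb := hmem B hB hFB b hb (by omega)
    have mf := hmem F hF (fun x hx _ => hx) f hf (by omega)
    obtain ⟨u, v, huv, hS⟩ := Set.ncard_eq_two.1 h2
    rw [hS] at ma mb mf
    simp only [Set.mem_insert_iff, Set.mem_singleton_iff] at ma mb mf
    have : a = b := by grind
    rwa [this]
  · exact hFB a (hP.mem_of_mem_of_agree hF hA hFA a ha hi) hi

/-- Flags whose differences are singletons differ in the face of a single rank. -/
theorem exists_rank_of_ncard_diff (hP : IsPolytope P rk n) {A B : Set P} (hA : IsMaxFlag P A)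
    (hB : IsMaxFlag P B) (h : (A \ B).ncard = 1) :
    ∃ k : ℕ, k < n ∧ A ≠ B ∧ (∀ x ∈ A, rk x ≠ k → x ∈ B) ∧
      ∀ x ∈ A, rk x = k → x ∉ B := by
  obtain ⟨a, ha⟩ := Set.ncard_eq_one.1 h
  have haA : a ∈ A \ B := by rw [ha]; rfl
  have h1 : -1 < rk a := by
    rcases (hP.neg_one_le_rank a).lt_or_eq with h | h
    · exact h
    · exact absurd (hB.mem_of_forall fun y _ => Or.inl (hP.isBot_of_rank h.symm y)) haA.2
  have h2 : rk a < n := by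
    rcases (hP.rank_le a).lt_or_eq with h | h
    · exact h
    · exact absurd (hB.mem_of_forall fun y _ => Or.inr (hP.isTop_of_rank h y)) haA.2
  refine ⟨(rk a).toNat, by omega, ?_, ?_, ?_⟩
  · rintro rfl
    exact haA.2 haA.1
  · intro x hx hr
    by_contra hxB
    have : x ∈ A \ B := ⟨hx, hxB⟩
    rw [ha] at this
    obtain rfl : x = a := this
    omega
  · intro x hx hr
    rw [hP.eq_of_rank_eq hA hx haA.1 (by omega)]
    exact haA.2

theorem smul_eq_of_smul_flag (hP : IsPolytope P rk n) {F : Set P} (hF : IsMaxFlag P F)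
    {g : ↥(orderAut P)} (h : g • F = F) {x : P} (hx : x ∈ F) : g • x = x :=
  hP.eq_of_rank_eq hF (by rw [← h]; exact Set.smul_mem_smul_set hx) hx (hP.rank_smul g x)

theorem smul_flag_eq_of_forall (hP : IsPolytope P rk n) {F : Set P} (hF : IsMaxFlag P F)
    {g : ↥(orderAut P)} (h : ∀ x ∈ F, 0 ≤ rk x → rk x < n → g • x = x) : g • F = F := by
  refine ((hF.smul g).eq_of_subset hF ?_)
  rintro _ ⟨x, hx, rfl⟩
  have h1 := hP.neg_one_le_rank x
  have h2 := hP.rank_le x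
  have hr := hP.rank_smul g x
  by_cases h3 : rk x = -1
  · exact hF.mem_of_forall fun y _ => Or.inl (hP.isBot_of_rank (hr.trans h3) y)
  by_cases h4 : rk x = n
  · exact hF.mem_of_forall fun y _ => Or.inr (hP.isTop_of_rank (hr.trans h4) y)
  simpa only [h x hx (by omega) (by omega)] using hx

theorem eq_one_of_smul_flag (hP : IsPolytope P rk n) {F : Set P} (hF : IsMaxFlag P F)
    {g : ↥(orderAut P)} (h : g • F = F) : g = 1 := by
  have key : ∀ G, IsMaxFlag P G → g • G = G := by
    intro G hG
    have hpath := Relation.ReflTransGen.mono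
      (p := fun A B => IsMaxFlag P A ∧ IsMaxFlag P B ∧ (A \ B).ncard = 1)
      (fun A B hAB => ⟨hAB.1, hAB.2.1, hAB.2.2.2.2.1⟩) F G (hP.2.2.2.2.2 F G hF hG)
    induction hpath with
    | refl => exact h
    | @tail A B _ hAB ih =>
      obtain ⟨hA, hB, hd⟩ := hAB
      have ih := ih hA
      obtain ⟨k, -, hne, hag, -⟩ := hP.exists_rank_of_ncard_diff hA hB hd
      refine hP.adjacent_flag_unique (i := k) hA (hB.smul g) hB ?_ hne.symm ?_ hag
      · intro hgB
        rw [← ih] at hgB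
        exact hne (smul_left_cancel g hgB).symm
      · intro x hx hr
        rw [← hP.smul_eq_of_smul_flag hA ih hx]
        exact Set.smul_mem_smul_set (hag x hx hr)
  refine Subtype.ext (Equiv.ext fun x => ?_)
  obtain ⟨G, hG, hx⟩ := exists_flag x
  exact hP.smul_eq_of_smul_flag hG (key G hG) hx

theorem eq_of_smul_flag_eq (hP : IsPolytope P rk n) {F : Set P} (hF : IsMaxFlag P F)
    {g h : ↥(orderAut P)} (hgh : g • F = h • F) : g = h := by
  have : h⁻¹ * g = 1 := hP.eq_one_of_smul_flag hF (by rw [mul_smul, hgh, inv_smul_smul])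
  exact (inv_mul_eq_one.1 this).symm

section DistinguishedGens

variable {Φ : Set P} {σ : Fin n → ↥(orderAut P)}

theorem gen_smul_eq (hP : IsPolytope P rk n) (h : IsDistinguishedGens P rk n Φ σ) (i : Fin n)
    {x : P} (hx : x ∈ Φ) (hr : rk x ≠ i) : σ i • x = x := by
  obtain ⟨y, hy, rfl⟩ := (h.2 i).2 x hx hr
  have hry : rk ((σ i).1 y) = rk y := hP.rank_smul (σ i) y
  have : (σ i).1 y = y := hP.eq_of_rank_eq h.1 hx hy hry
  rw [this]
  exact this

theorem gen_smul_flag_ne (h : IsDistinguishedGens P rk n Φ σ) (i : Fin n) : σ i • Φ ≠ Φ :=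
  (h.2 i).1

theorem gen_smul_ne (hP : IsPolytope P rk n) (h : IsDistinguishedGens P rk n Φ σ) (i : Fin n)
    {x : P} (hx : x ∈ Φ) (hr : rk x = i) : σ i • x ≠ x := by
  intro hfix
  refine gen_smul_flag_ne h i (hP.smul_flag_eq_of_forall h.1 fun y hy _ _ => ?_)
  by_cases hy' : rk y = i
  · rwa [hP.eq_of_rank_eq h.1 hy hx (by omega)]
  · exact hP.gen_smul_eq h i hy hy'

theorem gen_mul_self (hP : IsPolytope P rk n) (h : IsDistinguishedGens P rk n Φ σ)
    (i : Fin n) : σ i * σ i = 1 := by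
  refine hP.eq_one_of_smul_flag h.1 ?_
  rw [mul_smul]
  refine hP.adjacent_flag_unique (i := i) (h.1.smul (σ i)) ((h.1.smul _).smul _) h.1 ?_
    (gen_smul_flag_ne h i).symm ?_ ?_
  · exact fun hh => gen_smul_flag_ne h i (smul_left_cancel _ hh)
  · rintro _ ⟨y, hy, rfl⟩ hr
    have hr' : rk y ≠ i := by rwa [← hP.rank_smul (σ i) y]
    have := hP.gen_smul_eq h i hy hr'
    refine Set.smul_mem_smul_set ?_
    exact (h.2 i).2 y hy hr'
  · rintro _ ⟨y, hy, rfl⟩ hr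
    have hr' : rk y ≠ i := by rwa [← hP.rank_smul (σ i) y]
    simpa only [hP.gen_smul_eq h i hy hr'] using hy

theorem gen_inv (hP : IsPolytope P rk n) (h : IsDistinguishedGens P rk n Φ σ)
    (i : Fin n) : (σ i)⁻¹ = σ i :=
  inv_eq_of_mul_eq_one_left (hP.gen_mul_self h i)

theorem gen_smul_gen_smul_eq (hP : IsPolytope P rk n) (h : IsDistinguishedGens P rk n Φ σ)
    {i j : Fin n} (hij : (i : ℕ) + 1 < j ∨ (j : ℕ) + 1 < i) {x : P} (hx : x ∈ Φ)
    (hr : rk x = j) : σ i • σ j • x = σ j • x := by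
  have hj := j.2
  obtain ⟨p, hp, hpr⟩ := hP.exists_mem_rank h.1 (k := (j : ℤ) - 1) (by omega) (by omega)
  obtain ⟨q, hq, hqr⟩ := hP.exists_mem_rank h.1 (k := (j : ℤ) + 1) (by omega) (by omega)
  have hpq := hP.lt_of_rank_lt h.1 hp hq (by omega)
  have h2 := hP.2.2.2.2.1 p q hpq (by omega)
  have fp : ∀ k : Fin n, k = i ∨ k = j → σ k • p = p := fun k hk =>
    hP.gen_smul_eq h k hp (by rcases hk with rfl | rfl <;> omega)
  have fq : ∀ k : Fin n, k = i ∨ k = j → σ k • q = q := fun k hk =>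
    hP.gen_smul_eq h k hq (by rcases hk with rfl | rfl <;> omega)
  have hmap : ∀ k : Fin n, k = i ∨ k = j → ∀ y ∈ {y | p < y ∧ y < q},
      σ k • y ∈ {y | p < y ∧ y < q} := by
    intro k hk y hy
    refine ⟨?_, ?_⟩
    · rw [← fp k hk, smul_lt_smul_iff_of_orderAut]; exact hy.1
    · rw [← fq k hk, smul_lt_smul_iff_of_orderAut]; exact hy.2
  have mx : x ∈ {y | p < y ∧ y < q} :=
    ⟨hP.lt_of_rank_lt h.1 hp hx (by omega), hP.lt_of_rank_lt h.1 hx hq (by omega)⟩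
  have m1 := hmap j (Or.inr rfl) x mx
  have m2 := hmap i (Or.inl rfl) _ m1
  have n1 := hP.gen_smul_ne h j hx hr
  have fx : σ i • x = x := hP.gen_smul_eq h i hx (by omega)
  have n2 : σ i • σ j • x ≠ x := by
    intro hh
    rw [← fx] at hh
    have := smul_left_cancel _ hh
    rw [fx] at this
    exact n1 this
  obtain ⟨u, v, huv, hS⟩ := Set.ncard_eq_two.1 h2
  rw [hS] at mx m1 m2
  simp only [Set.mem_insert_iff, Set.mem_singleton_iff] at mx m1 m2
  grind

theorem gen_comm (hP : IsPolytope P rk n) (h : IsDistinguishedGens P rk n Φ σ)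
    {i j : Fin n} (hij : (i : ℕ) + 1 < j ∨ (j : ℕ) + 1 < i) : σ i * σ j = σ j * σ i := by
  refine hP.eq_of_smul_flag_eq h.1 ?_
  suffices ∀ x ∈ Φ, (σ i * σ j) • x = (σ j * σ i) • x by
    ext y
    constructor
    · rintro ⟨x, hx, rfl⟩
      exact ⟨x, hx, (this x hx).symm⟩
    · rintro ⟨x, hx, rfl⟩
      exact ⟨x, hx, this x hx⟩
  intro x hx
  rw [mul_smul, mul_smul]
  by_cases h1 : rk x = i
  · rw [hP.gen_smul_eq h j hx (by omega), hP.gen_smul_gen_smul_eq h hij.symm hx h1]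
  · rw [hP.gen_smul_eq h i hx h1]
    by_cases h2 : rk x = j
    · rw [hP.gen_smul_gen_smul_eq h hij hx h2]
    · rw [hP.gen_smul_eq h j hx h2, hP.gen_smul_eq h i hx h1]

/-- The pointwise stabiliser of a set of faces of the base flag is generated by the
distinguished generators fixing these faces. -/
theorem mem_closure_of_fix (hP : IsPolytope P rk n) (h : IsDistinguishedGens P rk n Φ σ)
    (J : Set (Fin n)) (g : ↥(orderAut P))
    (hg : ∀ x ∈ Φ, ∀ j ∈ J, rk x = (j : ℕ) → g • x = x) :
    g ∈ Subgroup.closure (σ '' Jᶜ) := by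
  have hpath := hP.2.2.2.2.2 Φ (g • Φ) h.1 (h.1.smul g)
  have key : ∀ A, Relation.ReflTransGen
      (fun A B => IsMaxFlag P A ∧ IsMaxFlag P B ∧ Φ ∩ g • Φ ⊆ A ∧ Φ ∩ g • Φ ⊆ B ∧
        (A \ B).ncard = 1 ∧ (B \ A).ncard = 1) Φ A →
      ∃ t ∈ Subgroup.closure (σ '' Jᶜ), A = t • Φ := by
    intro A hA
    induction hA with
    | refl => exact ⟨1, one_mem _, (one_smul _ _).symm⟩
    | @tail A B _ hAB ih =>
      obtain ⟨t, ht, rfl⟩ := ih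
      obtain ⟨hA, hB, hsA, hsB, hd, -⟩ := hAB
      obtain ⟨k, hk, hne, hag, hnag⟩ := hP.exists_rank_of_ncard_diff hA hB hd
      have hkJ : (⟨k, hk⟩ : Fin n) ∈ Jᶜ := by
        intro hkJ
        obtain ⟨x, hx, hxr⟩ := hP.exists_mem_rank h.1 (k := (k : ℤ)) (by omega) (by omega)
        have hgx := hg x hx _ hkJ hxr
        have hmem : x ∈ Φ ∩ g • Φ := ⟨hx, by
          rw [← hgx]; exact Set.smul_mem_smul_set hx⟩
        exact hnag x (hsA hmem) hxr (hsB hmem)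
      refine ⟨t * σ ⟨k, hk⟩, mul_mem ht (Subgroup.subset_closure ⟨_, hkJ, rfl⟩), ?_⟩
      refine hP.adjacent_flag_unique (i := k) hA hB (h.1.smul _) hne.symm ?_ hag ?_
      · rw [mul_smul]
        exact fun hh => gen_smul_flag_ne h _ (smul_left_cancel _ hh)
      · rintro _ ⟨x, hx, rfl⟩ hr
        have hr' : rk x ≠ k := by rwa [← hP.rank_smul t x]
        rw [mul_smul]
        exact Set.smul_mem_smul_set ((h.2 ⟨k, hk⟩).2 x hx hr')
  obtain ⟨t, ht, htg⟩ := key _ hpath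
  rwa [hP.eq_of_smul_flag_eq h.1 htg]

/-- Conjugating distinguished generators gives the distinguished generators of the image
of the base flag. -/
theorem isDistinguishedGens_conj (hP : IsPolytope P rk n)
    (h : IsDistinguishedGens P rk n Φ σ) (g : ↥(orderAut P)) :
    IsDistinguishedGens P rk n (g • Φ) (fun i => g * σ i * g⁻¹) := by
  refine ⟨h.1.smul g, fun i => ?_⟩
  have : ⇑(g * σ i * g⁻¹).1 '' (g • Φ) = g • σ i • Φ := by
    change (g * σ i * g⁻¹) • g • Φ = _
    rw [mul_smul, mul_smul, inv_smul_smul]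
  refine ⟨?_, ?_⟩
  · rw [this]
    exact fun hh => gen_smul_flag_ne h i (smul_left_cancel _ hh)
  · rw [this]
    rintro _ ⟨x, hx, rfl⟩ hr
    have hr' : rk x ≠ i := by rwa [← hP.rank_smul g x]
    exact Set.smul_mem_smul_set ((h.2 i).2 x hx hr')

/-- Distinguished generators are determined by the base flag. -/
theorem gens_unique (hP : IsPolytope P rk n) (h : IsDistinguishedGens P rk n Φ σ)
    {σ' : Fin n → ↥(orderAut P)} (h' : IsDistinguishedGens P rk n Φ σ') : σ = σ' := by
  funext i
  exact hP.eq_of_smul_flag_eq h.1 (hP.adjacent_flag_unique h.1 (h.1.smul _) (h.1.smul _)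
    (h.2 i).1 (h'.2 i).1 (h.2 i).2 (h'.2 i).2)

/-- In a regular polytope, a partial chain with prescribed ranks is the image of the
corresponding part of the base flag. -/
theorem exists_smul_eq_of_chain (hP : IsPolytope P rk n) (hreg : IsRegularPolytope P)
    {Φ : Set P} (hΦ : IsMaxFlag P Φ) {f : Fin n → P} (hf : ∀ i, f i ∈ Φ)
    (hfr : ∀ i, rk (f i) = (i : ℕ)) (J : Set (Fin n)) (H : Fin n → P)
    (hH : ∀ i ∈ J, rk (H i) = (i : ℕ)) (hle : ∀ i ∈ J, ∀ j ∈ J, i ≤ j → H i ≤ H j) :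
    ∃ g : ↥(orderAut P), ∀ i ∈ J, g • f i = H i := by
  have hc : IsChain (· ≤ ·) (H '' J) := by
    rintro _ ⟨i, hi, rfl⟩ _ ⟨j, hj, rfl⟩ _
    exact (le_total i j).imp (hle i hi j hj) (hle j hj i hi)
  obtain ⟨M, hM, hs⟩ := hc.exists_maxChain
  obtain ⟨α, hα, hαM⟩ := hreg Φ M hΦ hM
  refine ⟨⟨α, hα⟩, fun i hi => ?_⟩
  refine hP.eq_of_rank_eq hM ?_ (hs ⟨i, hi, rfl⟩) ?_
  · rw [← hαM]
    exact ⟨f i, hf i, rfl⟩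
  · rw [hP.rank_smul, hfr, hH i hi]

end DistinguishedGens

end IsPolytope

end Polytope

/-! ### Coset geometries -/

section CosetGeometry

variable {G : Type*} [Group G] {I : Type*} {Gi : I → Subgroup G}

/-- The coset of type `i` containing `g`. -/
def cosetEl (Gi : I → Subgroup G) (i : I) (g : G) : (cosetSystem Gi).X :=
  (⟨i, ⟨rCoset (Gi i) g, g, rfl⟩⟩ : cosetX Gi)

theorem exists_eq_cosetEl (x : (cosetSystem Gi).X) :
    ∃ g, x = cosetEl Gi ((cosetSystem Gi).t x) g := by
  obtain ⟨i, s, g, rfl⟩ := x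
  exact ⟨g, rfl⟩

theorem rCoset_eq_of_mem {H : Subgroup G} {g h : G} (hgh : g * h⁻¹ ∈ H) :
    rCoset H g = rCoset H h := by
  ext x
  have : x * h⁻¹ = x * g⁻¹ * (g * h⁻¹) := by group
  change x * g⁻¹ ∈ H ↔ x * h⁻¹ ∈ H
  rw [this, H.mul_mem_cancel_right hgh]

theorem cosetEl_eq_iff {i : I} {g h : G} :
    cosetEl Gi i g = cosetEl Gi i h ↔ g * h⁻¹ ∈ Gi i := by
  constructor
  · intro hgh
    have h1 : rCoset (Gi i) g = rCoset (Gi i) h := by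
      have := eq_of_heq (Sigma.mk.inj hgh).2
      exact congrArg Subtype.val this
    have h2 : g ∈ rCoset (Gi i) g := by
      change g * g⁻¹ ∈ Gi i
      simp
    rw [h1] at h2
    exact h2
  · intro hgh
    unfold cosetEl
    congr 2
    exact rCoset_eq_of_mem hgh

theorem inc_cosetEl_iff {i j : I} {g h : G} :
    (cosetSystem Gi).inc (cosetEl Gi i g) (cosetEl Gi j h) ↔
      ∃ c, c * g⁻¹ ∈ Gi i ∧ c * h⁻¹ ∈ Gi j :=
  Iff.rfl

theorem inc_cosetEl_same (i j : I) (g : G) :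
    (cosetSystem Gi).inc (cosetEl Gi i g) (cosetEl Gi j g) :=
  inc_cosetEl_iff.2 ⟨g, by simp, by simp⟩

theorem cosetSystem_isSystem : (cosetSystem Gi).IsSystem := by
  refine ⟨?_, ?_, ?_⟩
  · intro x
    obtain ⟨g, hg⟩ := exists_eq_cosetEl x
    rw [hg]
    exact inc_cosetEl_same _ _ g
  · rintro x y ⟨c, hx, hy⟩
    exact ⟨c, hy, hx⟩
  · intro x y hxy ht
    obtain ⟨g, hg⟩ := exists_eq_cosetEl x
    obtain ⟨h, hh⟩ := exists_eq_cosetEl y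
    rw [← ht] at hh
    rw [hg, hh] at hxy
    obtain ⟨c, h1, h2⟩ := inc_cosetEl_iff.1 hxy
    rw [hg, hh, ← cosetEl_eq_iff.2 h1, ← cosetEl_eq_iff.2 h2]

theorem cosetMul_cosetEl (i : I) (g h : G) :
    cosetMul Gi h (cosetEl Gi i g) = cosetEl Gi i (g * h) := by
  unfold cosetMul cosetEl
  congr 2
  ext x
  constructor
  · rintro ⟨y, hy, rfl⟩
    change y * h * (g * h)⁻¹ ∈ Gi i
    rw [mul_inv_rev, mul_assoc, mul_inv_cancel_left]
    exact hy
  · intro hx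
    refine ⟨x * h⁻¹, ?_, inv_mul_cancel_right x h⟩
    change x * h⁻¹ * g⁻¹ ∈ Gi i
    rw [mul_assoc, ← mul_inv_rev]
    exact hx

/-- Right multiplication as a permutation of the cosets. -/
def cosetMulPerm (Gi : I → Subgroup G) (h : G) : Equiv.Perm (cosetSystem Gi).X where
  toFun := cosetMul Gi h
  invFun := cosetMul Gi h⁻¹
  left_inv x := by
    obtain ⟨g, hg⟩ := exists_eq_cosetEl x
    rw [hg, cosetMul_cosetEl, cosetMul_cosetEl, mul_inv_cancel_right]
  right_inv x := by
    obtain ⟨g, hg⟩ := exists_eq_cosetEl x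
    rw [hg, cosetMul_cosetEl, cosetMul_cosetEl, inv_mul_cancel_right]

theorem cosetMulPerm_mem_typeAut (h : G) :
    cosetMulPerm Gi h ∈ (cosetSystem Gi).typeAut := by
  refine ⟨fun x => rfl, fun x y => ?_⟩
  obtain ⟨g, hg⟩ := exists_eq_cosetEl x
  obtain ⟨k, hk⟩ := exists_eq_cosetEl y
  rw [hg, hk]
  change (cosetSystem Gi).inc (cosetMul Gi h _) (cosetMul Gi h _) ↔ _
  rw [cosetMul_cosetEl, cosetMul_cosetEl, inc_cosetEl_iff, inc_cosetEl_iff]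
  constructor
  · rintro ⟨c, h1, h2⟩
    exact ⟨c * h⁻¹, by simpa [mul_assoc] using h1, by simpa [mul_assoc] using h2⟩
  · rintro ⟨c, h1, h2⟩
    exact ⟨c * h, by simpa [mul_assoc] using h1, by simpa [mul_assoc] using h2⟩

/-- Every flag of the coset system consists of cosets with a common element. -/
def FlagsMeet (Gi : I → Subgroup G) : Prop :=
  ∀ (J : Set I) (g : I → G),
    (∀ i ∈ J, ∀ j ∈ J, ∃ c, c * (g i)⁻¹ ∈ Gi i ∧ c * (g j)⁻¹ ∈ Gi j) →
      ∃ c, ∀ i ∈ J, c * (g i)⁻¹ ∈ Gi i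

theorem FlagsMeet.exists_eq_image (hflag : FlagsMeet Gi) {F : Set (cosetSystem Gi).X}
    (hF : (cosetSystem Gi).IsFlag F) :
    ∃ c, F = (fun i => cosetEl Gi i c) '' ((cosetSystem Gi).t '' F) := by
  have hrep : ∀ i : I, ∃ g, i ∈ (cosetSystem Gi).t '' F → cosetEl Gi i g ∈ F := by
    intro i
    by_cases hi : i ∈ (cosetSystem Gi).t '' F
    · obtain ⟨x, hx, rfl⟩ := hi
      obtain ⟨g, hg⟩ := exists_eq_cosetEl x
      exact ⟨g, fun _ => by rwa [← hg]⟩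
    · exact ⟨1, fun h => absurd h hi⟩
  choose g hg using hrep
  obtain ⟨c, hc⟩ := hflag ((cosetSystem Gi).t '' F) g fun i hi j hj =>
    inc_cosetEl_iff.1 (hF _ (hg i hi) _ (hg j hj))
  have hmem : ∀ i ∈ (cosetSystem Gi).t '' F, cosetEl Gi i c ∈ F := fun i hi => by
    rw [cosetEl_eq_iff.2 (hc i hi)]
    exact hg i hi
  refine ⟨c, Set.Subset.antisymm (fun x hx => ?_) ?_⟩
  · have hi : (cosetSystem Gi).t x ∈ (cosetSystem Gi).t '' F := ⟨x, hx, rfl⟩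
    exact ⟨_, hi, cosetSystem_isSystem.2.2 _ _ (hF _ (hmem _ hi) _ hx) rfl⟩
  · rintro _ ⟨i, hi, rfl⟩
    exact hmem i hi

theorem FlagsMeet.exists_eq_range (hflag : FlagsMeet Gi) {C : Set (cosetSystem Gi).X}
    (hC : (cosetSystem Gi).IsChamber C) : ∃ c, C = Set.range fun i => cosetEl Gi i c := by
  obtain ⟨c, hc⟩ := hflag.exists_eq_image hC.1
  rw [hC.2, Set.image_univ] at hc
  exact ⟨c, hc⟩

theorem isChamber_range_cosetEl (c : G) :
    (cosetSystem Gi).IsChamber (Set.range fun i => cosetEl Gi i c) := by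
  refine ⟨?_, ?_⟩
  · rintro _ ⟨i, rfl⟩ _ ⟨j, rfl⟩
    exact inc_cosetEl_same i j c
  · ext i
    exact ⟨fun _ => trivial, fun _ => ⟨_, ⟨i, rfl⟩, rfl⟩⟩

variable {r : I → G}

theorem FlagsMeet.residue_eq (hflag : FlagsMeet Gi)
    (hinter : ∀ (J : Set I) (g : G), (∀ i ∈ J, g ∈ Gi i) → g ∈ Subgroup.closure (r '' Jᶜ))
    (hgen : ∀ i j, j ≠ i → r j ∈ Gi i) (J : Set I) (c : G) :
    (cosetSystem Gi).residueSet ((fun i => cosetEl Gi i c) '' J) =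
      {x | ∃ j ∉ J, ∃ h ∈ Subgroup.closure (r '' Jᶜ), x = cosetEl Gi j (h * c)} := by
  ext x
  constructor
  · rintro ⟨hxF, hx⟩
    have hflag' : (cosetSystem Gi).IsFlag (insert x ((fun i => cosetEl Gi i c) '' J)) := by
      rintro y (rfl | hy) z (rfl | hz)
      · exact cosetSystem_isSystem.1 _
      · exact hx z hz
      · exact cosetSystem_isSystem.2.1 _ _ (hx y hy)
      · obtain ⟨i, -, rfl⟩ := hy
        obtain ⟨j, -, rfl⟩ := hz
        exact inc_cosetEl_same i j c
    obtain ⟨d, hd⟩ := hflag.exists_eq_image hflag'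
    have hel : ∀ y ∈ insert x ((fun i => cosetEl Gi i c) '' J),
        y = cosetEl Gi ((cosetSystem Gi).t y) d := by
      intro y hy
      rw [hd] at hy
      obtain ⟨i, -, rfl⟩ := hy
      rfl
    have hdc : ∀ i ∈ J, d * c⁻¹ ∈ Gi i := fun i hi =>
      cosetEl_eq_iff.1 (hel (cosetEl Gi i c) (Or.inr ⟨i, hi, rfl⟩)).symm
    refine ⟨(cosetSystem Gi).t x, ?_, d * c⁻¹, hinter J _ hdc, ?_⟩
    · intro hJ
      refine hxF ⟨_, hJ, ?_⟩
      refine cosetSystem_isSystem.2.2 _ _ ?_ rfl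
      exact cosetSystem_isSystem.2.1 _ _ (hx _ ⟨_, hJ, rfl⟩)
    · rw [inv_mul_cancel_right]
      exact hel x (Or.inl rfl)
  · rintro ⟨j, hj, h, hh, rfl⟩
    refine ⟨?_, ?_⟩
    · rintro ⟨i, hi, hij⟩
      have : i = j := congrArg (cosetSystem Gi).t hij
      exact hj (this ▸ hi)
    · rintro _ ⟨i, hi, rfl⟩
      have hsub : Subgroup.closure (r '' Jᶜ) ≤ Gi i := by
        rw [Subgroup.closure_le]
        rintro _ ⟨k, hk, rfl⟩
        exact hgen i k fun hki => hk (hki ▸ hi)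
      change (cosetSystem Gi).inc (cosetEl Gi j (h * c)) (cosetEl Gi i c)
      rw [← cosetEl_eq_iff.2 (show h * c * c⁻¹ ∈ Gi i by
        rw [mul_inv_cancel_right]; exact hsub hh)]
      exact inc_cosetEl_same _ _ _

theorem connOn_symm {Γ : IncidenceSystem I} (hΓ : Γ.IsSystem) (S : Set Γ.X) {x y : Γ.X}
    (h : Relation.ReflTransGen (fun a b => a ∈ S ∧ b ∈ S ∧ Γ.inc a b) x y) :
    Relation.ReflTransGen (fun a b => a ∈ S ∧ b ∈ S ∧ Γ.inc a b) y x := by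
  induction h with
  | refl => exact .refl
  | tail _ hab ih => exact .head ⟨hab.2.1, hab.1, hΓ.2.1 _ _ hab.2.2⟩ ih

/-- A criterion for a coset system to be a regular hypertope. -/
theorem cosetSystem_isRegularHypertope [Finite I] [Nontrivial I]
    (hflag : FlagsMeet Gi)
    (hinter : ∀ (J : Set I) (g : G), (∀ i ∈ J, g ∈ Gi i) → g ∈ Subgroup.closure (r '' Jᶜ))
    (hgen : ∀ i j, j ≠ i → r j ∈ Gi i) (hr : ∀ j, r j * r j = 1)
    (hnot : ∀ j, r j ∉ Gi j) :
    (cosetSystem Gi).IsRegularHypertope := by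
  have hconn : ∀ F : Set (cosetSystem Gi).X, (cosetSystem Gi).IsFlag F →
      2 ≤ (Set.univ \ (cosetSystem Gi).t '' F).ncard →
      (cosetSystem Gi).ConnOn ((cosetSystem Gi).residueSet F) := by
    intro F hF h2
    obtain ⟨c, hc⟩ := hflag.exists_eq_image hF
    set J := (cosetSystem Gi).t '' F with hJ
    rw [hc, hflag.residue_eq hinter hgen]
    set S := {x | ∃ j ∉ J, ∃ h ∈ Subgroup.closure (r '' Jᶜ), x = cosetEl Gi j (h * c)} with hS
    have hex : ∀ k : I, ∃ l ∉ J, l ≠ k := by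
      intro k
      obtain ⟨l, hl, hlk⟩ := Set.exists_ne_of_one_lt_ncard (show 1 < _ from h2) k
      exact ⟨l, hl.2, hlk⟩
    have : Nonempty I := inferInstance
    obtain ⟨j₀, hj₀, -⟩ := hex (Classical.arbitrary I)
    have key : ∀ h ∈ Subgroup.closure (r '' Jᶜ), ∀ j ∉ J, Relation.ReflTransGen
        (fun a b => a ∈ S ∧ b ∈ S ∧ (cosetSystem Gi).inc a b)
        (cosetEl Gi j (h * c)) (cosetEl Gi j₀ c) := by
      have hstep : ∀ k, ∀ y ∈ Subgroup.closure (r '' Jᶜ), r k * y ∈ Subgroup.closure (r '' Jᶜ) →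
          (∀ j ∉ J, Relation.ReflTransGen
            (fun a b => a ∈ S ∧ b ∈ S ∧ (cosetSystem Gi).inc a b)
            (cosetEl Gi j (y * c)) (cosetEl Gi j₀ c)) →
          ∀ j ∉ J, Relation.ReflTransGen
            (fun a b => a ∈ S ∧ b ∈ S ∧ (cosetSystem Gi).inc a b)
            (cosetEl Gi j (r k * y * c)) (cosetEl Gi j₀ c) := by
        intro k y hy hky ih j hj
        obtain ⟨l, hl, hlk⟩ := hex k
        have heq : cosetEl Gi l (r k * y * c) = cosetEl Gi l (y * c) :=
          cosetEl_eq_iff.2 (by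
            rw [mul_assoc (r k), mul_inv_cancel_right]
            exact hgen l k hlk.symm)
        refine .head ⟨⟨j, hj, _, hky, rfl⟩, ⟨l, hl, _, hky, rfl⟩, inc_cosetEl_same _ _ _⟩ ?_
        rw [heq]
        exact ih l hl
      intro h hh
      induction hh using Subgroup.closure_induction_left with
      | one =>
        intro j hj
        rw [one_mul]
        exact .single ⟨⟨j, hj, 1, one_mem _, by rw [one_mul]⟩,
          ⟨j₀, hj₀, 1, one_mem _, by rw [one_mul]⟩, inc_cosetEl_same _ _ _⟩
      | mul_left x hx y hy ih =>
        obtain ⟨k, hk, rfl⟩ := hx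
        exact hstep k y hy (mul_mem (Subgroup.subset_closure ⟨k, hk, rfl⟩) hy) ih
      | inv_mul_cancel x hx y hy ih =>
        obtain ⟨k, hk, rfl⟩ := hx
        rw [inv_eq_of_mul_eq_one_left (hr k)]
        exact hstep k y hy (mul_mem (Subgroup.subset_closure ⟨k, hk, rfl⟩) hy) ih
    rintro _ ⟨j, hj, h, hh, rfl⟩ _ ⟨j', hj', h', hh', rfl⟩
    exact (key h hh j hj).trans (connOn_symm cosetSystem_isSystem S (key h' hh' j' hj'))
  refine ⟨⟨⟨cosetSystem_isSystem, ?_⟩, ?_, ?_, hconn⟩, ?_⟩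
  · intro F hF
    obtain ⟨c, hc⟩ := hflag.exists_eq_image hF
    refine ⟨_, isChamber_range_cosetEl c, ?_⟩
    rw [hc]
    exact Set.image_subset_range _ _
  · intro F hF h1
    obtain ⟨c, hc⟩ := hflag.exists_eq_image hF
    set J := (cosetSystem Gi).t '' F with hJ
    rw [hc, hflag.residue_eq hinter hgen]
    obtain ⟨j, hj⟩ := Set.ncard_eq_one.1 h1
    rw [← Set.compl_eq_univ_sdiff] at hj
    have hjJ : j ∉ J := by
      have : j ∈ Jᶜ := by rw [hj]; rfl
      exact this
    have hcl : ∀ h ∈ Subgroup.closure (r '' Jᶜ), h = 1 ∨ h = r j := by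
      intro h hh
      rw [hj, Set.image_singleton] at hh
      induction hh using Subgroup.closure_induction_left with
      | one => exact Or.inl rfl
      | mul_left x hx y hy ih =>
        obtain rfl : x = r j := hx
        rcases ih with rfl | rfl
        · exact Or.inr (mul_one _)
        · exact Or.inl (hr j)
      | inv_mul_cancel x hx y hy ih =>
        obtain rfl : x = r j := hx
        rw [inv_eq_of_mul_eq_one_left (hr j)]
        rcases ih with rfl | rfl
        · exact Or.inr (mul_one _)
        · exact Or.inl (hr j)
    refine Set.ncard_eq_two.2 ⟨cosetEl Gi j c, cosetEl Gi j (r j * c), ?_, ?_⟩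
    · intro heq
      have := cosetEl_eq_iff.1 heq.symm
      rw [mul_inv_cancel_right] at this
      exact hnot j this
    · ext x
      simp only [Set.mem_insert_iff, Set.mem_singleton_iff]
      constructor
      · rintro ⟨i, hi, h, hh, rfl⟩
        obtain rfl : i = j := by
          have : i ∈ Jᶜ := hi
          rw [hj] at this
          exact this
        rcases hcl h hh with rfl | rfl
        · left; rw [one_mul]
        · exact Or.inr rfl
      · rintro (rfl | rfl)
        · exact ⟨j, hjJ, 1, one_mem _, by rw [one_mul]⟩
        · exact ⟨j, hjJ, r j, Subgroup.subset_closure ⟨j, hjJ, rfl⟩, rfl⟩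
  · have hempty : (cosetSystem Gi).IsFlag ∅ := fun x hx => absurd hx (Set.notMem_empty x)
    have h := hconn ∅ hempty (by
      rw [Set.image_empty, Set.sdiff_empty, Set.ncard_univ]
      exact Finite.one_lt_card)
    have huniv : (cosetSystem Gi).residueSet ∅ = Set.univ := by
      ext x
      exact ⟨fun _ => trivial, fun _ => ⟨Set.notMem_empty x,
        fun y hy => absurd hy (Set.notMem_empty y)⟩⟩
    rw [huniv] at h
    exact h
  · intro C D hC hD
    obtain ⟨c, rfl⟩ := hflag.exists_eq_range hC
    obtain ⟨d, rfl⟩ := hflag.exists_eq_range hD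
    refine ⟨_, cosetMulPerm_mem_typeAut (c⁻¹ * d), ?_⟩
    rw [← Set.range_comp]
    congr 1
    funext i
    change cosetMul Gi (c⁻¹ * d) (cosetEl Gi i c) = _
    rw [cosetMul_cosetEl, mul_inv_cancel_left]

end CosetGeometry

/-! ### Twisting the facets of a regular 4-polytope -/

section Twisting

/-- A regular 4-polytope `K` with base flag `Φ` and distinguished generators `σ`, an indexing
`fct` of its facets by `V`, and a copy `T` of the semidirect product of `V → Bool` with the
automorphism group of `K` inside a group `H`. -/
structure FacetTwist (K : Type*) [PartialOrder K] (rk : K → ℤ) (V H : Type*) [Group H]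
    [MulAction ↥(orderAut K) V] where
  Φ : Set K
  σ : Fin 4 → ↥(orderAut K)
  f : Fin 4 → K
  fct : V → K
  v₀ : V
  T : (V → Bool) → ↥(orderAut K) → H
  isPolytope : IsPolytope K rk 4
  isRegular : IsRegularPolytope K
  gens : IsDistinguishedGens K rk 4 Φ σ
  f_mem : ∀ i, f i ∈ Φ
  rk_f : ∀ i, rk (f i) = (i : ℕ)
  fct_inj : Function.Injective fct
  rk_fct : ∀ v, rk (fct v) = 3
  fct_smul : ∀ (g : ↥(orderAut K)) v, fct (g • v) = g • fct v
  fct_v₀ : fct v₀ = f 3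
  T_mul : ∀ a g b h, T a g * T b h = T (a + fun v => b (g⁻¹ • v)) (g * h)
  T_inj : ∀ a g b h, T a g = T b h → a = b ∧ g = h

namespace FacetTwist

variable {K : Type*} [PartialOrder K] {rk : K → ℤ} {V H : Type*} [Group H]
  [MulAction ↥(orderAut K) V] (D : FacetTwist K rk V H)

/-- The indicator vector of a facet. -/
def ind (v : V) : V → Bool := open Classical in Pi.single v 1

theorem ind_apply_self (v : V) : ind v v = 1 := by
  simp [ind]

theorem ind_apply_of_ne {v w : V} (h : w ≠ v) : ind v w = 0 := by
  simp [ind, h]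

theorem ind_smul (g : ↥(orderAut K)) (v : V) : (fun w => ind v (g⁻¹ • w)) = ind (g • v) := by
  funext w
  by_cases h : w = g • v
  · rw [h, inv_smul_smul, ind_apply_self, ind_apply_self]
  · rw [ind_apply_of_ne h, ind_apply_of_ne fun h' => h (by rw [← h', smul_inv_smul])]

theorem ind_add_ind_smul (g : ↥(orderAut K)) (v w : V) :
    (fun u => (ind v + ind w) (g⁻¹ • u)) = ind (g • v) + ind (g • w) := by
  rw [← ind_smul, ← ind_smul]
  rfl

theorem add_self_bool (a : V → Bool) : a + a = 0 := by
  funext v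
  exact BooleanRing.add_self (a v)

theorem eq_of_add_eq_zero_bool {a b : V → Bool} (h : a + b = 0) : a = b := by
  rw [← add_zero a, ← add_self_bool b, ← add_assoc, h, zero_add]

/-- The sum of the coordinates vanishes. -/
def IsEven [Fintype V] (a : V → Bool) : Prop := ∑ v, a v = 0

section Even

variable [Fintype V]

theorem isEven_zero : IsEven (0 : V → Bool) :=
  Finset.sum_const_zero

theorem IsEven.add {a b : V → Bool} (ha : IsEven a) (hb : IsEven b) : IsEven (a + b) := by
  unfold IsEven at *
  simp only [Pi.add_apply, Finset.sum_add_distrib, ha, hb, add_zero]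

theorem sum_ind (v : V) : ∑ w, ind v w = 1 := by
  classical
  rw [Finset.sum_eq_single v (fun w _ h => ind_apply_of_ne h)
    (fun h => absurd (Finset.mem_univ v) h), ind_apply_self]

theorem isEven_ind_add_ind (v w : V) : IsEven (ind v + ind w) := by
  unfold IsEven
  simp only [Pi.add_apply, Finset.sum_add_distrib, sum_ind]
  rfl

theorem IsEven.smul {a : V → Bool} (ha : IsEven a) (g : ↥(orderAut K)) :
    IsEven fun v => a (g⁻¹ • v) := by
  unfold IsEven at *
  rw [← ha]
  exact Equiv.sum_comp (MulAction.toPerm g⁻¹) a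

end Even

theorem T_zero_one : D.T 0 1 = 1 := by
  have : D.T 0 1 * D.T 0 1 = D.T 0 1 := by
    rw [D.T_mul, mul_one]
    congr 1
  exact mul_eq_left.1 this

theorem T_zero_mul (g : ↥(orderAut K)) (b : V → Bool) (h : ↥(orderAut K)) :
    D.T 0 g * D.T b h = D.T (fun v => b (g⁻¹ • v)) (g * h) := by
  rw [D.T_mul, zero_add]

theorem T_zero_mul_zero (g h : ↥(orderAut K)) : D.T 0 g * D.T 0 h = D.T 0 (g * h) :=
  D.T_zero_mul g 0 h

theorem T_mul_zero (a : V → Bool) (g h : ↥(orderAut K)) : D.T a g * D.T 0 h = D.T a (g * h) := by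
  rw [D.T_mul]
  congr 1
  exact add_zero a

theorem T_one_mul (a b : V → Bool) (h : ↥(orderAut K)) : D.T a 1 * D.T b h = D.T (a + b) h := by
  rw [D.T_mul, one_mul]
  simp only [inv_one, one_smul]

theorem T_inv (a : V → Bool) (g : ↥(orderAut K)) :
    (D.T a g)⁻¹ = D.T (fun v => a (g • v)) g⁻¹ := by
  refine inv_eq_of_mul_eq_one_right ?_
  rw [D.T_mul, mul_inv_cancel, ← D.T_zero_one]
  congr 1
  simp only [smul_inv_smul]
  exact add_self_bool a

/-- The automorphisms of `K` inside the twisted group. -/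
def homT : ↥(orderAut K) →* H where
  toFun := D.T 0
  map_one' := D.T_zero_one
  map_mul' g h := (D.T_zero_mul_zero g h).symm

theorem orderOf_T_zero (g : ↥(orderAut K)) : orderOf (D.T 0 g) = orderOf g :=
  orderOf_injective D.homT (fun _ _ h => (D.T_inj _ _ _ _ h).2) g

theorem σ_smul_f {i j : Fin 4} (h : i ≠ j) : D.σ i • D.f j = D.f j :=
  D.isPolytope.gen_smul_eq D.gens i (D.f_mem j) (by rw [D.rk_f]; omega)

theorem σ_smul_v₀ {i : Fin 4} (h : i ≠ 3) : D.σ i • D.v₀ = D.v₀ :=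
  D.fct_inj (by rw [D.fct_smul, D.fct_v₀, D.σ_smul_f h])

theorem σ_smul_v₀_ne : D.σ 3 • D.v₀ ≠ D.v₀ := by
  intro h
  have := congrArg D.fct h
  rw [D.fct_smul, D.fct_v₀] at this
  exact D.isPolytope.gen_smul_ne D.gens 3 (D.f_mem 3) (D.rk_f 3) this

theorem σ_mul_self (i : Fin 4) : D.σ i * D.σ i = 1 :=
  D.isPolytope.gen_mul_self D.gens i

theorem f_le_f {i j : Fin 4} (h : i ≤ j) : D.f i ≤ D.f j :=
  D.isPolytope.le_of_rank_le D.gens.1 (D.f_mem i) (D.f_mem j) (by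
    rw [D.rk_f, D.rk_f]; exact_mod_cast h)

theorem f_le_v₀ (i : Fin 4) : D.f i ≤ D.fct D.v₀ := by
  rw [D.fct_v₀]
  exact D.f_le_f (Fin.le_last i)

theorem mem_closure_σ (J : Set (Fin 4)) (g : ↥(orderAut K)) (hg : ∀ j ∈ J, g • D.f j = D.f j) :
    g ∈ Subgroup.closure (D.σ '' Jᶜ) := by
  refine D.isPolytope.mem_closure_of_fix D.gens J g fun x hx j hj hr => ?_
  rw [D.isPolytope.eq_of_rank_eq D.gens.1 hx (D.f_mem j) (by rw [hr, D.rk_f])]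
  exact hg j hj

/-- The distinguished generators of the twisted polytope. -/
def ϱ : Fin 5 → H := Fin.snoc (fun i : Fin 4 => D.T 0 (D.σ i)) (D.T (ind D.v₀) 1)

theorem ϱ_castSucc (i : Fin 4) : D.ϱ i.castSucc = D.T 0 (D.σ i) :=
  Fin.snoc_castSucc (α := fun _ => H) _ _ i

theorem ϱ_last : D.ϱ (Fin.last 4) = D.T (ind D.v₀) 1 :=
  Fin.snoc_last (α := fun _ => H) _ _

/-- The halving generators. -/
def ρ : Fin 5 → H := halvingGens 5 D.ϱ

theorem ρ_castSucc (i : Fin 4) : D.ρ i.castSucc = D.T 0 (D.σ i) := by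
  rw [← D.ϱ_castSucc]
  exact if_neg (by have := i.isLt; simp; omega)

theorem ρ_last : D.ρ (Fin.last 4) = D.T (ind D.v₀ + ind (D.σ 3 • D.v₀)) (D.σ 3) := by
  have : D.ρ (Fin.last 4) = D.ϱ (Fin.last 4) * D.ϱ (Fin.castSucc 3) * D.ϱ (Fin.last 4) := by
    unfold ρ halvingGens
    exact if_pos rfl
  rw [this, D.ϱ_castSucc, D.ϱ_last, D.T_one_mul, D.T_mul, add_zero, ind_smul, mul_one]

theorem ρ_mul_self (j : Fin 5) : D.ρ j * D.ρ j = 1 := by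
  induction j using Fin.lastCases with
  | last =>
    rw [D.ρ_last, D.T_mul, D.σ_mul_self, ← D.T_zero_one]
    congr 1
    rw [ind_add_ind_smul, smul_smul, D.σ_mul_self, one_smul, add_comm (ind D.v₀)]
    exact add_self_bool _
  | cast i => rw [D.ρ_castSucc, D.T_zero_mul_zero, D.σ_mul_self, D.T_zero_one]

/-- The condition describing the elements of the maximal parabolic subgroups of the halving
group. -/
def Cond (i : Fin 5) (a : V → Bool) (g : ↥(orderAut K)) : Prop :=
  if i = 4 then a = 0
  else if i = 3 then a = ind D.v₀ + ind (g • D.v₀)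
  else ∀ k : Fin 4, k.castSucc = i →
    g • D.f k = D.f k ∧ ∀ v, ¬ D.f k ≤ D.fct v → a v = 0

theorem cond_four {a : V → Bool} {g : ↥(orderAut K)} : D.Cond 4 a g ↔ a = 0 := Iff.rfl

theorem cond_three {a : V → Bool} {g : ↥(orderAut K)} :
    D.Cond 3 a g ↔ a = ind D.v₀ + ind (g • D.v₀) := Iff.rfl

theorem cond_castSucc {k : Fin 4} (hk : k ≠ 3) {a : V → Bool} {g : ↥(orderAut K)} :
    D.Cond k.castSucc a g ↔ g • D.f k = D.f k ∧ ∀ v, ¬ D.f k ≤ D.fct v → a v = 0 := by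
  have h1 : k.castSucc ≠ 4 := by
    have := k.isLt; intro h; have := congrArg Fin.val h; simp at this; omega
  have h2 : k.castSucc ≠ 3 := by
    intro h; apply hk; exact Fin.castSucc_injective 4 h
  rw [Cond, if_neg h1, if_neg h2]
  constructor
  · exact fun h => h k rfl
  · intro h l hl
    rwa [Fin.castSucc_injective 4 hl]

theorem fin_five_cases (i : Fin 5) : i = 4 ∨ i = 3 ∨ ∃ k : Fin 4, k ≠ 3 ∧ i = k.castSucc := by
  induction i using Fin.lastCases with
  | last => exact Or.inl rfl
  | cast k =>
    by_cases hk : k = 3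
    · exact Or.inr (Or.inl (by rw [hk]; rfl))
    · exact Or.inr (Or.inr ⟨k, hk, rfl⟩)

theorem cond_mul {i : Fin 5} {a b : V → Bool} {g h : ↥(orderAut K)} (ha : D.Cond i a g)
    (hb : D.Cond i b h) : D.Cond i (a + fun v => b (g⁻¹ • v)) (g * h) := by
  rcases fin_five_cases i with rfl | rfl | ⟨k, hk, rfl⟩
  · rw [cond_four] at *
    rw [ha, hb]
    rfl
  · rw [cond_three] at *
    have : (fun v => b (g⁻¹ • v)) = ind (g • D.v₀) + ind ((g * h) • D.v₀) := by
      rw [hb, mul_smul, ind_add_ind_smul]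
    rw [this, ha, add_assoc, ← add_assoc (ind (g • D.v₀)), add_self_bool, zero_add]
  · rw [D.cond_castSucc hk] at *
    refine ⟨by rw [mul_smul, hb.1, ha.1], fun v hv => ?_⟩
    have : ¬ D.f k ≤ D.fct (g⁻¹ • v) := by
      rwa [D.fct_smul, ← smul_le_smul_iff_of_orderAut g, smul_inv_smul, ha.1]
    change a v + b (g⁻¹ • v) = 0
    rw [ha.2 v hv, hb.2 _ this]
    rfl

theorem cond_ρ [Fintype V] {i j : Fin 5} (hij : j ≠ i) :
    ∃ a g, D.ρ j = D.T a g ∧ IsEven a ∧ D.Cond i a g := by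
  induction j using Fin.lastCases with
  | last =>
    refine ⟨_, _, D.ρ_last, isEven_ind_add_ind _ _, ?_⟩
    rcases fin_five_cases i with rfl | rfl | ⟨k, hk, rfl⟩
    · exact absurd rfl hij
    · exact D.cond_three.2 rfl
    · refine (D.cond_castSucc hk).2 ⟨D.σ_smul_f hk.symm, fun v hv => ?_⟩
      have h1 : v ≠ D.v₀ := by
        rintro rfl
        exact hv (D.f_le_v₀ k)
      have h2 : v ≠ D.σ 3 • D.v₀ := by
        rintro rfl
        apply hv
        rw [D.fct_smul, ← D.σ_smul_f hk.symm, smul_le_smul_iff_of_orderAut]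
        exact D.f_le_v₀ k
      change ind _ v + ind _ v = 0
      rw [ind_apply_of_ne h1, ind_apply_of_ne h2]
      rfl
  | cast l =>
    refine ⟨_, _, D.ρ_castSucc l, isEven_zero, ?_⟩
    rcases fin_five_cases i with rfl | rfl | ⟨k, hk, rfl⟩
    · rfl
    · rw [cond_three, D.σ_smul_v₀, add_self_bool]
      rintro rfl
      exact hij rfl
    · exact (D.cond_castSucc hk).2 ⟨D.σ_smul_f fun h => hij (by rw [h]), fun _ _ => rfl⟩

theorem exists_of_mem_closure [Fintype V] {i : Fin 5} {x : H}
    (hx : x ∈ Subgroup.closure (D.ρ '' {j | j ≠ i})) :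
    ∃ a g, x = D.T a g ∧ IsEven a ∧ D.Cond i a g := by
  have hstep : ∀ j, j ≠ i → ∀ y, (∃ a g, y = D.T a g ∧ IsEven a ∧ D.Cond i a g) →
      ∃ a g, D.ρ j * y = D.T a g ∧ IsEven a ∧ D.Cond i a g := by
    rintro j hj _ ⟨b, h, rfl, hb, hbh⟩
    obtain ⟨a, g, hag, ha, hc⟩ := D.cond_ρ hj
    exact ⟨_, _, by rw [hag, D.T_mul], ha.add (hb.smul g), D.cond_mul hc hbh⟩
  induction hx using Subgroup.closure_induction_left with
  | one =>
    refine ⟨0, 1, D.T_zero_one.symm, isEven_zero, ?_⟩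
    rcases fin_five_cases i with rfl | rfl | ⟨k, hk, rfl⟩
    · rfl
    · rw [cond_three, one_smul, add_self_bool]
    · exact (D.cond_castSucc hk).2 ⟨one_smul _ _, fun _ _ => rfl⟩
  | mul_left x hx y hy ih =>
    obtain ⟨j, hj, rfl⟩ := hx
    exact hstep j hj y ih
  | inv_mul_cancel x hx y hy ih =>
    obtain ⟨j, hj, rfl⟩ := hx
    rw [inv_eq_of_mul_eq_one_left (D.ρ_mul_self j)]
    exact hstep j hj y ih

theorem T_zero_mem_closure {A : Set (Fin 4)} {B : Set (Fin 5)} (h : ∀ i ∈ A, i.castSucc ∈ B)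
    {g : ↥(orderAut K)} (hg : g ∈ Subgroup.closure (D.σ '' A)) :
    D.T 0 g ∈ Subgroup.closure (D.ρ '' B) := by
  have : Subgroup.closure (D.σ '' A) ≤ (Subgroup.closure (D.ρ '' B)).comap D.homT := by
    rw [Subgroup.closure_le]
    rintro _ ⟨i, hi, rfl⟩
    exact Subgroup.subset_closure ⟨_, h i hi, D.ρ_castSucc i⟩
  exact this hg

theorem conj_T_zero (g : ↥(orderAut K)) :
    D.T (ind D.v₀) 1 * D.T 0 g * (D.T (ind D.v₀) 1)⁻¹ = D.T (ind D.v₀ + ind (g • D.v₀)) g := by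
  rw [D.T_inv, D.T_one_mul, D.T_mul]
  simp only [one_smul, add_zero, inv_one, mul_one]
  rw [ind_smul]

theorem T_conj_mem_closure {A : Set (Fin 4)} {B : Set (Fin 5)}
    (h : ∀ i ∈ A, i ≠ 3 → i.castSucc ∈ B) (h4 : 4 ∈ B)
    {g : ↥(orderAut K)} (hg : g ∈ Subgroup.closure (D.σ '' A)) :
    D.T (ind D.v₀ + ind (g • D.v₀)) g ∈ Subgroup.closure (D.ρ '' B) := by
  have : Subgroup.closure (D.σ '' A) ≤ (Subgroup.closure (D.ρ '' B)).comap
      ((MulAut.conj (D.T (ind D.v₀) 1)).toMonoidHom.comp D.homT) := by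
    rw [Subgroup.closure_le]
    rintro _ ⟨i, hi, rfl⟩
    refine Subgroup.subset_closure ?_
    change D.T (ind D.v₀) 1 * D.T 0 (D.σ i) * (D.T (ind D.v₀) 1)⁻¹ ∈ _
    rw [D.conj_T_zero]
    by_cases hi3 : i = 3
    · exact ⟨_, h4, by rw [hi3]; exact D.ρ_last⟩
    · exact ⟨_, h i hi hi3, by rw [D.σ_smul_v₀ hi3, add_self_bool]; exact D.ρ_castSucc i⟩
  rw [← D.conj_T_zero]
  exact this hg

theorem ind_add_ind_mem {A : Set (Fin 4)} {B : Set (Fin 5)} (h : ∀ i ∈ A, i.castSucc ∈ B)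
    (h4 : 4 ∈ B) {g : ↥(orderAut K)} (hg : g ∈ Subgroup.closure (D.σ '' A)) :
    D.T (ind D.v₀ + ind (g • D.v₀)) 1 ∈ Subgroup.closure (D.ρ '' B) := by
  have h1 := D.T_conj_mem_closure (fun i hi _ => h i hi) h4 hg
  have h2 := D.T_zero_mem_closure h (inv_mem hg)
  have := mul_mem h1 h2
  rwa [D.T_mul_zero, mul_inv_cancel] at this

theorem sum_mem [Fintype V] {N : Subgroup H} {S : Set V}
    (hN : ∀ v ∈ S, D.T (ind D.v₀ + ind v) 1 ∈ N) {a : V → Bool} (ha : IsEven a)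
    (haS : ∀ v, v ∉ S → a v = 0) : D.T a 1 ∈ N := by
  classical
  have key : ∀ s : Finset V, (∀ v ∈ s, v ∈ S) →
      D.T (∑ v ∈ s, (ind D.v₀ + ind v)) 1 ∈ N := by
    intro s
    induction s using Finset.induction_on with
    | empty =>
      intro _
      rw [Finset.sum_empty, D.T_zero_one]
      exact one_mem N
    | insert v s hv ih =>
      intro hs
      rw [Finset.sum_insert hv, ← D.T_one_mul]
      exact mul_mem (hN v (hs v (Finset.mem_insert_self v s)))
        (ih fun w hw => hs w (Finset.mem_insert_of_mem hw))
  have hsupp : ∑ v ∈ Finset.univ.filter (fun v => a v = 1), (ind D.v₀ + ind v) = a := by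
    have h1 : ∀ w : V, ∑ v ∈ Finset.univ.filter (fun v => a v = 1), (ind w : V → Bool) = 
        (∑ v, a v) • ind w := by
      intro w
      funext x
      rw [Finset.sum_filter, Finset.sum_apply, Pi.smul_apply, smul_eq_mul, Finset.sum_mul]
      refine Finset.sum_congr rfl fun v _ => ?_
      split_ifs with h
      · rw [h, one_mul]
      · rw [show a v = 0 from Bool.eq_false_iff.2 h, zero_mul]; rfl
    rw [Finset.sum_add_distrib, h1, ha, zero_smul, zero_add]
    funext x
    rw [Finset.sum_apply, Finset.sum_filter]
    rw [Finset.sum_eq_single x]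
    · split_ifs with h
      · rw [ind_apply_self, h]
      · exact (Bool.eq_false_iff.2 h).symm
    · intro v _ hvx
      rw [ind_apply_of_ne hvx.symm, ite_self]
    · exact fun h => absurd (Finset.mem_univ x) h
  rw [← hsupp]
  refine key _ fun v hv => ?_
  by_contra hvS
  have h0 := haS v hvS
  have h1 := (Finset.mem_filter.1 hv).2
  rw [h0] at h1
  exact zero_ne_one h1

theorem exists_smul_v₀ {J : Set (Fin 4)} (hJ : 3 ∉ J) {G : Fin 4 → K}
    (hG : ∀ i ∈ J, rk (G i) = (i : ℕ)) (hle : ∀ i ∈ J, ∀ j ∈ J, i ≤ j → G i ≤ G j) {v : V}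
    (hv : ∀ i ∈ J, G i ≤ D.fct v) :
    ∃ g : ↥(orderAut K), (∀ i ∈ J, g • D.f i = G i) ∧ g • D.v₀ = v := by
  classical
  have hne : ∀ i ∈ J, i ≠ 3 := fun i hi h => hJ (h ▸ hi)
  obtain ⟨g, hg⟩ := D.isPolytope.exists_smul_eq_of_chain D.isRegular D.gens.1 D.f_mem D.rk_f
    (insert 3 J) (Function.update G 3 (D.fct v)) (by
      rintro i (rfl | hi)
      · rw [Function.update_self, D.rk_fct]; rfl
      · rw [Function.update_of_ne (hne i hi), hG i hi]) (by
      rintro i (rfl | hi) j (rfl | hj) hij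
      · exact le_rfl
      · exact absurd (le_antisymm (Fin.le_last j) hij) (hne j hj)
      · rw [Function.update_self, Function.update_of_ne (hne i hi)]
        exact hv i hi
      · rw [Function.update_of_ne (hne i hi), Function.update_of_ne (hne j hj)]
        exact hle i hi j hj hij)
  refine ⟨g, fun i hi => ?_, D.fct_inj ?_⟩
  · rw [hg i (Or.inr hi), Function.update_of_ne (hne i hi)]
  · rw [D.fct_smul, D.fct_v₀, hg 3 (Or.inl rfl), Function.update_self]

theorem mem_closure_of_cond [Fintype V] (J : Set (Fin 5)) {a : V → Bool} {g : ↥(orderAut K)}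
    (ha : IsEven a) (hc : ∀ i ∈ J, D.Cond i a g) :
    D.T a g ∈ Subgroup.closure (D.ρ '' Jᶜ) := by
  have hfix : ∀ k : Fin 4, k ≠ 3 → k.castSucc ∈ J → g • D.f k = D.f k := fun k hk hkJ =>
    ((D.cond_castSucc hk).1 (hc _ hkJ)).1
  by_cases h4 : (4 : Fin 5) ∈ J
  · obtain rfl := D.cond_four.1 (hc 4 h4)
    refine D.T_zero_mem_closure (A := {k | k.castSucc ∈ J}ᶜ) (fun i hi => hi) ?_
    refine D.mem_closure_σ _ _ fun k hk => ?_
    by_cases hk3 : k = 3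
    · subst hk3
      have := eq_of_add_eq_zero_bool (D.cond_three.1 (hc 3 hk)).symm
      have h1 : g • D.v₀ = D.v₀ := by
        by_contra hne
        have h2 := congrFun this D.v₀
        rw [ind_apply_self, ind_apply_of_ne (Ne.symm hne)] at h2
        exact one_ne_zero h2
      rw [← D.fct_v₀, ← D.fct_smul, h1]
    · exact hfix k hk3 hk
  · by_cases h3 : (3 : Fin 5) ∈ J
    · rw [D.cond_three.1 (hc 3 h3)]
      refine D.T_conj_mem_closure (A := {k | k ≠ 3 ∧ k.castSucc ∈ J}ᶜ) ?_ h4 ?_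
      · exact fun i hi h hJ => hi ⟨h, hJ⟩
      · exact D.mem_closure_σ _ _ fun k hk => hfix k hk.1 hk.2
    · have hA : ∀ i ∈ {k : Fin 4 | k.castSucc ∈ J}ᶜ, i.castSucc ∈ Jᶜ := fun i hi => hi
      have hne : ∀ k : Fin 4, k.castSucc ∈ J → k ≠ 3 := by
        rintro k hk rfl
        exact h3 hk
      have h1 : D.T a 1 ∈ Subgroup.closure (D.ρ '' Jᶜ) := by
        refine D.sum_mem (S := {v | ∀ k : Fin 4, k.castSucc ∈ J → D.f k ≤ D.fct v}) ?_ ha ?_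
        · intro v hv
          obtain ⟨h, hh, rfl⟩ := D.exists_smul_v₀ (J := {k : Fin 4 | k.castSucc ∈ J}) h3
            (fun i _ => D.rk_f i) (fun i _ j _ => D.f_le_f) hv
          exact D.ind_add_ind_mem hA h4 (D.mem_closure_σ _ _ hh)
        · intro v hv
          simp only [Set.mem_ofPred_eq, not_forall] at hv
          obtain ⟨k, hk, hkv⟩ := hv
          exact ((D.cond_castSucc (hne k hk)).1 (hc _ hk)).2 v hkv
      have h2 : D.T 0 g ∈ Subgroup.closure (D.ρ '' Jᶜ) :=
        D.T_zero_mem_closure hA (D.mem_closure_σ _ _ fun k hk => hfix k (hne k hk) hk)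
      have := mul_mem h1 h2
      rwa [D.T_one_mul, add_zero] at this

end FacetTwist

end Twisting

theorem mem_closure_liftGens_iff {G : Type*} [Group G] {I : Type*} (ρ : I → G) (A : Set I)
    (x : ↥(Subgroup.closure (Set.range ρ))) :
    x ∈ Subgroup.closure (liftGens ρ '' A) ↔ (x : G) ∈ Subgroup.closure (ρ '' A) := by
  have h : (Subgroup.closure (liftGens ρ '' A)).map (Subgroup.closure (Set.range ρ)).subtype =
      Subgroup.closure (ρ '' A) := by
    rw [MonoidHom.map_closure, ← Set.image_comp]
    rfl
  rw [← h]
  exact (Subgroup.mem_map_iff_mem (Subgroup.subtype_injective _)).symm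

theorem orderOf_mul_eq_two {G : Type*} [Group G] {x y : G} (hx : x * x = 1) (hy : y * y = 1)
    (hxy : x * y = y * x) (hne : x ≠ y) : orderOf (x * y) = 2 := by
  refine orderOf_eq_prime ?_ ?_
  · rw [pow_two, mul_assoc, ← mul_assoc y, ← hxy, mul_assoc, hy, mul_one, hx]
  · intro h
    exact hne (by rw [eq_inv_of_mul_eq_one_left h, inv_eq_of_mul_eq_one_left hy])

namespace FacetTwist

variable {K : Type*} [PartialOrder K] {rk : K → ℤ} {V H : Type*} [Group H]
  [MulAction ↥(orderAut K) V] (D : FacetTwist K rk V H)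

theorem ind_add_ind_ne : ind D.v₀ + ind (D.σ 3 • D.v₀) ≠ 0 := by
  intro h
  have h1 := congrFun (eq_of_add_eq_zero_bool h) D.v₀
  rw [ind_apply_self, ind_apply_of_ne D.σ_smul_v₀_ne.symm] at h1
  exact one_ne_zero h1

/-- The condition for `T b h` to lie in the left coset of the `i`-th maximal parabolic subgroup
containing `T a g`. -/
theorem cond_inv_mul (i : Fin 5) (a b : V → Bool) (g h : ↥(orderAut K)) :
    D.Cond i (fun v => (a + b) (g • v)) (g⁻¹ * h) ↔
      (i = 4 → b = a) ∧ (i = 3 → b + ind (h • D.v₀) = a + ind (g • D.v₀)) ∧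
        ∀ k : Fin 4, k ≠ 3 → i = k.castSucc →
          h • D.f k = g • D.f k ∧ ∀ v, ¬ g • D.f k ≤ D.fct v → b v = a v := by
  have hfun : ∀ c d : V → Bool, (fun v => c (g • v)) = d ↔ c = fun v => d (g⁻¹ • v) := by
    intro c d
    constructor
    · rintro rfl
      funext v
      exact congrArg c (smul_inv_smul g v).symm
    · rintro rfl
      funext v
      exact congrArg d (inv_smul_smul g v)
  have hab : ∀ x y : Bool, x + y = 0 ↔ y = x := by decide
  rcases fin_five_cases i with rfl | rfl | ⟨k, hk, rfl⟩
  · rw [cond_four, hfun]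
    constructor
    · intro h
      refine ⟨fun _ => (eq_of_add_eq_zero_bool h).symm, fun h => ?_, fun k hk h => ?_⟩
      · exact absurd h (by decide)
      · exact absurd h.symm (Fin.castSucc_lt_last k).ne
    · rintro ⟨h, -, -⟩
      rw [h rfl, add_self_bool]
      rfl
  · rw [cond_three, hfun, ind_add_ind_smul, smul_smul, mul_inv_cancel_left]
    have key : a + b = ind (g • D.v₀) + ind (h • D.v₀) ↔
        b + ind (h • D.v₀) = a + ind (g • D.v₀) := by
      have : ∀ x y z w : Bool, x + y = z + w ↔ y + w = x + z := by decide
      simp only [funext_iff, Pi.add_apply]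
      exact forall_congr' fun v => this _ _ _ _
    rw [key]
    constructor
    · intro h
      refine ⟨fun h => absurd h (by decide), fun _ => h, fun k hk h => absurd ?_ hk⟩
      exact (Fin.castSucc_injective 4 (a₁ := 3) h).symm
    · exact fun h => h.2.1 rfl
  · rw [D.cond_castSucc hk, mul_smul, inv_smul_eq_iff]
    have key : (∀ v, ¬ D.f k ≤ D.fct v → (a + b) (g • v) = 0) ↔
        ∀ v, ¬ g • D.f k ≤ D.fct v → b v = a v := by
      constructor
      · intro h v hv
        have := h (g⁻¹ • v) (by
          rwa [D.fct_smul, ← smul_le_smul_iff_of_orderAut g, smul_inv_smul])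
        rw [smul_inv_smul] at this
        exact (hab _ _).1 this
      · intro h v hv
        exact (hab _ _).2 (h _ (by rwa [D.fct_smul, smul_le_smul_iff_of_orderAut]))
    rw [key]
    constructor
    · intro h
      refine ⟨fun h => absurd h (Fin.castSucc_lt_last k).ne,
        fun h => absurd (Fin.castSucc_injective 4 h) hk, fun l _ hl => ?_⟩
      obtain rfl := Fin.castSucc_injective 4 hl
      exact h
    · exact fun h => h.2.2 k hk rfl

section Family

variable [Fintype V]

theorem mem_family_iff (i : Fin 5) (x : ↥(Subgroup.closure (Set.range (halvingGens 5 D.ϱ)))) :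
    x ∈ halvingCosetFamily 5 D.ϱ i ↔
      ∃ a g, (x : H) = D.T a g ∧ IsEven a ∧ D.Cond i a g := by
  refine (mem_closure_liftGens_iff (halvingGens 5 D.ϱ) _ x).trans
    ⟨D.exists_of_mem_closure, ?_⟩
  rintro ⟨a, g, h, ha, hc⟩
  rw [h]
  have : {j : Fin 5 | j ≠ i} = {i}ᶜ := rfl
  rw [this]
  exact D.mem_closure_of_cond {i} ha (by rintro _ rfl; exact hc)

theorem mem_closure_range_iff (x : H) :
    x ∈ Subgroup.closure (Set.range (halvingGens 5 D.ϱ)) ↔ ∃ a g, x = D.T a g ∧ IsEven a := by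
  constructor
  · intro hx
    have hstep : ∀ j, ∀ y, (∃ a g, y = D.T a g ∧ IsEven a) →
        ∃ a g, D.ρ j * y = D.T a g ∧ IsEven a := by
      rintro j _ ⟨b, h, rfl, hb⟩
      obtain ⟨i, hi⟩ := exists_ne j
      obtain ⟨a, g, hag, ha, -⟩ := D.cond_ρ hi.symm
      exact ⟨_, _, by rw [hag, D.T_mul], ha.add (hb.smul g)⟩
    induction hx using Subgroup.closure_induction_left with
    | one => exact ⟨0, 1, D.T_zero_one.symm, isEven_zero⟩
    | mul_left x hx y hy ih =>
      obtain ⟨j, rfl⟩ := hx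
      exact hstep j y ih
    | inv_mul_cancel x hx y hy ih =>
      obtain ⟨j, rfl⟩ := hx
      have := hstep j y ih
      rwa [← inv_eq_of_mul_eq_one_left (D.ρ_mul_self j)] at this
  · rintro ⟨a, g, rfl, ha⟩
    have := D.mem_closure_of_cond ∅ (g := g) ha (fun _ h => absurd h (Set.notMem_empty _))
    rw [Set.compl_empty, Set.image_univ] at this
    exact this

theorem mem_closure_of_forall (J : Set (Fin 5))
    (x : ↥(Subgroup.closure (Set.range (halvingGens 5 D.ϱ))))
    (hx : ∀ i ∈ J, x ∈ halvingCosetFamily 5 D.ϱ i) :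
    x ∈ Subgroup.closure (liftGens (halvingGens 5 D.ϱ) '' Jᶜ) := by
  obtain ⟨a, g, hag, ha⟩ := (D.mem_closure_range_iff _).1 x.2
  rw [mem_closure_liftGens_iff, hag]
  refine D.mem_closure_of_cond J ha fun i hi => ?_
  obtain ⟨b, h, hbh, -, hc⟩ := (D.mem_family_iff i x).1 (hx i hi)
  obtain ⟨rfl, rfl⟩ := D.T_inj _ _ _ _ (hag.symm.trans hbh)
  exact hc

theorem gen_notMem_family (j : Fin 5) :
    liftGens (halvingGens 5 D.ϱ) j ∉ halvingCosetFamily 5 D.ϱ j := by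
  rw [mem_family_iff]
  rintro ⟨a, g, hag, -, hc⟩
  change D.ρ j = D.T a g at hag
  rcases fin_five_cases j with rfl | rfl | ⟨k, hk, rfl⟩
  · obtain ⟨rfl, rfl⟩ := D.T_inj _ _ _ _ (D.ρ_last.symm.trans hag)
    exact D.ind_add_ind_ne hc
  · obtain ⟨rfl, rfl⟩ := D.T_inj _ _ _ _ ((D.ρ_castSucc 3).symm.trans hag)
    exact D.ind_add_ind_ne (D.cond_three.1 hc).symm
  · obtain ⟨rfl, rfl⟩ := D.T_inj _ _ _ _ ((D.ρ_castSucc k).symm.trans hag)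
    exact D.isPolytope.gen_smul_ne D.gens k (D.f_mem k) (D.rk_f k)
      ((D.cond_castSucc hk).1 hc).1

theorem exists_of_chain {J : Set (Fin 5)} {a : Fin 5 → V → Bool} {g : Fin 5 → ↥(orderAut K)}
    (hpair : ∀ i ∈ J, ∀ j ∈ J, ∃ b h, IsEven b ∧
      D.Cond i (fun v => (a i + b : V → Bool) (g i • v)) ((g i)⁻¹ * h) ∧
      D.Cond j (fun v => (a j + b : V → Bool) (g j • v)) ((g j)⁻¹ * h)) :
    ∃ b h, IsEven b ∧ ∀ i ∈ J, D.Cond i (fun v => (a i + b : V → Bool) (g i • v)) ((g i)⁻¹ * h) := by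
  simp only [cond_inv_mul] at hpair ⊢
  set G : Fin 4 → K := fun k => g k.castSucc • D.f k with hG
  set L : Set (Fin 4) := {k | k ≠ 3 ∧ k.castSucc ∈ J} with hL
  have hL3 : (3 : Fin 4) ∉ L := fun h => h.1 rfl
  have hrG : ∀ k ∈ L, rk (G k) = (k : ℕ) := fun k _ => by
    rw [hG, D.isPolytope.rank_smul, D.rk_f]
  have hle : ∀ i ∈ L, ∀ j ∈ L, i ≤ j → G i ≤ G j := by
    rintro i ⟨hi3, hi⟩ j ⟨hj3, hj⟩ hij
    obtain ⟨b, h, -, h1, h2⟩ := hpair _ hi _ hj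
    change g i.castSucc • D.f i ≤ g j.castSucc • D.f j
    rw [← (h1.2.2 i hi3 rfl).1, ← (h2.2.2 j hj3 rfl).1, smul_le_smul_iff_of_orderAut]
    exact D.f_le_f hij
  -- a vector `b` and a facet `u` solve the problem
  have hred : ∀ (b : V → Bool) (u : V), IsEven b → (4 ∈ J → b = a 4) →
      (3 ∈ J → b + ind u = a 3 + ind (g 3 • D.v₀)) → (∀ k ∈ L, G k ≤ D.fct u) →
      (∀ k ∈ L, ∀ v, ¬ G k ≤ D.fct v → b v = a k.castSucc v) →
      ∃ (b : V → Bool) (h : ↥(orderAut K)), IsEven b ∧ ∀ i ∈ J, (i = 4 → b = a i) ∧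
        (i = 3 → b + ind (h • D.v₀) = a i + ind (g i • D.v₀)) ∧
        ∀ k : Fin 4, k ≠ 3 → i = k.castSucc →
          h • D.f k = g i • D.f k ∧ ∀ v, ¬ g i • D.f k ≤ D.fct v → b v = a i v := by
    intro b u hb h4 h3 hu hoff
    obtain ⟨h, hh, rfl⟩ := D.exists_smul_v₀ hL3 hrG hle hu
    refine ⟨b, h, hb, fun i hi => ⟨?_, ?_, ?_⟩⟩
    · rintro rfl
      exact h4 hi
    · rintro rfl
      exact h3 hi
    · rintro k hk rfl
      exact ⟨hh k ⟨hk, hi⟩, hoff k ⟨hk, hi⟩⟩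
  have hmax : L.Nonempty → ∃ m ∈ L, ∀ k ∈ L, k ≤ m := by
    intro hne
    exact Set.exists_max_image L id (Set.toFinite L) hne
  have hcancel : ∀ {x y z : Bool}, x + 0 = y → z + 0 = y → x = z := by decide
  by_cases h4 : (4 : Fin 5) ∈ J
  · obtain ⟨b, h, hb, h1, -⟩ := hpair 4 h4 4 h4
    obtain rfl := h1.1 rfl
    have hoff : ∀ k ∈ L, ∀ v, ¬ G k ≤ D.fct v → a 4 v = a k.castSucc v := by
      rintro k ⟨hk3, hk⟩ v hv
      obtain ⟨b, h, -, h1, h2⟩ := hpair _ hk 4 h4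
      rw [← h2.1 rfl]
      exact (h1.2.2 k hk3 rfl).2 v hv
    by_cases h3 : (3 : Fin 5) ∈ J
    · obtain ⟨b, h, -, h1, h2⟩ := hpair 3 h3 4 h4
      have hb' := h2.1 rfl
      have h1 := h1.2.1 rfl
      rw [hb'] at h1
      refine hred (a 4) (h • D.v₀) hb (fun _ => rfl) (fun _ => h1) ?_ hoff
      rintro k ⟨hk3, hk⟩
      by_contra hku
      obtain ⟨b', h', -, h5, h6⟩ := hpair _ hk 3 h3
      have hfix := (h5.2.2 k hk3 rfl).1
      have h5 := (h5.2.2 k hk3 rfl).2 _ hku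
      have h6 := congrFun (h6.2.1 rfl) (h • D.v₀)
      have h1' := congrFun h1 (h • D.v₀)
      simp only [Pi.add_apply] at h6 h1'
      rw [← h1', h5, ← hoff k ⟨hk3, hk⟩ _ hku, add_right_inj, ind_apply_self] at h6
      have heq : h • D.v₀ = h' • D.v₀ := by
        by_contra hne
        rw [ind_apply_of_ne hne] at h6
        exact zero_ne_one h6
      apply hku
      rw [heq, D.fct_smul]
      change g _ • D.f _ ≤ _
      rw [← hfix, smul_le_smul_iff_of_orderAut]
      exact D.f_le_v₀ k
    · obtain ⟨u, hu⟩ : ∃ u, ∀ k ∈ L, G k ≤ D.fct u := by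
        obtain ⟨h, hh⟩ := D.isPolytope.exists_smul_eq_of_chain D.isRegular D.gens.1 D.f_mem
          D.rk_f L G hrG hle
        refine ⟨h • D.v₀, fun k hk => ?_⟩
        rw [← hh k hk, D.fct_smul, smul_le_smul_iff_of_orderAut]
        exact D.f_le_v₀ k
      exact hred _ u hb (fun _ => rfl) (fun h => absurd h h3) hu hoff
  · rcases L.eq_empty_or_nonempty with hLe | hne
    · have hL' : ∀ k, k ∉ L := fun k hk => by rw [hLe] at hk; exact hk
      by_cases h3 : (3 : Fin 5) ∈ J
      · obtain ⟨b, h, hb, h1, -⟩ := hpair 3 h3 3 h3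
        exact hred b (h • D.v₀) hb (fun h => absurd h h4) (fun _ => h1.2.1 rfl)
          (fun k hk => absurd hk (hL' k)) (fun k hk => absurd hk (hL' k))
      · exact hred 0 D.v₀ isEven_zero (fun h => absurd h h4) (fun h => absurd h h3)
          (fun k hk => absurd hk (hL' k)) (fun k hk => absurd hk (hL' k))
    · obtain ⟨m, ⟨hm3, hm⟩, hmmax⟩ := hmax hne
      by_cases h3 : (3 : Fin 5) ∈ J
      · obtain ⟨b, h, hb, h1, h2⟩ := hpair _ hm 3 h3
        have hu : ∀ k ∈ L, G k ≤ D.fct (h • D.v₀) := by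
          intro k hk
          refine (hle k hk m ⟨hm3, hm⟩ (hmmax k hk)).trans ?_
          rw [D.fct_smul]
          change g _ • D.f _ ≤ _
          rw [← (h1.2.2 m hm3 rfl).1, smul_le_smul_iff_of_orderAut]
          exact D.f_le_v₀ m
        refine hred b (h • D.v₀) hb (fun h => absurd h h4) (fun _ => h2.2.1 rfl) hu ?_
        rintro k ⟨hk3, hk⟩ v hv
        obtain ⟨b', h', -, h5, h6⟩ := hpair _ hk 3 h3
        rw [← (h5.2.2 k hk3 rfl).2 v hv]
        have e1 := congrFun (h6.2.1 rfl) v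
        have e2 := congrFun (h2.2.1 rfl) v
        simp only [Pi.add_apply] at e1 e2
        rw [ind_apply_of_ne (v := h' • D.v₀)] at e1
        · rw [ind_apply_of_ne (v := h • D.v₀)] at e2
          · exact hcancel e2 e1
          · rintro rfl
            exact hv (hu k ⟨hk3, hk⟩)
        · rintro rfl
          apply hv
          rw [D.fct_smul]
          change g _ • D.f _ ≤ _
          rw [← (h5.2.2 k hk3 rfl).1, smul_le_smul_iff_of_orderAut]
          exact D.f_le_v₀ k
      · obtain ⟨b, h, hb, h1, -⟩ := hpair _ hm _ hm
        refine hred b (h • D.v₀) hb (fun h => absurd h h4) (fun h => absurd h h3) ?_ ?_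
        · intro k hk
          refine (hle k hk m ⟨hm3, hm⟩ (hmmax k hk)).trans ?_
          rw [D.fct_smul]
          change g _ • D.f _ ≤ _
          rw [← (h1.2.2 m hm3 rfl).1, smul_le_smul_iff_of_orderAut]
          exact D.f_le_v₀ m
        · rintro k ⟨hk3, hk⟩ v hv
          have hvm : ¬ G m ≤ D.fct v := fun hh =>
            hv ((hle k ⟨hk3, hk⟩ m ⟨hm3, hm⟩ (hmmax k ⟨hk3, hk⟩)).trans hh)
          obtain ⟨b', h', -, h5, h6⟩ := hpair _ hk _ hm
          rw [← (h5.2.2 k hk3 rfl).2 v hv, (h6.2.2 m hm3 rfl).2 v hvm,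
            (h1.2.2 m hm3 rfl).2 v hvm]

theorem flagsMeet : FlagsMeet (halvingCosetFamily 5 D.ϱ) := by
  intro J x hpair
  have hrep : ∀ i, ∃ a g, ((x i)⁻¹ : H) = D.T a g ∧ IsEven a := fun i =>
    (D.mem_closure_range_iff _).1 (x i)⁻¹.2
  choose a g hag ha using hrep
  have hmem : ∀ (b : V → Bool) (h : ↥(orderAut K))
      (c : ↥(Subgroup.closure (Set.range (halvingGens 5 D.ϱ)))), (c : H)⁻¹ = D.T b h →
      IsEven b → ∀ i, (c * (x i)⁻¹ ∈ halvingCosetFamily 5 D.ϱ i ↔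
        D.Cond i (fun v => (a i + b) (g i • v)) ((g i)⁻¹ * h)) := by
    intro b h c hc hb i
    rw [← Subgroup.inv_mem_iff, mem_family_iff]
    have heq : ((c * (x i)⁻¹)⁻¹ : ↥(Subgroup.closure (Set.range (halvingGens 5 D.ϱ)))).1 =
        D.T (fun v => (a i + b) (g i • v)) ((g i)⁻¹ * h) := by
      rw [mul_inv_rev, inv_inv]
      change (x i : H) * (c : H)⁻¹ = _
      rw [← inv_inv (x i : H), hag, hc, D.T_inv, D.T_mul, inv_inv]
      rfl
    constructor
    · rintro ⟨a', g', h1, -, h3⟩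
      obtain ⟨rfl, rfl⟩ := D.T_inj _ _ _ _ (heq.symm.trans h1)
      exact h3
    · intro h3
      refine ⟨_, _, heq, ?_, h3⟩
      have := ((ha i).add hb).smul (g i)⁻¹
      simpa only [inv_inv] using this
  obtain ⟨b, h, hb, hc⟩ := D.exists_of_chain (J := J) (a := a) (g := g) (by
    intro i hi j hj
    obtain ⟨c, h1, h2⟩ := hpair i hi j hj
    obtain ⟨b, h, hbh, hb⟩ := (D.mem_closure_range_iff _).1 c⁻¹.2
    exact ⟨b, h, hb, (hmem b h c hbh hb i).1 h1, (hmem b h c hbh hb j).1 h2⟩)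
  refine ⟨⟨D.T b h, (D.mem_closure_range_iff _).2 ⟨b, h, rfl, hb⟩⟩⁻¹, fun i hi => ?_⟩
  exact (hmem b h _ (inv_inv _) hb i).2 (hc i hi)

theorem isRegularHypertope : (halvingCosetSystem 5 D.ϱ).IsRegularHypertope := by
  refine cosetSystem_isRegularHypertope D.flagsMeet D.mem_closure_of_forall ?_ ?_
    D.gen_notMem_family
  · exact fun i j hij => Subgroup.subset_closure ⟨j, hij, rfl⟩
  · exact fun j => Subtype.ext (D.ρ_mul_self j)

theorem card_isEven [Nonempty V] :
    Nat.card {a : V → Bool // IsEven a} = 2 ^ (Fintype.card V - 1) := by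
  let φ : (V → Bool) →+ Bool :=
    { toFun := fun a => ∑ v, a v
      map_zero' := isEven_zero
      map_add' := fun a b => Finset.sum_add_distrib }
  have hφ : Function.Surjective φ := by
    intro b
    cases b with
    | false => exact ⟨0, isEven_zero⟩
    | true => exact ⟨ind (Classical.arbitrary V), sum_ind _⟩
  have h1 : Nat.card φ.ker * Nat.card Bool = Nat.card (V → Bool) := by
    rw [← AddSubgroup.card_mul_index φ.ker, AddSubgroup.index_ker,
      AddMonoidHom.range_eq_top.2 hφ]
    congr 1
    exact Nat.card_congr (Equiv.Set.univ Bool).symm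
  have h2 : Nat.card φ.ker = Nat.card {a : V → Bool // IsEven a} := rfl
  rw [← h2]
  simp only [Nat.card_fun, Nat.card_eq_fintype_card, Fintype.card_bool] at h1 ⊢
  have : 0 < Fintype.card V := Fintype.card_pos
  obtain ⟨m, hm⟩ := Nat.exists_eq_succ_of_ne_zero this.ne'
  rw [hm, pow_succ] at h1
  rw [hm, Nat.succ_sub_one]
  exact Nat.eq_of_mul_eq_mul_right two_pos h1

theorem card_closure :
    Nat.card ↥(Subgroup.closure (Set.range (halvingGens 5 D.ϱ))) =
      2 ^ (Fintype.card V - 1) * Nat.card ↥(orderAut K) := by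
  have : Nonempty V := ⟨D.v₀⟩
  rw [← card_isEven, ← Nat.card_prod]
  refine (Nat.card_congr (Equiv.ofBijective
    (fun p => ⟨D.T p.1.1 p.2, (D.mem_closure_range_iff _).2 ⟨_, _, rfl, p.1.2⟩⟩) ⟨?_, ?_⟩)).symm
  · rintro ⟨⟨a, ha⟩, g⟩ ⟨⟨b, hb⟩, h⟩ heq
    obtain ⟨rfl, rfl⟩ := D.T_inj _ _ _ _ (congrArg Subtype.val heq)
    rfl
  · rintro ⟨x, hx⟩
    obtain ⟨a, g, rfl, ha⟩ := (D.mem_closure_range_iff _).1 hx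
    exact ⟨⟨⟨a, ha⟩, g⟩, rfl⟩

end Family

theorem orderOf_ρ_mul_ρ (i j : Fin 4) :
    orderOf (D.ρ i.castSucc * D.ρ j.castSucc) = orderOf (D.σ i * D.σ j) := by
  rw [D.ρ_castSucc, D.ρ_castSucc, D.T_zero_mul_zero, D.orderOf_T_zero]

theorem orderOf_ϱ_mul_ϱ (i j : Fin 4) :
    orderOf (D.ϱ i.castSucc * D.ϱ j.castSucc) = orderOf (D.σ i * D.σ j) := by
  rw [D.ϱ_castSucc, D.ϱ_castSucc, D.T_zero_mul_zero, D.orderOf_T_zero]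

theorem orderOf_ρ_mul_ρ_last {i : Fin 4} (hi : i ≠ 3) :
    orderOf (D.ρ i.castSucc * D.ρ 4) = orderOf (D.σ i * D.σ 3) := by
  have : D.ρ i.castSucc * D.ρ 4 = MulAut.conj (D.T (ind D.v₀) 1) (D.T 0 (D.σ i * D.σ 3)) := by
    rw [MulAut.conj_apply, D.conj_T_zero]
    change _ * D.ρ (Fin.last 4) = _
    rw [D.ρ_castSucc, D.ρ_last, D.T_zero_mul, ind_add_ind_smul, D.σ_smul_v₀ hi, mul_smul]
  rw [this, ← D.orderOf_T_zero]
  exact orderOf_injective (MulAut.conj (D.T (ind D.v₀) 1)).toMonoidHom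
    (MulAut.conj _).injective _

theorem orderOf_translation : orderOf (D.T (ind D.v₀ + ind (D.σ 3 • D.v₀)) 1) = 2 := by
  refine orderOf_eq_prime ?_ ?_
  · rw [pow_two, D.T_one_mul, add_self_bool, D.T_zero_one]
  · intro h
    rw [← D.T_zero_one] at h
    exact D.ind_add_ind_ne (D.T_inj _ _ _ _ h).1

theorem orderOf_ρ_three_mul_ρ_four : orderOf (D.ρ 3 * D.ρ 4) = 2 := by
  have : D.ρ 3 * D.ρ 4 = D.T (ind D.v₀ + ind (D.σ 3 • D.v₀)) 1 := by
    change D.ρ (Fin.castSucc 3) * D.ρ (Fin.last 4) = _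
    rw [D.ρ_castSucc, D.ρ_last, D.T_zero_mul, ind_add_ind_smul, smul_smul, D.σ_mul_self,
      one_smul, add_comm]
  rw [this, D.orderOf_translation]

theorem orderOf_ϱ_three_mul_ϱ_four : orderOf (D.ϱ 3 * D.ϱ 4) = 4 := by
  have h1 : D.ϱ 3 * D.ϱ 4 = D.T (ind (D.σ 3 • D.v₀)) (D.σ 3) := by
    change D.ϱ (Fin.castSucc 3) * D.ϱ (Fin.last 4) = _
    rw [D.ϱ_castSucc, D.ϱ_last, D.T_zero_mul, ind_smul, mul_one]
  have h2 : (D.ϱ 3 * D.ϱ 4) ^ 2 = D.T (ind D.v₀ + ind (D.σ 3 • D.v₀)) 1 := by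
    rw [h1, pow_two, D.T_mul, ind_smul, smul_smul, D.σ_mul_self, one_smul, add_comm]
  have h3 := D.orderOf_translation
  rw [← h2] at h3
  refine orderOf_eq_prime_pow (p := 2) (n := 1) ?_ ?_
  · intro h
    rw [pow_one] at h
    rw [h, orderOf_one] at h3
    exact absurd h3 (by decide)
  · have := pow_orderOf_eq_one ((D.ϱ 3 * D.ϱ 4) ^ 2)
    rw [h3, ← pow_mul] at this
    exact this

theorem orderOf_σ_mul_σ_eq_two {i j : Fin 4} (hij : (i : ℕ) + 1 < j) :
    orderOf (D.σ i * D.σ j) = 2 := by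
  refine orderOf_mul_eq_two (D.σ_mul_self i) (D.σ_mul_self j)
    (D.isPolytope.gen_comm D.gens (Or.inl hij)) ?_
  intro h
  have hne : j ≠ i := by rintro rfl; omega
  refine D.isPolytope.gen_smul_ne D.gens i (D.f_mem i) (D.rk_f i) ?_
  rw [h]
  exact D.σ_smul_f hne

end FacetTwist

/-! ### Coset tables -/

/-- The entry in row `k` and column `j` of the table with `c` columns whose entries are the
digits of `e` in base `1000`. -/
def tableEntry (c e k j : ℕ) : ℕ := e / 1000 ^ (c * k + j) % 1000

/-- The first column in which row `k` has an entry smaller than `k` (and `3` if none of the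
first three columns will do). -/
def tableParent (c e k : ℕ) : ℕ :=
  if tableEntry c e k 0 < k then 0 else if tableEntry c e k 1 < k then 1 else
    if tableEntry c e k 2 < k then 2 else 3

/-- The entries of the Coxeter matrix of type `{5, 3, 3}`. -/
def coxeterEntry (i j : ℕ) : ℕ :=
  if i = j then 1 else if i + 1 = j ∨ j + 1 = i then (if i = 0 ∨ j = 0 then 5 else 3) else 2

/-- Following the columns `g, h, g, …` of the table for `n` steps from row `a` leads to row `b`,
using only entries among the first `k` rows and the entry leading from the parent of `k`
to `k`. -/
def tableWalk (c e k b : ℕ) : ℕ → ℕ → ℕ → ℕ → Bool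
  | 0, a, _, _ => a == b
  | n + 1, a, g, h =>
    ((decide (a < k) && decide (tableEntry c e a g < k)) ||
      ((a == tableEntry c e k (tableParent c e k)) && (g == tableParent c e k))) &&
      tableWalk c e k b n (tableEntry c e a g) h g

/-- The consistency check for the entry in row `k` and column `j` of a table. -/
def tableCheckEntry (c N e k j : ℕ) : Bool :=
  decide (tableEntry c e k j < N) && (tableEntry c e (tableEntry c e k j) j == k) &&
    (decide (k < tableEntry c e k j) || (j == tableParent c e k) ||
      ((k == 0) && (tableEntry c e k j == 0)) ||
        tableWalk c e k (tableEntry c e k j) (2 * (coxeterEntry (tableParent c e k) j - 1))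
          (tableEntry c e k (tableParent c e k)) j (tableParent c e k))

/-- The consistency check for row `k` of a table. -/
def tableCheckRow (c N e k : ℕ) : Bool :=
  ((k == 0) || (decide (tableParent c e k < c) &&
    decide (tableEntry c e k (tableParent c e k) < k))) &&
    Nat.rec true (fun j r => tableCheckEntry c N e k j && r) c

/-- The consistency check for the first `n` rows of a table. -/
def tableCheck (c N e : ℕ) : ℕ → Bool
  | 0 => true
  | n + 1 => tableCheckRow c N e n && tableCheck c N e n

/-- A consistent coset table of type `{5, 3, 3}` with `c` columns and `N` rows. -/
def IsCosetTable (c N e : ℕ) : Prop := 0 < N ∧ tableCheck c N e N = true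

/-- The coset table for a facet of the segment. -/
def cosetTableOne : ℕ := 1

/-- The coset table for an edge of the pentagon. -/
def cosetTableTwo : ℕ := 4003002004003001000002001000

/-- The coset table for the pentagons of the dodecahedron. -/
def cosetTableThree : ℕ :=
  10011011011009010009010008008007009005008006004006007007005004006003005003004002002001003000002001001000000

/-- The coset table for the dodecahedra of the `120`-cell. -/
def cosetTableFour : ℕ :=
  1181191191191191171181181171181161171161161171151151151141161141121151131131101131141111141121101121111111091091131081121101091071111071081101061081051091041041061031081051071051021061021011071011001061031021040991051030981041010971031001000990951020960941010950981000940970970960920930990910990980920980970910940930900960930880960890950950910940880860930870900840870920850920880840910820890900830900860820860810830850890890800880810780850790870870770860780850760810840770840800760740790830750830730740820800820770730730810720800710750750790790700780710760780690770690720760680750670710740700740660670720660730650650680640720670710630700660690700620680620610690610600680640630630670590620650580660640570650610560640600600590590550630580530620540520610530570600520560560550500590510540490510580480580570490570560480520510470540550460550500470440540450530530480520440420510430500500460460420400430490410490440400480380450470390470420380460370390410450450360440370340410350430430330420340410320370400330400360320310350390350390300310380360380330300300370290360350280340310320340270330270290320260280310250280290250300240240260230290250270280220260220210270210200260230220240190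25023018024021017023020020019015022016014021015018020014017017016013016019012019018013018017012014010016011015015012014010008011013009013010008012007009009011011006010007009005007008006008006005005007004006004004005003003003002004002001003002000002001001001000000000

theorem isCosetTable_one : IsCosetTable 1 2 cosetTableOne := by
  unfold IsCosetTable; decide +kernel

theorem isCosetTable_two : IsCosetTable 2 5 cosetTableTwo := by
  unfold IsCosetTable; decide +kernel

theorem isCosetTable_three : IsCosetTable 3 12 cosetTableThree := by
  unfold IsCosetTable; decide +kernel

theorem isCosetTable_four : IsCosetTable 4 120 cosetTableFour := by
  unfold IsCosetTable; decide +kernel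

theorem tableCheckRow_of_tableCheck {c N e : ℕ} : ∀ {n k : ℕ}, tableCheck c N e n = true → k < n →
    tableCheckRow c N e k = true
  | 0, _, _, h => absurd h (Nat.not_lt_zero _)
  | n + 1, k, h, hk => by
    rw [tableCheck, Bool.and_eq_true] at h
    rcases Nat.lt_succ_iff_lt_or_eq.1 hk with hk | rfl
    · exact tableCheckRow_of_tableCheck h.2 hk
    · exact h.1

theorem IsCosetTable.parent_lt {c N e k : ℕ} (h : IsCosetTable c N e) (hk : k < N) (h0 : k ≠ 0) :
    tableParent c e k < c ∧ tableEntry c e k (tableParent c e k) < k := by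
  have := tableCheckRow_of_tableCheck h.2 hk
  simpa [tableCheckRow, h0] using (Bool.and_eq_true_iff.1 this).1

theorem IsCosetTable.checkEntry {c N e k j : ℕ} (h : IsCosetTable c N e) (hk : k < N)
    (hj : j < c) : tableCheckEntry c N e k j = true := by
  have h1 := (Bool.and_eq_true_iff.1 (tableCheckRow_of_tableCheck h.2 hk)).2
  have h2 : ∀ n : ℕ, Nat.rec true (fun j r => tableCheckEntry c N e k j && r) n = true →
      j < n → tableCheckEntry c N e k j = true := by
    intro n
    induction n with
    | zero => intro _ h; exact absurd h (Nat.not_lt_zero _)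
    | succ n ih =>
      intro hn hjn
      have hn' := Bool.and_eq_true_iff.1 hn
      rcases Nat.lt_succ_iff_lt_or_eq.1 hjn with hjn | rfl
      · exact ih hn'.2 hjn
      · exact hn'.1
  exact h2 c h1 hj

theorem IsCosetTable.entry_lt {c N e k j : ℕ} (h : IsCosetTable c N e) (hk : k < N)
    (hj : j < c) : tableEntry c e k j < N := by
  have := h.checkEntry hk hj
  simp only [tableCheckEntry, Bool.and_eq_true, decide_eq_true_eq] at this
  exact this.1.1

theorem IsCosetTable.entry_entry {c N e k j : ℕ} (h : IsCosetTable c N e) (hk : k < N)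
    (hj : j < c) : tableEntry c e (tableEntry c e k j) j = k := by
  have := h.checkEntry hk hj
  simp only [tableCheckEntry, Bool.and_eq_true, beq_iff_eq] at this
  exact this.1.2

section Action

variable {G X : Type*} [Group G] [MulAction G X]

/-- The element of a `G`-set reached from `x` along the row `k` of a coset table. -/
def tablePoint (c e : ℕ) (σ : ℕ → G) (x : X) (k : ℕ) : X :=
  if _h : tableEntry c e k (tableParent c e k) < k then
    σ (tableParent c e k) • tablePoint c e σ x (tableEntry c e k (tableParent c e k))
  else x
termination_by k

/-- The image of `x` under an alternating product of `n` factors `s` and `s'`,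
starting with `s`. -/
def alternatingSmul : ℕ → G → G → X → X
  | 0, _, _, x => x
  | n + 1, s, s', x => alternatingSmul n s' s (s • x)

theorem alternatingSmul_two_mul (n : ℕ) (s s' : G) (x : X) :
    alternatingSmul (2 * n) s s' x = (s' * s) ^ n • x := by
  induction n generalizing x with
  | zero => simp [alternatingSmul]
  | succ n ih =>
    rw [Nat.mul_succ, pow_succ, mul_smul, mul_smul, ← ih]
    rfl

variable {c N e : ℕ} {σ : ℕ → G} {x : X}

theorem tablePoint_of_lt {k : ℕ} (h : tableEntry c e k (tableParent c e k) < k) :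
    tablePoint c e σ x k =
      σ (tableParent c e k) • tablePoint c e σ x (tableEntry c e k (tableParent c e k)) := by
  rw [tablePoint, dif_pos h]

theorem tablePoint_zero : tablePoint c e σ x 0 = x := by
  rw [tablePoint, dif_neg (Nat.not_lt_zero _)]

theorem alternatingSmul_of_tableWalk {k b : ℕ}
    (hlt : ∀ a < k, ∀ g < c, tableEntry c e a g < k →
      σ g • tablePoint c e σ x a = tablePoint c e σ x (tableEntry c e a g))
    (hp : σ (tableParent c e k) • tablePoint c e σ x (tableEntry c e k (tableParent c e k)) =
      tablePoint c e σ x (tableEntry c e (tableEntry c e k (tableParent c e k))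
        (tableParent c e k))) (n : ℕ) :
    ∀ a g g' : ℕ, g < c → g' < c → tableWalk c e k b n a g g' = true →
      alternatingSmul n (σ g) (σ g') (tablePoint c e σ x a) = tablePoint c e σ x b := by
  induction n with
  | zero =>
    intro a g g' _ _ h
    rw [tableWalk, beq_iff_eq] at h
    rw [h]; rfl
  | succ n ih =>
    intro a g g' hg hg' h
    simp only [tableWalk, Bool.and_eq_true, Bool.or_eq_true, decide_eq_true_eq,
      beq_iff_eq] at h
    have key : σ g • tablePoint c e σ x a = tablePoint c e σ x (tableEntry c e a g) := by
      rcases h.1 with h1 | ⟨h1, h2⟩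
      · exact hlt a h1.1 g hg h1.2
      · rw [h1, h2]; exact hp
    rw [alternatingSmul, key]
    exact ih _ _ _ hg' hg h.2

/-- A consistent coset table describes the action of generators satisfying the Coxeter relations
on the orbit of a point fixed by the generators which fix the first row. -/
theorem IsCosetTable.smul_tablePoint (h : IsCosetTable c N e)
    (hσ : ∀ i < c, ∀ j < c, (σ i * σ j) ^ coxeterEntry i j = 1)
    (hx : ∀ j < c, tableEntry c e 0 j = 0 → σ j • x = x) {k j : ℕ} (hk : k < N) (hj : j < c) :
    σ j • tablePoint c e σ x k = tablePoint c e σ x (tableEntry c e k j) := by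
  have hinv : ∀ i < c, σ i * σ i = 1 := fun i hi => by
    simpa [coxeterEntry] using hσ i hi i hi
  have key : ∀ n ≤ N, ∀ a < n, ∀ g < c, tableEntry c e a g < n →
      σ g • tablePoint c e σ x a = tablePoint c e σ x (tableEntry c e a g) := by
    intro n
    induction n with
    | zero => intro _ a ha; exact absurd ha (Nat.not_lt_zero _)
    | succ k ih =>
      intro hkN
      have hkN' : k < N := hkN
      specialize ih hkN'.le
      have row : ∀ g < c, tableEntry c e k g ≤ k →
          σ g • tablePoint c e σ x k = tablePoint c e σ x (tableEntry c e k g) := by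
        intro g hg hgk
        rcases Nat.eq_zero_or_pos k with rfl | hpos
        · have h0 : tableEntry c e 0 g = 0 := Nat.le_zero.1 hgk
          rw [h0, tablePoint_zero, hx g hg h0]
        obtain ⟨hpc, hpk⟩ := h.parent_lt hkN' hpos.ne'
        have hpe := tablePoint_of_lt (σ := σ) (x := x) hpk
        by_cases hgp : g = tableParent c e k
        · subst hgp
          rw [hpe, ← mul_smul, hinv _ hpc, one_smul]
        have hent := h.checkEntry hkN' hg
        simp only [tableCheckEntry, Bool.and_eq_true, Bool.or_eq_true, decide_eq_true_eq,
          beq_iff_eq] at hent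
        rcases hent.2 with ((h1 | h1) | h1) | h1
        · omega
        · exact absurd h1 hgp
        · omega
        · have hw := alternatingSmul_of_tableWalk ih
            (by rw [h.entry_entry hkN' hpc]; exact hpe.symm) _ _ _ _ hg hpc h1
          rw [alternatingSmul_two_mul] at hw
          rw [← hw, hpe, ← mul_smul]
          congr 1
          have hm : coxeterEntry (tableParent c e k) g - 1 + 1 =
              coxeterEntry (tableParent c e k) g := by
            unfold coxeterEntry; split_ifs <;> rfl
          have h2 := hσ _ hpc _ hg
          rw [← hm, pow_succ] at h2
          rw [eq_inv_of_mul_eq_one_left h2, mul_inv_rev, inv_eq_of_mul_eq_one_left (hinv _ hg),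
            inv_eq_of_mul_eq_one_left (hinv _ hpc)]
      intro a ha g hg hag
      rcases Nat.lt_succ_iff_lt_or_eq.1 ha with ha | rfl
      · rcases Nat.lt_succ_iff_lt_or_eq.1 hag with hag | hag
        · exact ih a ha g hg hag
        · have h1 := h.entry_entry (ha.trans hkN') hg
          rw [hag] at h1 ⊢
          have h2 := row g hg (by omega)
          rw [h1] at h2
          rw [← h2, ← mul_smul, hinv _ hg, one_smul]
      · exact row g hg (Nat.lt_succ_iff.1 hag)
  exact key N le_rfl k hk j hj (h.entry_lt hk hj)

theorem IsCosetTable.exists_tablePoint (h : IsCosetTable c N e)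
    (hσ : ∀ i < c, ∀ j < c, (σ i * σ j) ^ coxeterEntry i j = 1)
    (hx : ∀ j < c, tableEntry c e 0 j = 0 → σ j • x = x) {g : G}
    (hg : g ∈ Subgroup.closure (σ '' {j | j < c})) :
    ∃ k < N, g • x = tablePoint c e σ x k := by
  suffices H : ∀ k < N, ∃ k' < N, g • tablePoint c e σ x k = tablePoint c e σ x k' by
    simpa only [tablePoint_zero] using H 0 h.1
  induction hg using Subgroup.closure_induction'' with
  | mem y hy =>
    obtain ⟨j, hj, rfl⟩ := hy
    exact fun k hk => ⟨_, h.entry_lt hk hj, h.smul_tablePoint hσ hx hk hj⟩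
  | inv_mem y hy =>
    obtain ⟨j, hj, rfl⟩ := hy
    intro k hk
    refine ⟨_, h.entry_lt hk hj, ?_⟩
    rw [← h.smul_tablePoint hσ hx hk hj, inv_eq_of_mul_eq_one_left]
    simpa [coxeterEntry] using hσ j hj j hj
  | one => exact fun k hk => ⟨k, hk, one_smul _ _⟩
  | mul a b _ _ ha hb =>
    intro k hk
    obtain ⟨k', hk', h1⟩ := hb k hk
    obtain ⟨k'', hk'', h2⟩ := ha k' hk'
    exact ⟨k'', hk'', by rw [mul_smul, h1, h2]⟩

/-- The points of a coset table lie in the orbit. -/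
theorem IsCosetTable.exists_smul_eq_tablePoint (h : IsCosetTable c N e) {k : ℕ} (hk : k < N) :
    ∃ g ∈ Subgroup.closure (σ '' {j | j < c}), g • x = tablePoint c e σ x k := by
  induction k using Nat.strong_induction_on with
  | _ k ih =>
    rcases Nat.eq_zero_or_pos k with rfl | hpos
    · exact ⟨1, one_mem _, by rw [one_smul, tablePoint_zero]⟩
    · obtain ⟨hpc, hpk⟩ := h.parent_lt hk hpos.ne'
      obtain ⟨g, hg, hgx⟩ := ih _ hpk (hpk.trans hk)
      refine ⟨σ (tableParent c e k) * g,
        mul_mem (Subgroup.subset_closure ⟨_, hpc, rfl⟩) hg, ?_⟩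
      rw [mul_smul, hgx, ← tablePoint_of_lt hpk]

end Action

/-! ### The 120-cell -/

section Cell

open scoped Pointwise

variable {P : Type*} [PartialOrder P] {rk : P → ℤ}

/-- A family of four group elements, extended by `1` to a family indexed by `ℕ`. -/
def natGen {G : Type*} [Group G] (σ : Fin 4 → G) (i : ℕ) : G :=
  if h : i < 4 then σ ⟨i, h⟩ else 1

/-- A regular polytope with the Coxeter relations and the group order of the 120-cell, a base
flag with faces `F i`, and the corresponding distinguished generators. -/
structure IsOneTwentyCell (rk : P → ℤ) (Φ : Set P) (σ : Fin 4 → ↥(orderAut P)) (F : ℕ → P) :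
    Prop where
  isPolytope : IsPolytope P rk 4
  isRegular : IsRegularPolytope P
  gens : IsDistinguishedGens P rk 4 Φ σ
  pow_five : (σ 0 * σ 1) ^ 5 = 1
  pow_three : (σ 1 * σ 2) ^ 3 = 1
  pow_three' : (σ 2 * σ 3) ^ 3 = 1
  card : Nat.card ↥(orderAut P) = 14400
  mem : ∀ i < 4, F i ∈ Φ
  rk_eq : ∀ i < 4, rk (F i) = i

/-- The number of facets of the faces of the 120-cell. -/
def cellRows : ℕ → ℕ
  | 1 => 2
  | 2 => 5
  | 3 => 12
  | _ => 120

/-- The coset tables of the faces of the 120-cell. -/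
def cellTable : ℕ → ℕ
  | 1 => cosetTableOne
  | 2 => cosetTableTwo
  | 3 => cosetTableThree
  | _ => cosetTableFour

theorem isCosetTable_cellTable {c : ℕ} (h : 0 < c) (h' : c ≤ 4) :
    IsCosetTable c (cellRows c) (cellTable c) := by
  interval_cases c
  exacts [isCosetTable_one, isCosetTable_two, isCosetTable_three, isCosetTable_four]

theorem card_le_mul_card_of_orbit {G X : Type*} [Group G] [Finite G] [MulAction G X]
    (A B : Subgroup G) (x : X) (S : Set X) (hS : S.Finite) (h : ∀ g ∈ A, g • x ∈ S)
    (hB : ∀ g ∈ A, g • x = x → g ∈ B) : Nat.card A ≤ S.ncard * Nat.card B := by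
  have h1' : Nat.card (MulAction.orbit A x) * Nat.card (MulAction.stabilizer A x) =
      Nat.card A := by
    rw [← Nat.card_prod]
    exact Nat.card_congr (MulAction.orbitProdStabilizerEquivGroup A x)
  rw [← h1']
  refine Nat.mul_le_mul ?_ ?_
  · rw [Nat.card_coe_set_eq]
    refine Set.ncard_le_ncard ?_ hS
    rintro _ ⟨g, rfl⟩
    exact h g.1 g.2
  · refine Nat.card_le_card_of_injective
      (fun g : MulAction.stabilizer A x => (⟨g.1.1, hB _ g.1.2 g.2⟩ : B)) ?_
    intro g g' hgg
    exact Subtype.ext (Subtype.ext (congrArg (fun b : B => (b : G)) hgg))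

theorem mem_of_orbit_card {G X : Type*} [Group G] [Finite G] [MulAction G X]
    (A B : Subgroup G) (x : X) (S : Set X) (hBA : B ≤ A) (hBx : ∀ g ∈ B, g • x = x)
    (hS : ∀ y ∈ S, ∃ g ∈ A, g • x = y) (hcard : Nat.card A ≤ S.ncard * Nat.card B)
    (hSpos : 0 < S.ncard) {g : G} (hg : g ∈ A) (hgx : g • x = x) : g ∈ B := by
  have h1' : Nat.card (MulAction.orbit A x) * Nat.card (MulAction.stabilizer A x) =
      Nat.card A := by
    rw [← Nat.card_prod]
    exact Nat.card_congr (MulAction.orbitProdStabilizerEquivGroup A x)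
  have hle : B ≤ A ⊓ MulAction.stabilizer G x := fun b hb => ⟨hBA hb, hBx b hb⟩
  have hstab : Nat.card (MulAction.stabilizer A x) =
      Nat.card ↥(A ⊓ MulAction.stabilizer G x) := by
    refine Nat.card_congr
      ⟨fun g => ⟨g.1.1, g.1.2, g.2⟩, fun g => ⟨⟨g.1, g.2.1⟩, g.2.2⟩, fun _ => rfl, fun _ => rfl⟩
  have hSle : S.ncard ≤ Nat.card (MulAction.orbit A x) := by
    rw [Nat.card_coe_set_eq]
    refine Set.ncard_le_ncard ?_ (Set.finite_range _)
    intro y hy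
    obtain ⟨a, ha, rfl⟩ := hS y hy
    exact ⟨⟨a, ha⟩, rfl⟩
  have hcard' : Nat.card ↥(A ⊓ MulAction.stabilizer G x) ≤ Nat.card B := by
    rw [← hstab]
    by_contra hlt
    push Not at hlt
    have := Nat.mul_lt_mul_of_pos_left hlt hSpos
    have := Nat.mul_le_mul_right (Nat.card (MulAction.stabilizer A x)) hSle
    omega
  have := Subgroup.eq_of_le_of_card_ge hle hcard'
  rw [this]
  exact ⟨hg, hgx⟩

namespace IsOneTwentyCell

variable {Φ : Set P} {σ : Fin 4 → ↥(orderAut P)} {F : ℕ → P}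

theorem finite (h : IsOneTwentyCell rk Φ σ F) : Finite ↥(orderAut P) :=
  Nat.finite_of_card_ne_zero (by rw [h.card]; norm_num)

theorem natGen_relation (h : IsOneTwentyCell rk Φ σ F) {c : ℕ} (hc : c ≤ 4) :
    ∀ i < c, ∀ j < c, (natGen σ i * natGen σ j) ^ coxeterEntry i j = 1 := by
  have hsq := h.isPolytope.gen_mul_self h.gens
  have hinv := h.isPolytope.gen_inv h.gens
  have hcomm : ∀ i j : Fin 4, (i : ℕ) + 1 < j ∨ (j : ℕ) + 1 < i → (σ i * σ j) ^ 2 = 1 := by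
    intro i j hij
    rw [sq]
    nth_rewrite 2 [h.isPolytope.gen_comm h.gens hij]
    rw [mul_assoc, ← mul_assoc (σ j), hsq, one_mul, hsq]
  have hrev : ∀ (i j : Fin 4) (m : ℕ), (σ i * σ j) ^ m = 1 → (σ j * σ i) ^ m = 1 := by
    intro i j m hm
    have : σ j * σ i = (σ i * σ j)⁻¹ := by rw [mul_inv_rev, hinv, hinv]
    rw [this, inv_pow, hm, inv_one]
  intro i hi j hj
  have hi4 : i < 4 := by omega
  have hj4 : j < 4 := by omega
  rw [natGen, natGen, dif_pos hi4, dif_pos hj4]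
  clear hi hj
  by_cases hij : i = j
  · subst hij
    simpa [coxeterEntry] using hsq _
  by_cases hij' : i + 1 < j ∨ j + 1 < i
  · have : coxeterEntry i j = 2 := by
      rw [coxeterEntry, if_neg hij, if_neg (by omega)]
    rw [this]
    exact hcomm _ _ hij'
  have h1 := h.pow_five
  have h2 := h.pow_three
  have h3 := h.pow_three'
  interval_cases i <;> interval_cases j <;> first
    | omega
    | exact h1
    | exact h2
    | exact h3
    | exact hrev _ _ _ h1
    | exact hrev _ _ _ h2
    | exact hrev _ _ _ h3

theorem natGen_smul (h : IsOneTwentyCell rk Φ σ F) {i j : ℕ} (hj : j < 4) (hij : i ≠ j) :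
    natGen σ i • F j = F j := by
  unfold natGen
  split_ifs with hi
  · refine h.isPolytope.gen_smul_eq h.gens _ (h.mem j hj) ?_
    rw [h.rk_eq j hj]
    simpa using hij.symm
  · exact one_smul _ _

/-- The subgroup generated by the first `c` distinguished generators. -/
abbrev initialSubgroup (σ : Fin 4 → ↥(orderAut P)) (c : ℕ) : Subgroup ↥(orderAut P) :=
  Subgroup.closure (natGen σ '' {j | j < c})

theorem initialSubgroup_mono (σ : Fin 4 → ↥(orderAut P)) {c d : ℕ} (hcd : c ≤ d) :
    initialSubgroup σ c ≤ initialSubgroup σ d :=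
  Subgroup.closure_mono (Set.image_mono fun _ hj => lt_of_lt_of_le hj hcd)

theorem initialSubgroup_smul (h : IsOneTwentyCell rk Φ σ F) {c j : ℕ} (hj : j < 4)
    (hcj : c ≤ j) {g : ↥(orderAut P)} (hg : g ∈ initialSubgroup σ c) : g • F j = F j := by
  have : initialSubgroup σ c ≤ MulAction.stabilizer ↥(orderAut P) (F j) := by
    rw [Subgroup.closure_le]
    rintro _ ⟨i, hi, rfl⟩
    have hi' : i < c := hi
    exact h.natGen_smul hj (by omega)
  exact this hg

theorem mem_initialSubgroup (h : IsOneTwentyCell rk Φ σ F) {c : ℕ} {g : ↥(orderAut P)}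
    (hg : ∀ j < 4, c ≤ j → g • F j = F j) : g ∈ initialSubgroup σ c := by
  have := h.isPolytope.mem_closure_of_fix h.gens {j | c ≤ j} g (by
    intro x hx j hj hxr
    rw [h.isPolytope.eq_of_rank_eq h.gens.1 hx (h.mem j j.2) (by rw [hxr, h.rk_eq j j.2])]
    exact hg j j.2 hj)
  refine (Subgroup.closure_mono ?_) this
  rintro _ ⟨j, hj, rfl⟩
  have hj' : (j : ℕ) < c := not_le.1 hj
  refine ⟨j, hj', ?_⟩
  rw [natGen, dif_pos j.2]

theorem initialSubgroup_four (h : IsOneTwentyCell rk Φ σ F) : initialSubgroup σ 4 = ⊤ :=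
  top_le_iff.1 fun _ _ => h.mem_initialSubgroup fun j hj hj' => by omega

theorem table_zero {c : ℕ} (hc : 0 < c) (hc' : c ≤ 4) :
    ∀ j < c, tableEntry c (cellTable c) 0 j = 0 → j ≠ c - 1 := by
  interval_cases c <;> decide +kernel

theorem table_fix (h : IsOneTwentyCell rk Φ σ F) {c : ℕ} (hc : 0 < c) (hc' : c ≤ 4) :
    ∀ j < c, tableEntry c (cellTable c) 0 j = 0 → natGen σ j • F (c - 1) = F (c - 1) :=
  fun j hj h0 => h.natGen_smul (by omega) (table_zero hc hc' j hj h0)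

theorem orbit_subset (h : IsOneTwentyCell rk Φ σ F) {c : ℕ} (hc : 0 < c) (hc' : c ≤ 4)
    {g : ↥(orderAut P)} (hg : g ∈ initialSubgroup σ c) :
    g • F (c - 1) ∈
      tablePoint c (cellTable c) (natGen σ) (F (c - 1)) '' (Finset.range (cellRows c) : Set ℕ) := by
  obtain ⟨k, hk, hgk⟩ := (isCosetTable_cellTable hc hc').exists_tablePoint
    (h.natGen_relation hc') (h.table_fix hc hc') hg
  exact ⟨k, by simpa using hk, hgk.symm⟩

theorem card_initialSubgroup_le_mul (h : IsOneTwentyCell rk Φ σ F) {c : ℕ} (hc : c + 1 ≤ 4) :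
    Nat.card (initialSubgroup σ (c + 1)) ≤
      (tablePoint (c + 1) (cellTable (c + 1)) (natGen σ) (F c) ''
        (Finset.range (cellRows (c + 1)) : Set ℕ)).ncard * Nat.card (initialSubgroup σ c) := by
  have := h.finite
  refine card_le_mul_card_of_orbit _ _ (F c) _ ((Finset.finite_toSet _).image _)
    (fun g hg => h.orbit_subset (Nat.succ_pos c) hc hg) fun g hg hgF => ?_
  refine h.mem_initialSubgroup fun j hj hcj => ?_
  rcases hcj.eq_or_lt with rfl | hlt
  · exact hgF
  · exact h.initialSubgroup_smul hj hlt hg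

theorem ncard_tablePoint_le (c : ℕ) (x : P) :
    (tablePoint c (cellTable c) (natGen σ) x ''
      (Finset.range (cellRows c) : Set ℕ)).ncard ≤ cellRows c := by
  refine (Set.ncard_image_le (Finset.finite_toSet _)).trans ?_
  rw [Set.ncard_coe_finset, Finset.card_range]

theorem card_facts (h : IsOneTwentyCell rk Φ σ F) :
    Nat.card (initialSubgroup σ 1) = 2 ∧ Nat.card (initialSubgroup σ 2) = 10 ∧
      Nat.card (initialSubgroup σ 3) = 120 ∧ Nat.card (initialSubgroup σ 0) = 1 ∧
      (tablePoint 4 cosetTableFour (natGen σ) (F 3) '' (Finset.range 120 : Set ℕ)).ncard =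
        120 := by
  have h0 : Nat.card (initialSubgroup σ 0) = 1 := by
    have : initialSubgroup σ 0 = ⊥ := by
      rw [initialSubgroup]
      simp
    rw [this, Subgroup.card_bot]
  have h1 := h.card_initialSubgroup_le_mul (c := 0) (by norm_num)
  have h2 := h.card_initialSubgroup_le_mul (c := 1) (by norm_num)
  have h3 := h.card_initialSubgroup_le_mul (c := 2) (by norm_num)
  have h4 := h.card_initialSubgroup_le_mul (c := 3) (by norm_num)
  have b1 := (h1.trans (Nat.mul_le_mul_right _ (ncard_tablePoint_le _ _)))
  have b2 := (h2.trans (Nat.mul_le_mul_right _ (ncard_tablePoint_le _ _)))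
  have b3 := (h3.trans (Nat.mul_le_mul_right _ (ncard_tablePoint_le _ _)))
  have b4 := ncard_tablePoint_le (σ := σ) 4 (F 3)
  have e4 : Nat.card (initialSubgroup σ (3 + 1)) = 14400 := by
    rw [← h.card]
    change Nat.card (initialSubgroup σ 4) = _
    rw [h.initialSubgroup_four, Subgroup.card_top]
  rw [e4] at h4
  change Nat.card (initialSubgroup σ 1) ≤ 2 * _ at b1
  change Nat.card (initialSubgroup σ 2) ≤ 5 * _ at b2
  change Nat.card (initialSubgroup σ 3) ≤ 12 * _ at b3
  change _ ≤ 120 at b4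
  have h5 : 14400 ≤ 120 * Nat.card (initialSubgroup σ 3) :=
    h4.trans (Nat.mul_le_mul_right _ b4)
  refine ⟨by omega, by omega, by omega, h0, ?_⟩
  have e3 : Nat.card (initialSubgroup σ 3) = 120 := by omega
  rw [e3] at h4
  change 14400 ≤ (tablePoint 4 cosetTableFour (natGen σ) (F 3) ''
    (Finset.range 120 : Set ℕ)).ncard * 120 at h4
  change (tablePoint 4 cosetTableFour (natGen σ) (F 3) ''
    (Finset.range 120 : Set ℕ)).ncard ≤ 120 at b4
  omega

/-- The facets of the 120-cell. -/
def cellFacet (σ : Fin 4 → ↥(orderAut P)) (F : ℕ → P) (k : ℕ) : P :=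
  tablePoint 4 cosetTableFour (natGen σ) (F 3) k

theorem cellFacet_injOn (h : IsOneTwentyCell rk Φ σ F) {a b : ℕ} (ha : a < 120) (hb : b < 120)
    (hab : cellFacet σ F a = cellFacet σ F b) : a = b := by
  have hinj := Set.injOn_of_ncard_image_eq (f := tablePoint 4 cosetTableFour (natGen σ) (F 3))
    (s := (Finset.range 120 : Set ℕ))
    (by rw [h.card_facts.2.2.2.2, Set.ncard_coe_finset, Finset.card_range])
    (Finset.finite_toSet _)
  exact hinj (by simpa using ha) (by simpa using hb) hab

theorem cellFacet_zero : cellFacet σ F 0 = F 3 := tablePoint_zero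

theorem natGen_smul_cellFacet (h : IsOneTwentyCell rk Φ σ F) {j k : ℕ} (hk : k < 120)
    (hj : j < 4) :
    natGen σ j • cellFacet σ F k = cellFacet σ F (tableEntry 4 cosetTableFour k j) :=
  isCosetTable_four.smul_tablePoint (h.natGen_relation le_rfl)
    (h.table_fix (c := 4) (by norm_num) le_rfl) hk hj

theorem exists_smul_flag_face (h : IsOneTwentyCell rk Φ σ F) {x : P} {i : ℕ} (hi : i < 4)
    (hx : rk x = i) : ∃ g : ↥(orderAut P), g • F i = x := by
  obtain ⟨g, hg⟩ := h.isPolytope.exists_smul_eq_of_chain h.isRegular h.gens.1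
    (f := fun i => F i) (fun i => h.mem i i.2) (fun i => h.rk_eq i i.2) {⟨i, hi⟩}
    (fun _ => x) (by rintro _ rfl; exact hx) (fun _ _ _ _ _ => le_rfl)
  exact ⟨g, hg _ rfl⟩

theorem exists_smul_flag_face_pair (h : IsOneTwentyCell rk Φ σ F) {x : P} {i j : ℕ} (hi : i < 4)
    (hij : j < i) (hx : rk x = i) (hle : F j ≤ x) :
    ∃ g : ↥(orderAut P), g • F i = x ∧ g • F j = F j := by
  have hj : j < 4 := by omega
  obtain ⟨g, hg⟩ := h.isPolytope.exists_smul_eq_of_chain h.isRegular h.gens.1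
    (f := fun i => F i) (fun i => h.mem i i.2) (fun i => h.rk_eq i i.2) {⟨i, hi⟩, ⟨j, hj⟩}
    (fun l => if (l : ℕ) = i then x else F j) (by
      rintro _ (rfl | rfl)
      · simpa using hx
      · simpa [hij.ne] using h.rk_eq j hj) (by
      rintro _ (rfl | rfl) _ (rfl | rfl) hl
      · exact le_rfl
      · exact absurd hl (by simpa using hij)
      · simpa [hij.ne] using hle
      · exact le_rfl)
  have h1 := hg ⟨i, hi⟩ (Or.inl rfl)
  have h2 := hg ⟨j, hj⟩ (Or.inr rfl)
  exact ⟨g, by simpa using h1, by simpa [hij.ne] using h2⟩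

theorem exists_cellFacet (h : IsOneTwentyCell rk Φ σ F) {x : P} (hx : rk x = 3) :
    ∃ k < 120, x = cellFacet σ F k := by
  obtain ⟨g, rfl⟩ := h.exists_smul_flag_face (i := 3) (by norm_num) hx
  obtain ⟨k, hk, hgk⟩ := h.orbit_subset (c := 4) (by norm_num) le_rfl (g := g)
    (by rw [h.initialSubgroup_four]; trivial)
  exact ⟨k, by simpa [cellRows] using hk, hgk.symm⟩

theorem rk_cellFacet (h : IsOneTwentyCell rk Φ σ F) {k : ℕ} (hk : k < 120) :
    rk (cellFacet σ F k) = 3 := by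
  obtain ⟨g, -, hg⟩ := isCosetTable_four.exists_smul_eq_tablePoint (σ := natGen σ) (x := F 3) hk
  rw [cellFacet, ← hg, h.isPolytope.rank_smul, h.rk_eq 3 (by norm_num)]
  rfl

theorem ncard_facets (h : IsOneTwentyCell rk Φ σ F) : {x : P | rk x = 3}.ncard = 120 := by
  rw [← h.card_facts.2.2.2.2]
  congr 1
  ext x
  constructor
  · intro hx
    obtain ⟨k, hk, rfl⟩ := h.exists_cellFacet hx
    exact ⟨k, by simpa using hk, rfl⟩
  · rintro ⟨k, hk, rfl⟩
    exact h.rk_cellFacet (by simpa using hk)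

end IsOneTwentyCell

end Cell

section CellFaces

open scoped Pointwise

variable {P : Type*} [PartialOrder P] {rk : P → ℤ}

namespace IsOneTwentyCell

variable {Φ : Set P} {σ : Fin 4 → ↥(orderAut P)} {F : ℕ → P}

theorem table_row_le : ∀ j < 4, ∀ l < 4 - j, ∀ i < 4,
    i = j ∨ tableEntry 4 cosetTableFour l i + j ≤ 3 := by
  decide +kernel

theorem table_row_succ : ∀ r < 3, tableEntry 4 cosetTableFour r (3 - r) = r + 1 := by
  decide +kernel

theorem table_row_fix : ∀ r < 3, ∀ l < r, tableEntry 4 cosetTableFour l (3 - r) = l := by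
  decide +kernel

theorem table_row_initial : ∀ r < 4, ∀ j < 3 - r, tableEntry 4 cosetTableFour r j = r := by
  decide +kernel

theorem exists_smul_cellFacet_of_reach (h : IsOneTwentyCell rk Φ σ F) {c s : ℕ} (hc : c ≤ 4)
    {L : Finset ℕ} (hL : ∀ a ∈ L, a < 120 ∧ (a = s ∨ ∃ j < c,
      tableEntry 4 cosetTableFour a j ∈ L ∧ tableEntry 4 cosetTableFour a j < a)) {a : ℕ}
    (ha : a ∈ L) : ∃ g ∈ initialSubgroup σ c, g • cellFacet σ F s = cellFacet σ F a := by
  induction a using Nat.strong_induction_on with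
  | _ a ih =>
    obtain ⟨ha', rfl | ⟨j, hj, hjL, hlt⟩⟩ := hL a ha
    · exact ⟨1, one_mem _, one_smul _ _⟩
    · obtain ⟨g, hg, hgx⟩ := ih _ hlt hjL
      have hj4 : j < 4 := by omega
      refine ⟨natGen σ j * g, mul_mem (Subgroup.subset_closure ⟨j, hj, rfl⟩) hg, ?_⟩
      rw [mul_smul, hgx, h.natGen_smul_cellFacet (hlt.trans ha') hj4,
        isCosetTable_four.entry_entry ha' hj4]

theorem mem_initialSubgroup_of_reach (h : IsOneTwentyCell rk Φ σ F) {s : ℕ} (hs : s < 4)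
    {L : Finset ℕ} (hL : ∀ a ∈ L, a < 120 ∧ (a = s ∨ ∃ j < 4 - s,
      tableEntry 4 cosetTableFour a j ∈ L ∧ tableEntry 4 cosetTableFour a j < a))
    (hLpos : 0 < L.card)
    (hcard : Nat.card (initialSubgroup σ (4 - s)) ≤ L.card * Nat.card (initialSubgroup σ (3 - s)))
    {g : ↥(orderAut P)} (hg : g ∈ initialSubgroup σ (4 - s))
    (hgs : g • cellFacet σ F s = cellFacet σ F s) : g ∈ initialSubgroup σ (3 - s) := by
  have := h.finite
  have hn : (cellFacet σ F '' (L : Set ℕ)).ncard = L.card := by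
    rw [Set.InjOn.ncard_image, Set.ncard_coe_finset]
    exact fun a ha b hb hab => h.cellFacet_injOn (hL a ha).1 (hL b hb).1 hab
  refine mem_of_orbit_card (initialSubgroup σ (4 - s)) (initialSubgroup σ (3 - s))
    (cellFacet σ F s) (cellFacet σ F '' (L : Set ℕ)) (initialSubgroup_mono σ (by omega)) ?_ ?_
    (by rwa [hn]) (by rwa [hn]) hg hgs
  · have : initialSubgroup σ (3 - s) ≤
        MulAction.stabilizer ↥(orderAut P) (cellFacet σ F s) := by
      rw [Subgroup.closure_le]
      rintro _ ⟨i, hi, rfl⟩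
      have hi' : i < 3 - s := hi
      change natGen σ i • cellFacet σ F s = _
      rw [h.natGen_smul_cellFacet (by omega) (by omega), table_row_initial s hs i hi']
    exact fun b hb => this hb
  · rintro _ ⟨a, ha, rfl⟩
    exact h.exists_smul_cellFacet_of_reach (by omega) hL ha

/-- The pointwise stabiliser of the first `s` facets. -/
theorem mem_initialSubgroup_of_fix_facets (h : IsOneTwentyCell rk Φ σ F) {g : ↥(orderAut P)}
    {s : ℕ} (hs : s ≤ 4) (hg : ∀ l < s, g • cellFacet σ F l = cellFacet σ F l) :
    g ∈ initialSubgroup σ (4 - s) := by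
  induction s with
  | zero =>
    change g ∈ initialSubgroup σ 4
    rw [h.initialSubgroup_four]
    trivial
  | succ s ih =>
    have ih := ih (by omega) fun l hl => hg l (by omega)
    have hgs := hg s (by omega)
    obtain ⟨c1, c2, c3, c0, -⟩ := h.card_facts
    have hs4 : s < 4 := by omega
    interval_cases s
    · refine h.mem_initialSubgroup fun j hj hj' => ?_
      obtain rfl : j = 3 := by omega
      rwa [cellFacet_zero] at hgs
    · refine h.mem_initialSubgroup_of_reach (s := 1) (by norm_num)
        (L := {1, 2, 3, 4, 5, 6, 7, 8, 10, 12, 14, 17}) (by decide +kernel) (by decide) ?_ ih hgs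
      change Nat.card (initialSubgroup σ 3) ≤ 12 * Nat.card (initialSubgroup σ 2)
      omega
    · refine h.mem_initialSubgroup_of_reach (s := 2) (by norm_num)
        (L := {2, 3, 4, 5, 6}) (by decide +kernel) (by decide) ?_ ih hgs
      change Nat.card (initialSubgroup σ 2) ≤ 5 * Nat.card (initialSubgroup σ 1)
      omega
    · refine h.mem_initialSubgroup_of_reach (s := 3) (by norm_num)
        (L := {3, 4}) (by decide +kernel) (by decide) ?_ ih hgs
      change Nat.card (initialSubgroup σ 1) ≤ 2 * Nat.card (initialSubgroup σ 0)
      omega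

theorem flag_face_le (h : IsOneTwentyCell rk Φ σ F) {i j : ℕ} (hij : i ≤ j) (hj : j < 4) :
    F i ≤ F j := by
  have hi : i < 4 := by omega
  refine h.isPolytope.le_of_rank_le h.gens.1 (h.mem i hi) (h.mem j hj) ?_
  rw [h.rk_eq i hi, h.rk_eq j hj]
  exact_mod_cast hij

theorem flag_face_le_cellFacet (h : IsOneTwentyCell rk Φ σ F) {j l : ℕ} (hjl : l + j ≤ 3) :
    F j ≤ cellFacet σ F l := by
  induction l with
  | zero =>
    rw [cellFacet_zero]
    exact h.flag_face_le (by omega) (by norm_num)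
  | succ l ih =>
    have ih := ih (by omega)
    rw [← smul_le_smul_iff_of_orderAut (natGen σ (3 - l)),
      h.natGen_smul_cellFacet (by omega) (by omega), table_row_succ l (by omega),
      h.natGen_smul (by omega) (by omega)] at ih
    exact ih

theorem exists_cellFacet_of_flag_face_le (h : IsOneTwentyCell rk Φ σ F) {j : ℕ} (hj : j < 4)
    {v : P} (hv : rk v = 3) (hle : F j ≤ v) : ∃ l, l + j ≤ 3 ∧ v = cellFacet σ F l := by
  rcases Nat.lt_succ_iff_lt_or_eq.1 hj with hj3 | rfl
  · obtain ⟨g, hgv, hgj⟩ := h.exists_smul_flag_face_pair (i := 3) (by norm_num) hj3 hv hle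
    have hg := h.isPolytope.mem_closure_of_fix h.gens {⟨j, hj⟩} g (by
      rintro x hx _ rfl hxr
      rwa [h.isPolytope.eq_of_rank_eq h.gens.1 hx (h.mem j hj) (by rw [hxr, h.rk_eq j hj])])
    have key : ∀ t ∈ Subgroup.closure (σ '' {⟨j, hj⟩}ᶜ), ∀ l, l + j ≤ 3 →
        ∃ l', l' + j ≤ 3 ∧ t • cellFacet σ F l = cellFacet σ F l' := by
      intro t ht
      have hgen : ∀ i : Fin 4, i ∈ ({⟨j, hj⟩} : Set (Fin 4))ᶜ → ∀ l, l + j ≤ 3 →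
          ∃ l', l' + j ≤ 3 ∧ σ i • cellFacet σ F l = cellFacet σ F l' := by
        intro i hi l hl
        refine ⟨_, (table_row_le j hj l (by omega) i i.2).resolve_left fun hij => hi (Fin.ext hij), ?_⟩
        rw [← h.natGen_smul_cellFacet (by omega) i.2, natGen, dif_pos i.2]
      induction ht using Subgroup.closure_induction'' with
      | mem y hy => obtain ⟨i, hi, rfl⟩ := hy; exact hgen i hi
      | inv_mem y hy =>
        obtain ⟨i, hi, rfl⟩ := hy
        rw [h.isPolytope.gen_inv h.gens]
        exact hgen i hi
      | one => exact fun l hl => ⟨l, hl, one_smul _ _⟩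
      | mul a b _ _ ha hb =>
        intro l hl
        obtain ⟨l', hl', h1⟩ := hb l hl
        obtain ⟨l'', hl'', h2⟩ := ha l' hl'
        exact ⟨l'', hl'', by rw [mul_smul, h1, h2]⟩
    obtain ⟨l, hl, hgl⟩ := key g hg 0 (by omega)
    exact ⟨l, hl, by rw [← hgl, cellFacet_zero, hgv]⟩
  · refine ⟨0, le_rfl, ?_⟩
    rw [cellFacet_zero]
    by_contra hne
    have := h.isPolytope.2.2.1 (lt_of_le_of_ne hle (Ne.symm hne))
    rw [hv, h.rk_eq 3 (by norm_num)] at this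
    norm_num at this

theorem exists_smul_cellFacet_eq (h : IsOneTwentyCell rk Φ σ F) {j s r : ℕ} (hsr : s ≤ r)
    (hrj : r + j ≤ 3) : ∃ g : ↥(orderAut P), g • F j = F j ∧
      (∀ l < s, g • cellFacet σ F l = cellFacet σ F l) ∧
      g • cellFacet σ F s = cellFacet σ F r := by
  induction r, hsr using Nat.le_induction with
  | base => exact ⟨1, one_smul _ _, fun _ _ => one_smul _ _, one_smul _ _⟩
  | succ r hsr ih =>
    obtain ⟨g, h1, h2, h3⟩ := ih (by omega)
    refine ⟨natGen σ (3 - r) * g, ?_, fun l hl => ?_, ?_⟩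
    · rw [mul_smul, h1, h.natGen_smul (by omega) (by omega)]
    · rw [mul_smul, h2 l hl, h.natGen_smul_cellFacet (by omega) (by omega),
        table_row_fix r (by omega) l (by omega)]
    · rw [mul_smul, h3, h.natGen_smul_cellFacet (by omega) (by omega),
        table_row_succ r (by omega)]

theorem le_flag_face_of_facets (h : IsOneTwentyCell rk Φ σ F) {i j : ℕ} (hi : i < 4)
    (hj : j < 4) {x : P} (hx : rk x = j) (hle : ∀ l, l + i ≤ 3 → x ≤ cellFacet σ F l) :
    x ≤ F i := by
  have key : ∀ s, s + i ≤ 4 → s + j ≤ 4 ∧ ∃ g : ↥(orderAut P), g • F j = x ∧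
      ∀ l < s, g • cellFacet σ F l = cellFacet σ F l := by
    intro s
    induction s with
    | zero =>
      intro _
      obtain ⟨g, hg⟩ := h.exists_smul_flag_face hj hx
      exact ⟨by omega, g, hg, fun l hl => absurd hl (Nat.not_lt_zero _)⟩
    | succ s ih =>
      intro hs
      obtain ⟨-, g, hg, hgl⟩ := ih (by omega)
      have hFj : F j ≤ g⁻¹ • cellFacet σ F s := by
        rw [← smul_le_smul_iff_of_orderAut g, smul_inv_smul, hg]
        exact hle s (by omega)
      obtain ⟨r, hr, hgr⟩ := h.exists_cellFacet_of_flag_face_le hj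
        (by rw [h.isPolytope.rank_smul, h.rk_cellFacet (by omega)]) hFj
      have hsr : s ≤ r := by
        by_contra hrs
        have h1 := hgl r (by omega)
        rw [← hgr, smul_inv_smul] at h1
        have := h.cellFacet_injOn (by omega) (by omega) (h1.trans hgr)
        omega
      obtain ⟨t, ht1, ht2, ht3⟩ := h.exists_smul_cellFacet_eq hsr hr
      refine ⟨by omega, g * t, by rw [mul_smul, ht1, hg], fun l hl => ?_⟩
      rw [mul_smul]
      rcases Nat.lt_succ_iff_lt_or_eq.1 hl with hl | rfl
      · rw [ht2 l hl, hgl l hl]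
      · rw [ht3, ← hgr, smul_inv_smul]
  obtain ⟨hij, g, hg, hgl⟩ := key (4 - i) (by omega)
  have hgi := h.mem_initialSubgroup_of_fix_facets (by omega) hgl
  rw [show 4 - (4 - i) = i by omega] at hgi
  rw [← hg, ← h.initialSubgroup_smul hi le_rfl hgi, smul_le_smul_iff_of_orderAut]
  exact h.flag_face_le (by omega) hi

/-- A face of the 120-cell is the meet of the facets containing it. -/
theorem le_of_forall_facet (h : IsOneTwentyCell rk Φ σ F) {x y : P}
    (hxy : ∀ v, rk v = 3 → y ≤ v → x ≤ v) : x ≤ y := by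
  have hP := h.isPolytope
  have hx1 := hP.neg_one_le_rank x
  have hx2 := hP.rank_le x
  have hy1 := hP.neg_one_le_rank y
  have hy2 := hP.rank_le y
  by_cases hxb : rk x = -1
  · exact hP.isBot_of_rank hxb y
  by_cases hyt : rk y = 4
  · exact hP.isTop_of_rank hyt x
  have hxt : rk x ≠ 4 := by
    intro hxt
    obtain ⟨M, hM, hyM⟩ := IsPolytope.exists_flag y
    obtain ⟨v, hv, hvr⟩ := hP.exists_mem_rank hM (k := 3) (by norm_num) (by norm_num)
    have hle := hxy v hvr (hP.le_of_rank_le hM hyM hv (by push_cast at hy2; omega))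
    have := hP.2.2.1.monotone hle
    omega
  push_cast at hx2 hy2
  obtain ⟨j, hj⟩ := Int.eq_ofNat_of_zero_le (show 0 ≤ rk x by omega)
  have hj4 : j < 4 := by omega
  by_cases hyb : rk y = -1
  · obtain ⟨g, rfl⟩ := h.exists_smul_flag_face hj4 hj
    have hle := hxy (g • cellFacet σ F 4)
      (by rw [hP.rank_smul, h.rk_cellFacet (by norm_num)]) (hP.isBot_of_rank hyb _)
    rw [smul_le_smul_iff_of_orderAut] at hle
    obtain ⟨l, hl, hl'⟩ := h.exists_cellFacet_of_flag_face_le hj4 (h.rk_cellFacet (by norm_num)) hle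
    have := h.cellFacet_injOn (by norm_num) (by omega) hl'
    omega
  obtain ⟨i, hi⟩ := Int.eq_ofNat_of_zero_le (show 0 ≤ rk y by omega)
  have hi4 : i < 4 := by omega
  obtain ⟨g, rfl⟩ := h.exists_smul_flag_face hi4 hi
  rw [← smul_le_smul_iff_of_orderAut g⁻¹, inv_smul_smul]
  refine h.le_flag_face_of_facets hi4 hj4 (by rw [hP.rank_smul, hj]) fun l hl => ?_
  rw [← smul_le_smul_iff_of_orderAut g, smul_inv_smul]
  refine hxy _ (by rw [hP.rank_smul, h.rk_cellFacet (by omega)]) ?_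
  rw [smul_le_smul_iff_of_orderAut]
  exact h.flag_face_le_cellFacet hl

end IsOneTwentyCell

end CellFaces

/-! ### Duals -/

theorem IsMaxFlag.dual {P : Type*} [PartialOrder P] {F : Set P} (hF : IsMaxFlag P F) :
    IsMaxFlag Pᵒᵈ (OrderDual.ofDual ⁻¹' F) :=
  hF.symm

theorem IsPolytope.dual {P : Type*} [PartialOrder P] {rk : P → ℤ} {n : ℕ}
    (hP : IsPolytope P rk n) : IsPolytope Pᵒᵈ (dualRk rk n) n := by
  obtain ⟨⟨b, hb, hbr⟩, ⟨t, ht, htr⟩, hmono, hflag, hdiam, hconn⟩ := hP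
  have hun : ∀ F : Set Pᵒᵈ, IsMaxFlag Pᵒᵈ F → IsMaxFlag P (OrderDual.toDual ⁻¹' F) :=
    fun F hF => hF.symm
  refine ⟨⟨OrderDual.toDual t, fun x => ht (OrderDual.ofDual x), ?_⟩,
    ⟨OrderDual.toDual b, fun x => hb (OrderDual.ofDual x), ?_⟩, ?_, ?_, ?_, ?_⟩
  · simp only [dualRk, OrderDual.ofDual_toDual]; omega
  · simp only [dualRk, OrderDual.ofDual_toDual]; omega
  · intro x y hxy
    have : rk (OrderDual.ofDual y) < rk (OrderDual.ofDual x) := hmono hxy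
    simp only [dualRk]; omega
  · intro F hF k hk hk'
    obtain ⟨x, hx, hxr⟩ := hflag _ (hun F hF) (n - 1 - k) (by omega) (by omega)
    refine ⟨OrderDual.toDual x, hx, ?_⟩
    simp only [dualRk, OrderDual.ofDual_toDual]; omega
  · intro x z hxz hr
    rw [← hdiam (OrderDual.ofDual z) (OrderDual.ofDual x) hxz
      (by simp only [dualRk] at hr; omega)]
    congr 1
    ext y
    exact and_comm
  · intro F G hF hG
    refine Relation.ReflTransGen.lift (fun A : Set P => (OrderDual.ofDual ⁻¹' A : Set Pᵒᵈ)) ?_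
      _ _ (hconn _ _ (hun F hF) (hun G hG))
    rintro A B ⟨hA, hB, h1, h2, h3, h4⟩
    exact ⟨hA.dual, hB.dual, h1, h2, h3, h4⟩

/-! ### The faces of `D2K` -/

section DTwo

variable {K : Type*} {rk : K → ℤ} {n : ℕ}

namespace DTwo

/-- The coordinates of the cube `2^{K*}` as facets of `K`. -/
def facet (v : polyVertices Kᵒᵈ (dualRk rk n)) : K := OrderDual.ofDual v.1

theorem rk_facet (v : polyVertices Kᵒᵈ (dualRk rk n)) : rk (facet v) = n - 1 := by
  have h := v.2
  simp only [dualRk] at h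
  simp only [facet]
  omega

theorem facet_injective :
    Function.Injective (facet : polyVertices Kᵒᵈ (dualRk rk n) → K) :=
  fun _ _ h => Subtype.ext h

theorem exists_facet {x : K} (hx : rk x = n - 1) :
    ∃ v : polyVertices Kᵒᵈ (dualRk rk n), facet v = x :=
  ⟨⟨OrderDual.toDual x, by simp only [dualRk, OrderDual.ofDual_toDual]; omega⟩, rfl⟩

variable [PartialOrder K]

/-- The face of `D2K` given by the face `F` of `K` and the vector `x`. -/
def face (F : K) (x : polyVertices Kᵒᵈ (dualRk rk n) → Bool) : D2 K rk n :=
  OrderDual.toDual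
    ⟨cubeFace Kᵒᵈ (dualRk rk n) (OrderDual.toDual F) x, Or.inr ⟨OrderDual.toDual F, x, rfl⟩⟩

/-- The greatest face of `D2K`. -/
def topFace : D2 K rk n := OrderDual.toDual ⟨∅, Or.inl rfl⟩

theorem eq_topFace_or (X : D2 K rk n) :
    X = topFace ∨ ∃ (F : K) (x : polyVertices Kᵒᵈ (dualRk rk n) → Bool), X = face F x := by
  obtain ⟨S, rfl | ⟨F, x, rfl⟩⟩ := X
  · exact Or.inl rfl
  · exact Or.inr ⟨OrderDual.ofDual F, x, rfl⟩

theorem mem_cubeFace_iff (F : K) (x y : polyVertices Kᵒᵈ (dualRk rk n) → Bool) :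
    y ∈ cubeFace Kᵒᵈ (dualRk rk n) (OrderDual.toDual F) x ↔
      ∀ v : polyVertices Kᵒᵈ (dualRk rk n), ¬ F ≤ facet v → y v = x v :=
  Iff.rfl

theorem le_topFace (X : D2 K rk n) : X ≤ topFace :=
  show (∅ : Set (polyVertices Kᵒᵈ (dualRk rk n) → Bool)) ⊆ (OrderDual.ofDual X).1 from
    Set.empty_subset _

theorem not_topFace_le (F : K) (x : polyVertices Kᵒᵈ (dualRk rk n) → Bool) :
    ¬ topFace ≤ face F x := fun h =>
  (show cubeFace Kᵒᵈ (dualRk rk n) (OrderDual.toDual F) x ⊆ ∅ from h) (fun _ _ => rfl : x ∈ _)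

theorem face_ne_topFace (F : K) (x : polyVertices Kᵒᵈ (dualRk rk n) → Bool) :
    face F x ≠ topFace := fun h => not_topFace_le F x h.ge

theorem face_le_face_of {F G : K} {x y : polyVertices Kᵒᵈ (dualRk rk n) → Bool} (hFG : F ≤ G)
    (h : ∀ v, ¬ F ≤ facet v → x v = y v) : face F x ≤ face G y := by
  change cubeFace Kᵒᵈ (dualRk rk n) (OrderDual.toDual G) y ⊆
    cubeFace Kᵒᵈ (dualRk rk n) (OrderDual.toDual F) x
  intro z hz
  rw [mem_cubeFace_iff] at hz ⊢
  exact fun v hv => (hz v fun hG => hv (hFG.trans hG)).trans (h v hv).symm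

theorem face_eq_face_of {F : K} {x y : polyVertices Kᵒᵈ (dualRk rk n) → Bool}
    (h : ∀ v, ¬ F ≤ facet v → x v = y v) : face F x = face F y :=
  le_antisymm (face_le_face_of le_rfl h) (face_le_face_of le_rfl fun v hv => (h v hv).symm)

/-- Every face is the meet of the facets containing it. -/
def IsAtomistic (K : Type*) [PartialOrder K] (rk : K → ℤ) (n : ℕ) : Prop :=
  ∀ x y : K, (∀ v : polyVertices Kᵒᵈ (dualRk rk n), y ≤ facet v → x ≤ facet v) → x ≤ y

theorem face_le_face_iff (hA : IsAtomistic K rk n) {F G : K}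
    {x y : polyVertices Kᵒᵈ (dualRk rk n) → Bool} :
    face F x ≤ face G y ↔ F ≤ G ∧ ∀ v, ¬ F ≤ facet v → x v = y v := by
  refine ⟨fun h => ?_, fun h => face_le_face_of h.1 h.2⟩
  change cubeFace Kᵒᵈ (dualRk rk n) (OrderDual.toDual G) y ⊆
    cubeFace Kᵒᵈ (dualRk rk n) (OrderDual.toDual F) x at h
  have hy : ∀ v, ¬ F ≤ facet v → y v = x v :=
    (mem_cubeFace_iff _ _ _).1 (h fun _ _ => rfl)
  refine ⟨hA _ _ fun v hv => ?_, fun v hv => (hy v hv).symm⟩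
  by_contra hF
  classical
  have h1 := (mem_cubeFace_iff F x _).1 (h (show Function.update y v (!y v) ∈ _ from
    (mem_cubeFace_iff _ _ _).2 fun w hw =>
      Function.update_of_ne (fun hwv => hw (by rwa [hwv])) _ _)) v hF
  rw [Function.update_self, ← hy v hF] at h1
  exact Bool.not_ne_self _ h1

theorem face_eq_face_iff (hA : IsAtomistic K rk n) {F G : K}
    {x y : polyVertices Kᵒᵈ (dualRk rk n) → Bool} :
    face F x = face G y ↔ F = G ∧ ∀ v, ¬ F ≤ facet v → x v = y v := by
  constructor
  · intro h
    have h1 := (face_le_face_iff hA).1 h.le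
    exact ⟨le_antisymm h1.1 ((face_le_face_iff hA).1 h.ge).1, h1.2⟩
  · rintro ⟨rfl, h⟩
    exact face_eq_face_of h

theorem face_injective (hA : IsAtomistic K rk n)
    (x : polyVertices Kᵒᵈ (dualRk rk n) → Bool) :
    Function.Injective fun F : K => face F x :=
  fun _ _ h => ((face_eq_face_iff hA).1 h).1

/-- The rank function of `D2K`. -/
def rank (X : D2 K rk n) : ℤ := by
  classical exact
    if h : ∃ (F : K) (x : polyVertices Kᵒᵈ (dualRk rk n) → Bool), X = face F x then rk h.choose
    else n + 1

theorem rank_topFace : rank (topFace : D2 K rk n) = n + 1 := by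
  rw [rank, dif_neg]
  rintro ⟨F, x, h⟩
  exact face_ne_topFace F x h.symm

theorem rank_face (hA : IsAtomistic K rk n) (F : K)
    (x : polyVertices Kᵒᵈ (dualRk rk n) → Bool) : rank (face F x) = rk F := by
  have h : ∃ (G : K) (y : polyVertices Kᵒᵈ (dualRk rk n) → Bool), face F x = face G y :=
    ⟨F, x, rfl⟩
  rw [rank, dif_pos h]
  obtain ⟨y, hy⟩ := h.choose_spec
  exact congrArg rk ((face_eq_face_iff hA).1 hy).1.symm

/-- The flag of `D2K` given by the flag `Ψ` of `K` and the vector `x`. -/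
def flag (Ψ : Set K) (x : polyVertices Kᵒᵈ (dualRk rk n) → Bool) : Set (D2 K rk n) :=
  insert topFace ((fun F => face F x) '' Ψ)

theorem topFace_mem_flag (Ψ : Set K) (x : polyVertices Kᵒᵈ (dualRk rk n) → Bool) :
    topFace ∈ flag Ψ x := Or.inl rfl

theorem face_mem_flag_iff (hA : IsAtomistic K rk n) {Ψ : Set K} {F : K}
    {x y : polyVertices Kᵒᵈ (dualRk rk n) → Bool} :
    face F y ∈ flag Ψ x ↔ F ∈ Ψ ∧ ∀ v, ¬ F ≤ facet v → y v = x v := by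
  constructor
  · rintro (h | ⟨G, hG, h⟩)
    · exact absurd h (face_ne_topFace _ _)
    · obtain ⟨rfl, h'⟩ := (face_eq_face_iff hA).1 (show face G x = face F y from h)
      exact ⟨hG, fun v hv => (h' v hv).symm⟩
  · rintro ⟨hF, h⟩
    exact Or.inr ⟨F, hF, face_eq_face_of fun v hv => (h v hv).symm⟩

theorem isChain_flag {Ψ : Set K} (hΨ : IsChain (· ≤ ·) Ψ)
    (x : polyVertices Kᵒᵈ (dualRk rk n) → Bool) : IsChain (· ≤ ·) (flag Ψ x) := by
  refine IsChain.insert ?_ fun X _ _ => Or.inr (le_topFace X)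
  rintro _ ⟨F, hF, rfl⟩ _ ⟨G, hG, rfl⟩ hne
  have hFG : F ≠ G := fun h => hne (by rw [h])
  exact (hΨ hF hG hFG).imp (fun h => face_le_face_of h fun _ _ => rfl)
    fun h => face_le_face_of h fun _ _ => rfl

theorem exists_eq_flag [Finite K] (hK : IsPolytope K rk n) (hA : IsAtomistic K rk n)
    {M : Set (D2 K rk n)} (hM : IsMaxFlag (D2 K rk n) M) :
    ∃ (Ψ : Set K) (x : polyVertices Kᵒᵈ (dualRk rk n) → Bool),
      IsMaxFlag K Ψ ∧ M = flag Ψ x := by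
  have htop : topFace ∈ M := hM.mem_of_forall fun X _ => Or.inr (le_topFace X)
  obtain ⟨b, hb, -⟩ := hK.1
  have hbot : face b (fun _ => false) ∈ M := by
    refine hM.mem_of_forall fun X _ => Or.inl ?_
    rcases eq_topFace_or X with rfl | ⟨F, x, rfl⟩
    · exact le_topFace _
    · exact face_le_face_of (hb F) fun v hv => absurd (hb _) hv
  obtain ⟨Y, hY⟩ := (Set.toFinite (M \ {topFace})).exists_maximal ⟨_, hbot, face_ne_topFace _ _⟩
  rcases eq_topFace_or Y with rfl | ⟨G, y, rfl⟩
  · exact absurd rfl hY.1.2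
  have hform : ∀ X ∈ M, X ≠ topFace → ∃ F : K, X = face F y := by
    intro X hX hXt
    rcases eq_topFace_or X with rfl | ⟨F, x, rfl⟩
    · exact absurd rfl hXt
    have hle : face F x ≤ face G y := by
      rcases hM.le_total hX hY.1.1 with h | h
      · exact h
      · exact hY.2 ⟨hX, hXt⟩ h
    exact ⟨F, face_eq_face_of ((face_le_face_iff hA).1 hle).2⟩
  have hMflag : M = flag {F | face F y ∈ M} y := by
    ext X
    constructor
    · intro hX
      by_cases hXt : X = topFace
      · exact Or.inl hXt
      · obtain ⟨F, rfl⟩ := hform X hX hXt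
        exact Or.inr ⟨F, hX, rfl⟩
    · rintro (rfl | ⟨F, hF, rfl⟩)
      · exact htop
      · exact hF
  refine ⟨{F | face F y ∈ M}, y, ⟨?_, ?_⟩, hMflag⟩
  · intro F hF H hH hne
    exact (hM.le_total hF hH).imp (fun h => ((face_le_face_iff hA).1 h).1)
      fun h => ((face_le_face_iff hA).1 h).1
  · intro Ψ hΨ hsub
    refine hsub.antisymm fun F hF => ?_
    have h1 : M ⊆ flag Ψ y := by
      rw [hMflag]
      exact Set.insert_subset_insert (Set.image_mono hsub)
    have h2 := hM.2 (isChain_flag hΨ y) h1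
    change face F y ∈ M
    rw [h2]
    exact Or.inr ⟨F, hF, rfl⟩

theorem eq_of_forall_top (hK : IsPolytope K rk n) {T : K} (hT : rk T = n)
    (v : polyVertices Kᵒᵈ (dualRk rk n)) : ¬ T ≤ facet v := by
  intro h
  have := hK.2.2.1.monotone h
  have := rk_facet v
  omega

theorem isMaxFlag_flag [Finite K] (hK : IsPolytope K rk n) (hA : IsAtomistic K rk n)
    {Ψ : Set K} (hΨ : IsMaxFlag K Ψ) (x : polyVertices Kᵒᵈ (dualRk rk n) → Bool) :
    IsMaxFlag (D2 K rk n) (flag Ψ x) := by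
  obtain ⟨M, hM, hs⟩ := (isChain_flag hΨ.1 x).exists_maxChain
  obtain ⟨Ψ', y, hΨ', rfl⟩ := exists_eq_flag hK hA hM
  have hsub : Ψ ⊆ Ψ' := fun F hF => ((face_mem_flag_iff hA).1 (hs (Or.inr ⟨F, hF, rfl⟩))).1
  obtain ⟨T, hT, hTr⟩ := hK.exists_mem_rank hΨ (k := n) (by omega) le_rfl
  have hxy : x = y := funext fun v => ((face_mem_flag_iff hA).1
    (hs (Or.inr ⟨T, hT, rfl⟩))).2 v (eq_of_forall_top hK hTr v)
  rw [hΨ.eq_of_subset hΨ' hsub, hxy]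
  exact hM

end DTwo

end DTwo

section DTwoPolytope

variable {K : Type*} [PartialOrder K] {rk : K → ℤ} {n : ℕ}

namespace DTwo

/-- Adjacency of two flags containing a given set of faces. -/
def FlagStep {P : Type*} [PartialOrder P] (I A B : Set P) : Prop :=
  IsMaxFlag P A ∧ IsMaxFlag P B ∧ I ⊆ A ∧ I ⊆ B ∧ (A \ B).ncard = 1 ∧ (B \ A).ncard = 1

theorem flag_mono {S Ψ : Set K} (h : S ⊆ Ψ) (x : polyVertices Kᵒᵈ (dualRk rk n) → Bool) :
    flag S x ⊆ flag Ψ x :=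
  Set.insert_subset_insert (Set.image_mono h)

theorem flag_congr {S : Set K} {x y : polyVertices Kᵒᵈ (dualRk rk n) → Bool}
    (h : ∀ F ∈ S, ∀ v, ¬ F ≤ facet v → x v = y v) : flag S x = flag S y :=
  congrArg (insert topFace) (Set.image_congr fun F hF => face_eq_face_of (h F hF))

theorem flag_sdiff_flag (hA : IsAtomistic K rk n) (Ψ Ψ' : Set K)
    (x : polyVertices Kᵒᵈ (dualRk rk n) → Bool) :
    flag Ψ x \ flag Ψ' x = (fun F => face F x) '' (Ψ \ Ψ') := by
  ext X
  constructor
  · rintro ⟨rfl | ⟨F, hF, rfl⟩, h⟩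
    · exact absurd (topFace_mem_flag _ _) h
    · exact ⟨F, ⟨hF, fun hF' => h (Or.inr ⟨F, hF', rfl⟩)⟩, rfl⟩
  · rintro ⟨F, hF, rfl⟩
    exact ⟨Or.inr ⟨F, hF.1, rfl⟩, fun h => hF.2 ((face_mem_flag_iff hA).1 h).1⟩

theorem path_of_eq [Finite K] (hK : IsPolytope K rk n) (hA : IsAtomistic K rk n) {S Ψ Ψ' : Set K}
    (hΨ : IsMaxFlag K Ψ) (hΨ' : IsMaxFlag K Ψ') (hS : S ⊆ Ψ ∩ Ψ')
    (x : polyVertices Kᵒᵈ (dualRk rk n) → Bool) :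
    Relation.ReflTransGen (FlagStep (flag S x)) (flag Ψ x) (flag Ψ' x) := by
  refine Relation.ReflTransGen.lift (fun A : Set K => flag A x) ?_ _ _
    (hK.2.2.2.2.2 Ψ Ψ' hΨ hΨ')
  rintro A B ⟨h1, h2, h3, h4, h5, h6⟩
  refine ⟨isMaxFlag_flag hK hA h1 x, isMaxFlag_flag hK hA h2 x, flag_mono (hS.trans h3) x,
    flag_mono (hS.trans h4) x, ?_, ?_⟩
  · rw [flag_sdiff_flag hA, Set.ncard_image_of_injective _ (face_injective hA x), h5]
  · rw [flag_sdiff_flag hA, Set.ncard_image_of_injective _ (face_injective hA x), h6]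

theorem le_facet_of_mem_flag (hK : IsPolytope K rk n) {Ψ : Set K} (hΨ : IsMaxFlag K Ψ) {F : K}
    (hF : F ∈ Ψ) {v : polyVertices Kᵒᵈ (dualRk rk n)} (hv : facet v ∈ Ψ) (hr : rk F ≠ n) :
    F ≤ facet v := by
  refine hK.le_of_rank_le hΨ hF hv ?_
  have := hK.rank_le F
  have := rk_facet v
  omega

theorem flag_sdiff_flag_update (hK : IsPolytope K rk n) (hA : IsAtomistic K rk n)
    {Ψ : Set K} (hΨ : IsMaxFlag K Ψ) {x y : polyVertices Kᵒᵈ (dualRk rk n) → Bool}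
    {v : polyVertices Kᵒᵈ (dualRk rk n)} (hv : facet v ∈ Ψ) (hxy : x v ≠ y v)
    (hne : ∀ w, w ≠ v → x w = y w) : (flag Ψ x \ flag Ψ y).ncard = 1 := by
  obtain ⟨T, hT, hTr⟩ := hK.exists_mem_rank hΨ (k := n) (by omega) le_rfl
  rw [Set.ncard_eq_one]
  refine ⟨face T x, ?_⟩
  ext X
  constructor
  · rintro ⟨rfl | ⟨F, hF, rfl⟩, h⟩
    · exact absurd (topFace_mem_flag _ _) h
    · by_cases hr : rk F = n
      · rw [hK.eq_of_rank_eq hΨ hF hT (by omega)]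
        rfl
      · refine absurd ((face_mem_flag_iff hA).2 ⟨hF, fun w hw => hne w ?_⟩) h
        rintro rfl
        exact hw (le_facet_of_mem_flag hK hΨ hF hv hr)
  · rintro rfl
    exact ⟨Or.inr ⟨T, hT, rfl⟩, fun h =>
      hxy (((face_mem_flag_iff hA).1 h).2 v (eq_of_forall_top hK hTr v))⟩

theorem path [Finite K] (hK : IsPolytope K rk n) (hA : IsAtomistic K rk n) (m : ℕ) :
    ∀ {S Ψ Ψ' : Set K} (_ : IsMaxFlag K Ψ) (_ : IsMaxFlag K Ψ') (_ : S ⊆ Ψ ∩ Ψ')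
      (x y : polyVertices Kᵒᵈ (dualRk rk n) → Bool)
      (_ : ∀ F ∈ S, ∀ v, ¬ F ≤ facet v → x v = y v) (_ : {v | x v ≠ y v}.ncard = m),
      Relation.ReflTransGen (FlagStep (flag S x)) (flag Ψ x) (flag Ψ' y) := by
  classical
  induction m with
  | zero =>
    intro S Ψ Ψ' hΨ hΨ' hS x y _ hm
    have hxy : x = y := by
      rw [Set.ncard_eq_zero] at hm
      funext v
      by_contra hv
      exact (hm ▸ (show v ∈ {v | x v ≠ y v} from hv) : v ∈ (∅ : Set _))
    subst hxy
    exact path_of_eq hK hA hΨ hΨ' hS x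
  | succ m ih =>
    intro S Ψ Ψ' hΨ hΨ' hS x y hxy hm
    obtain ⟨v, hv⟩ : {v | x v ≠ y v}.Nonempty := by
      rw [← Set.ncard_pos]; omega
    have hSv : ∀ F ∈ S, F ≤ facet v := fun F hF => by
      by_contra hFv
      exact hv (hxy F hF v hFv)
    have hch : IsChain (· ≤ ·) (insert (facet v) S) :=
      IsChain.insert (hΨ.1.mono fun F hF => (hS hF).1) fun F hF _ => Or.inr (hSv F hF)
    obtain ⟨Ψ₁, hΨ₁, hsub⟩ := hch.exists_maxChain
    have hvΨ : facet v ∈ Ψ₁ := hsub (Or.inl rfl)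
    have hSΨ : S ⊆ Ψ₁ := fun F hF => hsub (Or.inr hF)
    set z := Function.update x v (y v) with hz
    have hzv : z v = y v := Function.update_self _ _ _
    have hzw : ∀ w, w ≠ v → z w = x w := fun w hw => Function.update_of_ne hw _ _
    have hSz : flag S x = flag S z := flag_congr fun F hF w hw =>
      (hzw w (by rintro rfl; exact hw (hSv F hF))).symm
    have hxzv : x v ≠ z v := by rw [hzv]; exact hv
    have hstep : FlagStep (flag S x) (flag Ψ₁ x) (flag Ψ₁ z) := by
      refine ⟨isMaxFlag_flag hK hA hΨ₁ x, isMaxFlag_flag hK hA hΨ₁ z, flag_mono hSΨ x,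
        hSz ▸ flag_mono hSΨ z, ?_, ?_⟩
      · exact flag_sdiff_flag_update hK hA hΨ₁ hvΨ hxzv fun w hw => (hzw w hw).symm
      · exact flag_sdiff_flag_update hK hA hΨ₁ hvΨ hxzv.symm hzw
    have hdiff : {w | z w ≠ y w} = {w | x w ≠ y w} \ {v} := by
      ext w
      by_cases hw : w = v
      · subst hw
        exact ⟨fun h => absurd hzv h, fun h => absurd rfl h.2⟩
      · change z w ≠ y w ↔ x w ≠ y w ∧ w ≠ v
        rw [hzw w hw]
        exact ⟨fun h => ⟨h, hw⟩, fun h => h.1⟩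
    refine ((path_of_eq hK hA hΨ hΨ₁ (fun F hF => ⟨(hS hF).1, hSΨ hF⟩) x).tail hstep).trans ?_
    rw [hSz]
    refine ih hΨ₁ hΨ' (fun F hF => ⟨hSΨ hF, (hS hF).2⟩) z y ?_ ?_
    · intro F hF w hw
      rw [hzw w (by rintro rfl; exact hw (hSv F hF))]
      exact hxy F hF w hw
    · rw [hdiff, Set.ncard_sdiff_singleton_of_mem hv]
      omega

theorem isPolytope [Finite K] (hK : IsPolytope K rk n) (hA : IsAtomistic K rk n) :
    IsPolytope (D2 K rk n) rank (n + 1) := by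
  have hmono : StrictMono (rank : D2 K rk n → ℤ) := by
    intro X Y hXY
    rcases eq_topFace_or X with rfl | ⟨F, x, rfl⟩
    · exact absurd (le_topFace Y) hXY.not_ge
    rcases eq_topFace_or Y with rfl | ⟨G, y, rfl⟩
    · rw [rank_topFace, rank_face hA]
      have := hK.rank_le F
      omega
    · rw [rank_face hA, rank_face hA]
      obtain ⟨h1, h2⟩ := (face_le_face_iff hA).1 hXY.le
      refine hK.2.2.1 (lt_of_le_of_ne h1 ?_)
      rintro rfl
      exact hXY.ne (face_eq_face_of h2)
  refine ⟨?_, ⟨topFace, le_topFace, by rw [rank_topFace]; push_cast; rfl⟩, hmono, ?_, ?_, ?_⟩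
  · obtain ⟨b, hb, hbr⟩ := hK.1
    refine ⟨face b fun _ => false, fun X => ?_, by rw [rank_face hA, hbr]⟩
    rcases eq_topFace_or X with rfl | ⟨F, x, rfl⟩
    · exact le_topFace _
    · exact face_le_face_of (hb F) fun v hv => absurd (hb _) hv
  · intro M hM k hk hk'
    obtain ⟨Ψ, x, hΨ, rfl⟩ := exists_eq_flag hK hA hM
    push_cast at hk'
    by_cases hkn : k = n + 1
    · exact ⟨topFace, topFace_mem_flag _ _, by rw [rank_topFace, hkn]⟩
    · obtain ⟨F, hF, hFr⟩ := hK.exists_mem_rank hΨ (k := k) hk (by omega)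
      exact ⟨face F x, Or.inr ⟨F, hF, rfl⟩, by rw [rank_face hA, hFr]⟩
  · intro X Z hXZ hr
    rcases eq_topFace_or X with rfl | ⟨F, x, rfl⟩
    · exact absurd (le_topFace Z) hXZ.not_ge
    rw [rank_face hA] at hr
    rcases eq_topFace_or Z with rfl | ⟨G, z, rfl⟩
    · rw [rank_topFace] at hr
      classical
      obtain ⟨T, hT, hTr⟩ := hK.2.1
      obtain ⟨v, rfl⟩ := exists_facet (rk := rk) (n := n) (x := F) (by omega)
      have hvT : ¬ T ≤ facet v := eq_of_forall_top hK hTr v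
      rw [Set.ncard_eq_two]
      refine ⟨face T x, face T (Function.update x v (!x v)), ?_, ?_⟩
      · intro h
        have := ((face_eq_face_iff hA).1 h).2 v hvT
        rw [Function.update_self] at this
        exact Bool.not_ne_self _ this.symm
      have hlt : ∀ y, (∀ w, ¬ facet v ≤ facet w → x w = y w) →
          face (facet v) x < face T y ∧ face T y < topFace := by
        intro y hy
        refine ⟨lt_of_le_of_ne (face_le_face_of (hT _) hy) fun h => ?_,
          lt_of_le_of_ne (le_topFace _) (face_ne_topFace _ _)⟩
        exact hvT ((face_eq_face_iff hA).1 h).1.ge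
      ext Y
      constructor
      · rintro ⟨h1, h2⟩
        rcases eq_topFace_or Y with rfl | ⟨H, y, rfl⟩
        · exact absurd rfl h2.ne
        obtain ⟨h3, h4⟩ := (face_le_face_iff hA).1 h1.le
        have h5 := hmono h1
        rw [rank_face hA, rank_face hA, rk_facet v] at h5
        have h6 := hK.rank_le H
        have hHt := hK.isTop_of_rank (x := H) (by omega)
        obtain rfl : H = T := le_antisymm (hT _) (hHt _)
        have hw : ∀ w, w ≠ v → x w = y w := by
          intro w hw
          refine h4 w fun hle => hw ?_
          by_contra hne
          have := hK.2.2.1 (lt_of_le_of_ne hle fun h => hne (facet_injective h).symm)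
          rw [rk_facet v, rk_facet w] at this
          exact lt_irrefl _ this
        by_cases hyv : y v = x v
        · left
          refine face_eq_face_of fun w _ => ?_
          by_cases hwv : w = v
          · rw [hwv, hyv]
          · exact (hw w hwv).symm
        · right
          refine face_eq_face_of fun w _ => ?_
          by_cases hwv : w = v
          · rw [hwv, Function.update_self]
            exact Bool.eq_not_of_ne hyv
          · rw [Function.update_of_ne hwv, hw w hwv]
      · rintro (rfl | rfl)
        · exact hlt x fun _ _ => rfl
        · refine hlt _ fun w hw => ?_
          rw [Function.update_of_ne]
          rintro rfl
          exact hw le_rfl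
    · rw [rank_face hA] at hr
      obtain ⟨hFG, hxz⟩ := (face_le_face_iff hA).1 hXZ.le
      rw [face_eq_face_of hxz] at hXZ ⊢
      have hlt : ∀ {H H' : K}, face H z < face H' z ↔ H < H' := by
        intro H H'
        rw [lt_iff_le_not_ge, lt_iff_le_not_ge, face_le_face_iff hA, face_le_face_iff hA]
        simp
      rw [← hK.2.2.2.2.1 F G (hlt.1 hXZ) (by omega),
        ← Set.ncard_image_of_injective _ (face_injective hA z)]
      congr 1
      ext Y
      constructor
      · rintro ⟨h1, h2⟩
        rcases eq_topFace_or Y with rfl | ⟨H, y, rfl⟩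
        · exact absurd h2.le (not_topFace_le _ _)
        have he := face_eq_face_of ((face_le_face_iff hA).1 h2.le).2
        rw [he] at h1 h2 ⊢
        exact ⟨H, ⟨hlt.1 h1, hlt.1 h2⟩, rfl⟩
      · rintro ⟨H, ⟨h1, h2⟩, rfl⟩
        exact ⟨hlt.2 h1, hlt.2 h2⟩
  · intro M M' hM hM'
    obtain ⟨Ψ, x, hΨ, rfl⟩ := exists_eq_flag hK hA hM
    obtain ⟨Ψ', y, hΨ', rfl⟩ := exists_eq_flag hK hA hM'
    have hI : flag Ψ x ∩ flag Ψ' y ⊆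
        flag {F | F ∈ Ψ ∩ Ψ' ∧ ∀ v, ¬ F ≤ facet v → x v = y v} x := by
      rintro X ⟨rfl | ⟨F, hF, rfl⟩, h⟩
      · exact topFace_mem_flag _ _
      · have h' := (face_mem_flag_iff hA).1 h
        exact Or.inr ⟨F, ⟨⟨hF, h'.1⟩, h'.2⟩, rfl⟩
    refine Relation.ReflTransGen.mono ?_ _ _ (path hK hA _ hΨ hΨ'
      (S := {F | F ∈ Ψ ∩ Ψ' ∧ ∀ v, ¬ F ≤ facet v → x v = y v}) (fun F hF => hF.1) x y
      (fun F hF => hF.2) rfl)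
    rintro A B ⟨h1, h2, h3, h4, h5, h6⟩
    exact ⟨h1, h2, hI.trans h3, hI.trans h4, h5, h6⟩

theorem nonDegenerate (hK : IsPolytope K rk n) (hA : IsAtomistic K rk n)
    (hnd : NonDegenerate K rk) : NonDegenerate (D2 K rk n) rank := by
  have hlt : ∀ {H H' : K} {z : polyVertices Kᵒᵈ (dualRk rk n) → Bool},
      face H z < face H' z ↔ H < H' := by
    intro H H' z
    rw [lt_iff_le_not_ge, lt_iff_le_not_ge, face_le_face_iff hA, face_le_face_iff hA]
    simp
  have hlttop : ∀ (F : K) (x : polyVertices Kᵒᵈ (dualRk rk n) → Bool), face F x < topFace :=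
    fun F x => lt_of_le_of_ne (le_topFace _) (face_ne_topFace _ _)
  intro X Z hXZ hr
  rcases eq_topFace_or X with rfl | ⟨F, x, rfl⟩
  · exact absurd (le_topFace Z) hXZ.not_ge
  rw [rank_face hA] at hr ⊢
  rcases eq_topFace_or Z with rfl | ⟨G, z, rfl⟩
  · rw [rank_topFace] at hr
    classical
    obtain ⟨T, hT, hTr⟩ := hK.2.1
    have hFT : F < T := lt_of_le_of_ne (hT F) fun h => by rw [h] at hr; omega
    have h2 := hK.2.2.2.2.1 F T hFT (by omega)
    obtain ⟨V, W, hVW, hset⟩ := Set.ncard_eq_two.1 h2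
    have hV : F < V ∧ V < T := by
      have : V ∈ {y | F < y ∧ y < T} := by rw [hset]; exact Or.inl rfl
      exact this
    have hW : F < W ∧ W < T := by
      have : W ∈ {y | F < y ∧ y < T} := by rw [hset]; exact Or.inr rfl
      exact this
    have hVr1 := hK.2.2.1 hV.1
    have hVr2 := hK.2.2.1 hV.2
    have hWr1 := hK.2.2.1 hW.1
    have hWr2 := hK.2.2.1 hW.2
    obtain ⟨v, rfl⟩ := exists_facet (rk := rk) (n := n) (x := V) (by omega)
    obtain ⟨w, rfl⟩ := exists_facet (rk := rk) (n := n) (x := W) (by omega)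
    refine ⟨face (facet v) x, face (facet w) x, face (facet v) (Function.update x w (!x w)),
      ⟨hlt.2 hV.1, hlttop _ _, ?_⟩, ⟨hlt.2 hW.1, hlttop _ _, ?_⟩, ⟨?_, hlttop _ _, ?_⟩,
      ?_, ?_, ?_⟩
    · rw [rank_face hA]; omega
    · rw [rank_face hA]; omega
    · refine lt_of_le_of_ne (face_le_face_of hV.1.le fun u hu => ?_) fun h =>
        hV.1.ne ((face_eq_face_iff hA).1 h).1
      rw [Function.update_of_ne]
      rintro rfl
      exact hu hW.1.le
    · rw [rank_face hA]; omega
    · exact fun h => hVW ((face_eq_face_iff hA).1 h).1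
    · intro h
      have hle : ¬ facet v ≤ facet w := fun hle => by
        have := hK.2.2.1 (lt_of_le_of_ne hle hVW)
        omega
      have := ((face_eq_face_iff hA).1 h).2 w hle
      rw [Function.update_self] at this
      exact Bool.not_ne_self _ this.symm
    · exact fun h => hVW ((face_eq_face_iff hA).1 h).1.symm
  · rw [rank_face hA] at hr
    obtain ⟨hFG, hxz⟩ := (face_le_face_iff hA).1 hXZ.le
    rw [face_eq_face_of hxz] at hXZ ⊢
    obtain ⟨H₁, H₂, H₃, h₁, h₂, h₃, h12, h13, h23⟩ := hnd F G (hlt.1 hXZ) hr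
    refine ⟨face H₁ z, face H₂ z, face H₃ z, ⟨hlt.2 h₁.1, hlt.2 h₁.2.1, ?_⟩,
      ⟨hlt.2 h₂.1, hlt.2 h₂.2.1, ?_⟩, ⟨hlt.2 h₃.1, hlt.2 h₃.2.1, ?_⟩,
      fun h => h12 (face_injective hA z h), fun h => h13 (face_injective hA z h),
      fun h => h23 (face_injective hA z h)⟩
    · rw [rank_face hA, h₁.2.2]
    · rw [rank_face hA, h₂.2.2]
    · rw [rank_face hA, h₃.2.2]

end DTwo

end DTwoPolytope

/-! ### Automorphisms of `D2K` -/

section DTwoAut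

open scoped Pointwise

variable {K : Type*} [PartialOrder K] {rk : K → ℤ} {n : ℕ}

namespace DTwo

/-- The action of the automorphisms of `K` on the coordinates of the cube `2^{K*}`. -/
@[reducible] def facetAction (hK : IsPolytope K rk n) :
    MulAction ↥(orderAut K) (polyVertices Kᵒᵈ (dualRk rk n)) where
  smul g v := ⟨OrderDual.toDual (g • facet v), by
    have := hK.rank_smul g (facet v)
    have := rk_facet v
    simp only [dualRk, OrderDual.ofDual_toDual]
    omega⟩
  one_smul v := facet_injective (one_smul ↥(orderAut K) (facet v))
  mul_smul g h v := facet_injective (mul_smul g h (facet v))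

variable [MulAction ↥(orderAut K) (polyVertices Kᵒᵈ (dualRk rk n))]

/-- Permute the coordinates by `g`, then translate by `a`. -/
def shift (a : polyVertices Kᵒᵈ (dualRk rk n) → Bool) (g : ↥(orderAut K))
    (y : polyVertices Kᵒᵈ (dualRk rk n) → Bool) : polyVertices Kᵒᵈ (dualRk rk n) → Bool :=
  a + fun v => y (g⁻¹ • v)

theorem shift_shift (a b y : polyVertices Kᵒᵈ (dualRk rk n) → Bool) (g h : ↥(orderAut K)) :
    shift a g (shift b h y) = shift (a + fun v => b (g⁻¹ • v)) (g * h) y := by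
  funext v
  simp only [shift, Pi.add_apply, mul_inv_rev, mul_smul, add_assoc]

theorem shift_zero_one (y : polyVertices Kᵒᵈ (dualRk rk n) → Bool) : shift 0 1 y = y := by
  funext v
  simp only [shift, Pi.add_apply, inv_one, one_smul, Pi.zero_apply, zero_add]

theorem shift_inv_shift (a y : polyVertices Kᵒᵈ (dualRk rk n) → Bool) (g : ↥(orderAut K)) :
    shift (fun v => a (g • v)) g⁻¹ (shift a g y) = y := by
  rw [shift_shift, inv_mul_cancel, inv_inv, FacetTwist.add_self_bool, shift_zero_one]

theorem shift_shift_inv (a y : polyVertices Kᵒᵈ (dualRk rk n) → Bool) (g : ↥(orderAut K)) :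
    shift a g (shift (fun v => a (g • v)) g⁻¹ y) = y := by
  rw [shift_shift, mul_inv_cancel]
  simp only [smul_inv_smul]
  rw [FacetTwist.add_self_bool, shift_zero_one]

theorem smul_le_facet_iff
    (hf : ∀ (g : ↥(orderAut K)) (v : polyVertices Kᵒᵈ (dualRk rk n)),
      facet (g • v) = g • facet v)
    (g : ↥(orderAut K)) (F : K) (v : polyVertices Kᵒᵈ (dualRk rk n)) :
    g • F ≤ facet v ↔ F ≤ facet (g⁻¹ • v) := by
  rw [← smul_le_smul_iff_of_orderAut g F, ← hf, smul_inv_smul]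

theorem image_shift_cubeFace
    (hf : ∀ (g : ↥(orderAut K)) (v : polyVertices Kᵒᵈ (dualRk rk n)),
      facet (g • v) = g • facet v)
    (a x : polyVertices Kᵒᵈ (dualRk rk n) → Bool) (g : ↥(orderAut K))
    (F : K) :
    shift a g '' cubeFace Kᵒᵈ (dualRk rk n) (OrderDual.toDual F) x =
      cubeFace Kᵒᵈ (dualRk rk n) (OrderDual.toDual (g • F)) (shift a g x) := by
  ext y
  rw [mem_cubeFace_iff]
  constructor
  · rintro ⟨z, hz, rfl⟩ v hv
    rw [smul_le_facet_iff hf] at hv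
    exact congrArg (a v + ·) ((mem_cubeFace_iff _ _ _).1 hz _ hv)
  · intro hy
    refine ⟨_, (mem_cubeFace_iff _ _ _).2 fun v hv => ?_, shift_shift_inv a y g⟩
    have hv' := hy (g • v) (by rwa [smul_le_facet_iff hf, inv_smul_smul])
    rw [← shift_inv_shift a x g]
    simp only [shift, Pi.add_apply, inv_inv] at hv' ⊢
    rw [hv']

variable (hf : ∀ (g : ↥(orderAut K)) (v : polyVertices Kᵒᵈ (dualRk rk n)),
  facet (g • v) = g • facet v)

/-- The map of `D2K` induced by `shift a g`. -/
def act (a : polyVertices Kᵒᵈ (dualRk rk n) → Bool) (g : ↥(orderAut K)) (X : D2 K rk n) :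
    D2 K rk n :=
  OrderDual.toDual ⟨shift a g '' (OrderDual.ofDual X).1, by
    obtain ⟨S, rfl | ⟨F, x, rfl⟩⟩ := X
    · exact Or.inl (Set.image_empty _)
    · exact Or.inr ⟨_, _, image_shift_cubeFace hf a x g (OrderDual.ofDual F)⟩⟩

theorem act_act (a b : polyVertices Kᵒᵈ (dualRk rk n) → Bool) (g h : ↥(orderAut K))
    (X : D2 K rk n) :
    act hf a g (act hf b h X) = act hf (a + fun v => b (g⁻¹ • v)) (g * h) X := by
  refine Subtype.ext ?_
  change shift a g '' (shift b h '' (OrderDual.ofDual X).1) = shift _ _ '' (OrderDual.ofDual X).1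
  rw [Set.image_image]
  simp only [shift_shift]

theorem act_zero_one (X : D2 K rk n) : act hf 0 1 X = X := by
  refine Subtype.ext ?_
  change shift 0 1 '' (OrderDual.ofDual X).1 = (OrderDual.ofDual X).1
  simp only [shift_zero_one, Set.image_id']

theorem act_mono (a : polyVertices Kᵒᵈ (dualRk rk n) → Bool) (g : ↥(orderAut K))
    {X Y : D2 K rk n} (h : X ≤ Y) : act hf a g X ≤ act hf a g Y :=
  show shift a g '' (OrderDual.ofDual Y).1 ⊆ shift a g '' (OrderDual.ofDual X).1 from
    Set.image_mono h

theorem act_inv_act (a : polyVertices Kᵒᵈ (dualRk rk n) → Bool) (g : ↥(orderAut K))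
    (X : D2 K rk n) : act hf (fun v => a (g • v)) g⁻¹ (act hf a g X) = X := by
  rw [act_act, inv_mul_cancel, inv_inv, FacetTwist.add_self_bool, act_zero_one]

theorem act_act_inv (a : polyVertices Kᵒᵈ (dualRk rk n) → Bool) (g : ↥(orderAut K))
    (X : D2 K rk n) : act hf a g (act hf (fun v => a (g • v)) g⁻¹ X) = X := by
  rw [act_act, mul_inv_cancel]
  simp only [smul_inv_smul]
  rw [FacetTwist.add_self_bool, act_zero_one]

/-- The automorphism of `D2K` induced by `shift a g`. -/
def twist (a : polyVertices Kᵒᵈ (dualRk rk n) → Bool) (g : ↥(orderAut K)) :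
    ↥(orderAut (D2 K rk n)) :=
  ⟨⟨act hf a g, act hf (fun v => a (g • v)) g⁻¹, act_inv_act hf a g, act_act_inv hf a g⟩,
    fun X Y => ⟨fun h => by
      have := act_mono hf (fun v => a (g • v)) g⁻¹ h
      rwa [Equiv.coe_fn_mk, act_inv_act, act_inv_act] at this, act_mono hf a g⟩⟩

theorem twist_smul_face (a : polyVertices Kᵒᵈ (dualRk rk n) → Bool) (g : ↥(orderAut K)) (F : K)
    (x : polyVertices Kᵒᵈ (dualRk rk n) → Bool) :
    twist hf a g • (face F x : D2 K rk n) = face (g • F) (shift a g x) :=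
  Subtype.ext (image_shift_cubeFace hf a x g F)

theorem twist_smul_topFace (a : polyVertices Kᵒᵈ (dualRk rk n) → Bool) (g : ↥(orderAut K)) :
    twist hf a g • (topFace : D2 K rk n) = topFace :=
  Subtype.ext (Set.image_empty _)

theorem twist_mul (a : polyVertices Kᵒᵈ (dualRk rk n) → Bool) (g : ↥(orderAut K))
    (b : polyVertices Kᵒᵈ (dualRk rk n) → Bool) (h : ↥(orderAut K)) :
    twist hf a g * twist hf b h = twist hf (a + fun v => b (g⁻¹ • v)) (g * h) :=
  Subtype.ext (Equiv.ext fun X => act_act hf a b g h X)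

theorem shift_zero_right (a : polyVertices Kᵒᵈ (dualRk rk n) → Bool) (g : ↥(orderAut K)) :
    shift a g 0 = a :=
  add_zero a

theorem twist_inj (hK : IsPolytope K rk n) (hA : IsAtomistic K rk n)
    (a : polyVertices Kᵒᵈ (dualRk rk n) → Bool) (g : ↥(orderAut K))
    (b : polyVertices Kᵒᵈ (dualRk rk n) → Bool) (h : ↥(orderAut K))
    (e : twist hf a g = twist hf b h) : a = b ∧ g = h := by
  have key : ∀ F : K, g • F = h • F ∧ ∀ v, ¬ g • F ≤ facet v → a v = b v := by
    intro F
    have := congrArg (· • (face F 0 : D2 K rk n)) e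
    simp only [twist_smul_face, shift_zero_right] at this
    exact (face_eq_face_iff hA).1 this
  obtain ⟨T, -, hT⟩ := hK.2.1
  exact ⟨funext fun v => (key T).2 v (eq_of_forall_top hK ((hK.rank_smul g T).trans hT) v),
    Subtype.ext (Equiv.ext fun F => (key F).1)⟩

theorem twist_smul_flag (a x : polyVertices Kᵒᵈ (dualRk rk n) → Bool) (g : ↥(orderAut K))
    (Ψ : Set K) :
    twist hf a g • (flag Ψ x : Set (D2 K rk n)) = flag (g • Ψ) (shift a g x) := by
  simp only [flag, Set.smul_set_insert, twist_smul_topFace]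
  congr 1
  simp only [← Set.image_smul, Set.image_image, twist_smul_face]

theorem isRegularPolytope [Finite K]
    (hf : ∀ (g : ↥(orderAut K)) (v : polyVertices Kᵒᵈ (dualRk rk n)),
      facet (g • v) = g • facet v)
    (hK : IsPolytope K rk n) (hA : IsAtomistic K rk n)
    (hreg : IsRegularPolytope K) : IsRegularPolytope (D2 K rk n) := by
  intro M M' hM hM'
  obtain ⟨Ψ, x, hΨ, rfl⟩ := exists_eq_flag hK hA hM
  obtain ⟨Ψ', y, hΨ', rfl⟩ := exists_eq_flag hK hA hM'
  obtain ⟨γ, hγ, hγΨ⟩ := hreg Ψ Ψ' hΨ hΨ'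
  refine ⟨(twist hf (y + shift 0 ⟨γ, hγ⟩ x) ⟨γ, hγ⟩).1, Subtype.property _, ?_⟩
  refine (twist_smul_flag hf _ x ⟨γ, hγ⟩ Ψ).trans ?_
  have h1 : (⟨γ, hγ⟩ : ↥(orderAut K)) • Ψ = Ψ' := hγΨ
  rw [h1]
  congr 1
  funext v
  simp only [shift, Pi.add_apply, zero_add, add_assoc]
  rw [BooleanRing.add_self, add_zero]

end DTwo

namespace FacetTwist

/-- Conjugate the twisted group inside the ambient group. -/
def conj {V H : Type*} [Group H] [MulAction ↥(orderAut K) V] (D : FacetTwist K rk V H) (h : H) :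
    FacetTwist K rk V H :=
  { D with
    T := fun a g => h * D.T a g * h⁻¹
    T_mul := fun a g b k => by rw [← D.T_mul]; group
    T_inj := fun a g b k e => D.T_inj _ _ _ _ (mul_left_cancel (mul_right_cancel e)) }

theorem conj_ϱ {V H : Type*} [Group H] [MulAction ↥(orderAut K) V] (D : FacetTwist K rk V H)
    (h : H) : (D.conj h).ϱ = fun i => h * D.ϱ i * h⁻¹ := by
  funext i
  induction i using Fin.lastCases with
  | last => rw [ϱ_last, ϱ_last]; rfl
  | cast i => rw [ϱ_castSucc, ϱ_castSucc]; rfl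

end FacetTwist

namespace DTwo

variable [Finite K] [MulAction ↥(orderAut K) (polyVertices Kᵒᵈ (dualRk rk 4))]
  (hf : ∀ (g : ↥(orderAut K)) (v : polyVertices Kᵒᵈ (dualRk rk 4)), facet (g • v) = g • facet v)

/-- The generators of the twisted group are distinguished for the flag through `0`. -/
theorem isDistinguishedGens (hA : IsAtomistic K rk 4)
    (D : FacetTwist K rk (polyVertices Kᵒᵈ (dualRk rk 4)) ↥(orderAut (D2 K rk 4)))
    (hfct : D.fct = facet) (hT : D.T = twist hf) :
    IsDistinguishedGens (D2 K rk 4) rank 5 (flag D.Φ 0) D.ϱ := by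
  have hK := D.isPolytope
  refine ⟨isMaxFlag_flag hK hA D.gens.1 0, fun i => ?_⟩
  change D.ϱ i • (flag D.Φ 0 : Set (D2 K rk 4)) ≠ _ ∧ ∀ X ∈ flag D.Φ 0, rank X ≠ i →
    X ∈ D.ϱ i • (flag D.Φ 0 : Set (D2 K rk 4))
  induction i using Fin.lastCases with
  | last =>
    rw [D.ϱ_last, hT, twist_smul_flag, one_smul, shift_zero_right]
    constructor
    · intro h
      obtain ⟨T, hTΦ, hTr⟩ := hK.exists_mem_rank D.gens.1 (k := 4) (by omega) (by omega)
      have h1 : (face T 0 : D2 K rk 4) ∈ flag D.Φ (FacetTwist.ind D.v₀) := by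
        rw [h]
        exact (face_mem_flag_iff hA).2 ⟨hTΦ, fun _ _ => rfl⟩
      have h2 := ((face_mem_flag_iff hA).1 h1).2 D.v₀ (eq_of_forall_top hK hTr _)
      rw [FacetTwist.ind_apply_self] at h2
      exact absurd h2 (zero_ne_one (α := Bool))
    · rintro X (rfl | ⟨F, hF, rfl⟩) hr
      · exact topFace_mem_flag _ _
      · rw [rank_face hA] at hr
        refine (face_mem_flag_iff hA).2 ⟨hF, fun v hv => ?_⟩
        rw [FacetTwist.ind_apply_of_ne]
        · rfl
        · rintro rfl
          refine hv ?_
          rw [← hfct, D.fct_v₀]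
          refine hK.le_of_rank_le D.gens.1 hF (D.f_mem 3) ?_
          have := hK.rank_le F
          have := D.rk_f 3
          simp only [Fin.val_last] at hr
          simp at this
          omega
  | cast i =>
    rw [D.ϱ_castSucc, hT, twist_smul_flag, shift_zero_right]
    constructor
    · intro h
      refine IsPolytope.gen_smul_flag_ne D.gens i ?_
      ext F
      have h1 := Set.ext_iff.1 h (face F 0)
      rw [face_mem_flag_iff hA, face_mem_flag_iff hA] at h1
      simpa using h1
    · rintro X (rfl | ⟨F, hF, rfl⟩) hr
      · exact topFace_mem_flag _ _
      · rw [rank_face hA] at hr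
        exact (face_mem_flag_iff hA).2 ⟨(D.gens.2 i).2 F hF hr, fun _ _ => rfl⟩

/-- All distinguished generators of `D2K` come from conjugate copies of the twisted group. -/
theorem exists_eq_conj_ϱ (hA : IsAtomistic K rk 4)
    (D : FacetTwist K rk (polyVertices Kᵒᵈ (dualRk rk 4)) ↥(orderAut (D2 K rk 4)))
    (hfct : D.fct = facet) (hT : D.T = twist hf) {Ψ : Set (D2 K rk 4)}
    {τ : Fin 5 → ↥(orderAut (D2 K rk 4))} (hτ : IsDistinguishedGens (D2 K rk 4) rank 5 Ψ τ) :
    ∃ h, τ = (D.conj h).ϱ := by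
  have hD := isPolytope D.isPolytope hA
  have hB := isDistinguishedGens hf hA D hfct hT
  obtain ⟨α, hα, rfl⟩ := isRegularPolytope hf D.isPolytope hA D.isRegular _ Ψ hB.1 hτ.1
  refine ⟨⟨α, hα⟩, ?_⟩
  rw [D.conj_ϱ]
  exact hD.gens_unique hτ (hD.isDistinguishedGens_conj hB ⟨α, hα⟩)

end DTwo

end DTwoAut

theorem DTwo.isAtomistic_of_forall {K : Type*} [PartialOrder K] {rk : K → ℤ}
    (h : ∀ x y : K, (∀ v, rk v = 3 → y ≤ v → x ≤ v) → x ≤ y) : DTwo.IsAtomistic K rk 4 := by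
  intro x y hxy
  refine h x y fun w hw => ?_
  obtain ⟨v, rfl⟩ := DTwo.exists_facet (rk := rk) (n := 4) (x := w) (by rw [hw]; norm_num)
  exact hxy v

theorem DTwo.card_coordinates {K : Type*} [PartialOrder K] (rk : K → ℤ) :
    Nat.card (polyVertices Kᵒᵈ (dualRk rk 4)) = {x : K | rk x = 3}.ncard := by
  rw [← Set.ncard_univ, ← Set.ncard_image_of_injective _ (DTwo.facet_injective (rk := rk) (n := 4))]
  congr 1
  ext x
  constructor
  · rintro ⟨v, -, rfl⟩
    have := DTwo.rk_facet v
    change rk (DTwo.facet v) = 3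
    rw [this]
    norm_num
  · intro hx
    obtain ⟨v, hv⟩ := DTwo.exists_facet (rk := rk) (n := 4) (x := x)
      (by rw [show rk x = 3 from hx]; norm_num)
    exact ⟨v, Set.mem_univ v, hv⟩

/-- for `K` the 120-cell `{5,3,3}`, the polytope
`D2K = (2^{K*})*` is a non-degenerate regular polytope of rank 5 of type
`{5,3,3,4}`, its halving group has order `2^119 · 14400`, and `Γ(H(D2K))` is
a finite regular rank-5 hypertope of type `{5, 3, ₃³}`. -/
theorem halving_D2_120cell {K : Type*} [PartialOrder K]
    (rkK : K → ℤ) [Finite K]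
    (hK : IsPolytope K rkK 4) (hnd : NonDegenerate K rkK)
    (hreg : IsRegularPolytope K)
    (ΦK : Set K) (ϱK : Fin 4 → ↥(orderAut K))
    (hϱK : IsDistinguishedGens K rkK 4 ΦK ϱK)
    (h5 : orderOf (ϱK 0 * ϱK 1) = 5) (h3 : orderOf (ϱK 1 * ϱK 2) = 3)
    (h3' : orderOf (ϱK 2 * ϱK 3) = 3)
    (haut : Nat.card ↥(orderAut K) = 14400) :
    (∃ rkC : genCube Kᵒᵈ (dualRk rkK 4) → ℤ,
      IsPolytope (genCube Kᵒᵈ (dualRk rkK 4)) rkC 5) ∧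
    ∀ rkC : genCube Kᵒᵈ (dualRk rkK 4) → ℤ,
      IsPolytope (genCube Kᵒᵈ (dualRk rkK 4)) rkC 5 →
      -- `D2K` is a non-degenerate regular polytope of rank 5 of type `{5,3,3,4}`
      IsPolytope (D2 K rkK 4) (dualRk rkC 5) 5 ∧
      NonDegenerate (D2 K rkK 4) (dualRk rkC 5) ∧
      IsRegularPolytope (D2 K rkK 4) ∧
      ∀ (ΦD : Set (D2 K rkK 4)) (ϱ : Fin 5 → ↥(orderAut (D2 K rkK 4))),
        IsDistinguishedGens (D2 K rkK 4) (dualRk rkC 5) 5 ΦD ϱ →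
          (orderOf (ϱ 0 * ϱ 1) = 5 ∧ orderOf (ϱ 1 * ϱ 2) = 3 ∧
            orderOf (ϱ 2 * ϱ 3) = 3 ∧ orderOf (ϱ 3 * ϱ 4) = 4) ∧
          -- the halving group has order `2^119 · 14400`
          Nat.card ↥(Subgroup.closure (Set.range (halvingGens 5 ϱ))) =
            2 ^ 119 * 14400 ∧
          -- `Γ(H(D2K))` is a finite regular rank-5 hypertope …
          Finite (halvingCosetSystem 5 ϱ).X ∧
          (halvingCosetSystem 5 ϱ).IsRegularHypertope ∧
          -- … of type `{5, 3, ₃³}` (tail-triangle Coxeter diagram)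
          orderOf (halvingGens 5 ϱ 0 * halvingGens 5 ϱ 1) = 5 ∧
          orderOf (halvingGens 5 ϱ 1 * halvingGens 5 ϱ 2) = 3 ∧
          orderOf (halvingGens 5 ϱ 2 * halvingGens 5 ϱ 3) = 3 ∧
          orderOf (halvingGens 5 ϱ 2 * halvingGens 5 ϱ 4) = 3 ∧
          orderOf (halvingGens 5 ϱ 3 * halvingGens 5 ϱ 4) = 2 ∧
          orderOf (halvingGens 5 ϱ 0 * halvingGens 5 ϱ 2) = 2 ∧
          orderOf (halvingGens 5 ϱ 0 * halvingGens 5 ϱ 3) = 2 ∧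
          orderOf (halvingGens 5 ϱ 0 * halvingGens 5 ϱ 4) = 2 ∧
          orderOf (halvingGens 5 ϱ 1 * halvingGens 5 ϱ 3) = 2 ∧
          orderOf (halvingGens 5 ϱ 1 * halvingGens 5 ϱ 4) = 2 := by
  have hex : ∀ i : ℕ, ∃ x : K, i < 4 → x ∈ ΦK ∧ rkK x = i := by
    intro i
    by_cases hi : i < 4
    · obtain ⟨x, hx, hr⟩ := hK.exists_mem_rank hϱK.1 (k := i) (by omega) (by omega)
      exact ⟨x, fun _ => ⟨hx, hr⟩⟩
    · obtain ⟨b, -⟩ := hK.1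
      exact ⟨b, fun h => absurd h hi⟩
  choose F hF using hex
  have h120 : IsOneTwentyCell rkK ΦK ϱK F :=
    { isPolytope := hK
      isRegular := hreg
      gens := hϱK
      pow_five := orderOf_dvd_iff_pow_eq_one.1 h5.dvd
      pow_three := orderOf_dvd_iff_pow_eq_one.1 h3.dvd
      pow_three' := orderOf_dvd_iff_pow_eq_one.1 h3'.dvd
      card := haut
      mem := fun i hi => (hF i hi).1
      rk_eq := fun i hi => (hF i hi).2 }
  have hA : DTwo.IsAtomistic K rkK 4 :=
    DTwo.isAtomistic_of_forall fun x y => h120.le_of_forall_facet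
  have hD := DTwo.isPolytope hK hA
  let := DTwo.facetAction hK
  let : Fintype (polyVertices Kᵒᵈ (dualRk rkK 4)) := Fintype.ofFinite _
  have hf : ∀ (g : ↥(orderAut K)) (v : polyVertices Kᵒᵈ (dualRk rkK 4)),
    DTwo.facet (g • v) = g • DTwo.facet v := fun _ _ => rfl
  have hregD := DTwo.isRegularPolytope hf hK hA hreg
  refine ⟨⟨_, hD.dual⟩, fun rkC hC => ?_⟩
  have hC' : IsPolytope (D2 K rkK 4) (dualRk rkC 5) 5 := hC.dual
  have hrk : dualRk rkC 5 = (DTwo.rank : D2 K rkK 4 → ℤ) := hC'.rank_unique hD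
  rw [hrk]
  refine ⟨hD, DTwo.nonDegenerate hK hA hnd, hregD, fun ΦD ϱ hϱ => ?_⟩
  obtain ⟨v₀, hv₀⟩ := DTwo.exists_facet (rk := rkK) (n := 4) (x := F 3)
    (by rw [(hF 3 (by norm_num)).2]; norm_num)
  let D₀ : FacetTwist K rkK (polyVertices Kᵒᵈ (dualRk rkK 4)) ↥(orderAut (D2 K rkK 4)) :=
    { Φ := ΦK
      σ := ϱK
      f := fun i => F i
      fct := DTwo.facet
      v₀ := v₀
      T := DTwo.twist hf
      isPolytope := hK
      isRegular := hreg
      gens := hϱK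
      f_mem := fun i => (hF i i.isLt).1
      rk_f := fun i => (hF i i.isLt).2
      fct_inj := DTwo.facet_injective
      rk_fct := fun v => (DTwo.rk_facet v).trans (by norm_num)
      fct_smul := hf
      fct_v₀ := hv₀
      T_mul := DTwo.twist_mul hf
      T_inj := DTwo.twist_inj hf hK hA }
  obtain ⟨α, rfl⟩ := DTwo.exists_eq_conj_ϱ hf hA D₀ rfl rfl hϱ
  have hcard : Fintype.card (polyVertices Kᵒᵈ (dualRk rkK 4)) = 120 := by
    rw [← Nat.card_eq_fintype_card, DTwo.card_coordinates, h120.ncard_facets]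
  generalize hD' : D₀.conj α = D
  have hσ : ϱK = D.σ := by rw [← hD']; rfl
  rw [hσ] at h5 h3 h3'
  refine ⟨⟨?_, ?_, ?_, D.orderOf_ϱ_three_mul_ϱ_four⟩, ?_, ?_, D.isRegularHypertope, ?_, ?_, ?_, ?_,
    D.orderOf_ρ_three_mul_ρ_four, ?_, ?_, ?_, ?_, ?_⟩
  · exact (D.orderOf_ϱ_mul_ϱ 0 1).trans h5
  · exact (D.orderOf_ϱ_mul_ϱ 1 2).trans h3
  · exact (D.orderOf_ϱ_mul_ϱ 2 3).trans h3'
  · rw [D.card_closure, hcard, haut]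
  · change Finite (cosetX (halvingCosetFamily 5 D.ϱ))
    infer_instance
  · exact (D.orderOf_ρ_mul_ρ 0 1).trans h5
  · exact (D.orderOf_ρ_mul_ρ 1 2).trans h3
  · exact (D.orderOf_ρ_mul_ρ 2 3).trans h3'
  · exact (D.orderOf_ρ_mul_ρ_last (i := 2) (by decide)).trans h3'
  · exact (D.orderOf_ρ_mul_ρ 0 2).trans (D.orderOf_σ_mul_σ_eq_two (by decide))
  · exact (D.orderOf_ρ_mul_ρ 0 3).trans (D.orderOf_σ_mul_σ_eq_two (by decide))
  · exact (D.orderOf_ρ_mul_ρ_last (i := 0) (by decide)).trans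
      (D.orderOf_σ_mul_σ_eq_two (by decide))
  · exact (D.orderOf_ρ_mul_ρ 1 3).trans (D.orderOf_σ_mul_σ_eq_two (by decide))
  · exact (D.orderOf_ρ_mul_ρ_last (i := 1) (by decide)).trans
      (D.orderOf_σ_mul_σ_eq_two (by decide))
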